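/- Let w ∈ S∞, φ a flag, n a positive integer, and let e_i denote the Morse–Schilling raising operators on RF_n(w). For every ρ^• ∈ RFC_n(w,φ) and every i with 1 ≤ i < n, if e_i(ρ^•) ≠ 0 then P̂(e_i(ρ^•)) = P̂(ρ^•) and Q̂(e_i(ρ^•)) = e_i(Q̂(ρ^•)), where on the right e_i is the Assaf–Schilling raising operator on key tableaux. -/

import Mathlib

noncomputable section
attribute [local instance] Classical.propDecidable

/-! ### Words, permutations, reduced words -/

/-- The adjacent transposition `s_i` exchanging `i` and `i+1`. -/
def sPerm (i : ℕ) : Equiv.Perm ℕ := Equiv.swap i (i + 1)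

/-- The permutation `s_{i_1} ⋯ s_{i_n}` represented by the word `i_1 ⋯ i_n`. -/
def wordPerm (ρ : List ℕ) : Equiv.Perm ℕ := (ρ.map sPerm).prod

/-- A word whose letters are positive integers. -/
def PosWord (ρ : List ℕ) : Prop := ∀ x ∈ ρ, 1 ≤ x

/-- A reduced word: a word of positive integers of minimal length among all words of
positive integers representing the same permutation. -/
def IsReducedWord (ρ : List ℕ) : Prop :=
  PosWord ρ ∧ ∀ σ : List ℕ, PosWord σ → wordPerm σ = wordPerm ρ → ρ.length ≤ σ.length

/-- `ρ` is a reduced word for the permutation `w`. -/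
def IsReducedWordFor (w : Equiv.Perm ℕ) (ρ : List ℕ) : Prop :=
  IsReducedWord ρ ∧ wordPerm ρ = w

/-- A member of `S∞`: a permutation of the positive integers (it fixes `0`)
fixing all but finitely many points. -/
def FinitaryPerm (w : Equiv.Perm ℕ) : Prop := w 0 = 0 ∧ {i : ℕ | w i ≠ i}.Finite

/-- A flag: a weakly increasing function `φ : ℤ_{>0} → ℤ_{>0}` with `φ(n) ≥ n`. -/
def IsFlag (φ : ℕ → ℕ) : Prop :=
  (∀ m n : ℕ, 1 ≤ m → m ≤ n → φ m ≤ φ n) ∧ ∀ n : ℕ, 1 ≤ n → n ≤ φ n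

/-- A weak composition, as a function on the positive integers (value `0` at `0`)
with finitely many nonzero entries. -/
def WeakComp (α : ℕ → ℕ) : Prop := α 0 = 0 ∧ {i : ℕ | α i ≠ 0}.Finite

/-- `φ - e_i`, i.e. `l ↦ φ(l) - δ_{il}`. -/
def subE (φ : ℕ → ℕ) (i : ℕ) : ℕ → ℕ := fun l => if l = i then φ l - 1 else φ l

/-- The right action of `s_i` on weak compositions, swapping entries `i` and `i+1`. -/
def swapC (α : ℕ → ℕ) (i : ℕ) : ℕ → ℕ := fun j => α (sPerm i j)

/-- `α` has length `k`: `k` is minimal with `α i = 0` for all `i > k`. -/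
def HasLen (α : ℕ → ℕ) (k : ℕ) : Prop :=
  (∀ i, k < i → α i = 0) ∧ ∀ m, (∀ i, m < i → α i = 0) → k ≤ m

/-! ### Coxeter–Knuth equivalence -/

/-- One Coxeter–Knuth move. -/
def CKStep (u v : List ℕ) : Prop :=
  (∃ (a b : List ℕ) (x y z : ℕ), y < x ∧ x < z ∧
      u = a ++ [x, y, z] ++ b ∧ v = a ++ [x, z, y] ++ b) ∨
  (∃ (a b : List ℕ) (x y z : ℕ), y < z ∧ z < x ∧
      u = a ++ [x, y, z] ++ b ∧ v = a ++ [y, x, z] ++ b) ∨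
  (∃ (a b : List ℕ) (i : ℕ),
      u = a ++ [i, i + 1, i] ++ b ∧ v = a ++ [i + 1, i, i + 1] ++ b)

/-- Coxeter–Knuth equivalence: the transitive (symmetric, reflexive) closure of `CKStep`. -/
def CKEquiv : List ℕ → List ℕ → Prop := Relation.EqvGen CKStep

/-! ### Run factorizations and weak descent tableaux -/

/-- The run factorization of a word into maximal strictly increasing blocks
(listed from left to right). -/
def runFact : List ℕ → List (List ℕ)
  | [] => []
  | a :: rest =>
    match runFact rest with
    | [] => [[a]]
    | r :: rs => if a < r.headI then (a :: r) :: rs else [a] :: r :: rs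

/-- Auxiliary: rows of the remaining blocks, given the row of the previous block. -/
def wdtRowsAux : ℤ → List (List ℕ) → List ℤ
  | _, [] => []
  | prev, b :: bs =>
      min (prev - 1) (b.headI : ℤ) :: wdtRowsAux (min (prev - 1) (b.headI : ℤ)) bs

/-- The row indices assigned to the blocks of a run factorization (blocks listed
left to right): the leftmost block goes to the row indexed by its first letter, and each
subsequent block goes to the row indexed by its first letter if this is below the previous
block's row, and otherwise directly below the previous block's row. -/
def wdtRows : List (List ℕ) → List ℤ
  | [] => []
  | b :: bs => (b.headI : ℤ) :: wdtRowsAux (b.headI : ℤ) bs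

/-- A tableau: rows indexed by `ℤ` (bottom to top), columns indexed by `ℕ` starting at `1`;
the value `0` means that there is no box, a nonzero value is the (positive) entry. -/
abbrev Tableau := ℤ → ℕ → ℕ

/-- The weak descent tableau of a word. -/
def weakDesTab (ρ : List ℕ) : Tableau := fun r c =>
  if c = 0 then 0
  else
    match ((wdtRows (runFact ρ)).zip (runFact ρ)).find? (fun p => decide (p.1 = r)) with
    | some p => p.2.getD (c - 1) 0
    | none => 0

/-- A word is non-virtual if its weak descent tableau only occupies rows of positive index. -/
def NonVirtual (ρ : List ℕ) : Prop := ∀ r ∈ wdtRows (runFact ρ), 1 ≤ r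

/-- The shape of a tableau: the number of boxes in each (positively indexed) row. -/
def shapeOf (T : Tableau) : ℕ → ℕ := fun i => Set.ncard {c : ℕ | T (i : ℤ) c ≠ 0}

/-- The weak descent composition of a word: the shape of its weak descent tableau. -/
def desComp (ρ : List ℕ) : ℕ → ℕ := shapeOf (weakDesTab ρ)

/-- Partial-sum (dominance) order on weak compositions. -/
def compLE (μ ν : ℕ → ℕ) : Prop :=
  ∀ k : ℕ, ∑ i ∈ Finset.Icc 1 k, μ i ≤ ∑ i ∈ Finset.Icc 1 k, ν i

/-- A Yamanouchi reduced word: a non-virtual reduced word that is minimal in its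
Coxeter–Knuth class among non-virtual words, for the order
`ρ ≤ τ ↔ ρ ~ τ ∧ des ρ ≤ des τ`. -/
def Yamanouchi (ρ : List ℕ) : Prop :=
  IsReducedWord ρ ∧ NonVirtual ρ ∧
    ∀ σ : List ℕ, NonVirtual σ → CKEquiv ρ σ → compLE (desComp ρ) (desComp σ)

/-- The (unique) Yamanouchi reduced word Coxeter–Knuth equivalent to `ρ`. -/
def hatRho (ρ : List ℕ) : List ℕ :=
  if h : ∃ σ, Yamanouchi σ ∧ CKEquiv ρ σ then h.choose else []

/-- The weak Edelman–Greene insertion tableau of a word: the weak descent tableau of the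
unique Yamanouchi reduced word Coxeter–Knuth equivalent to it. -/
def hatP (ρ : List ℕ) : Tableau := weakDesTab (hatRho ρ)

/-! ### Factorizations -/

/-- The factorization `f : ℕ → List ℕ` stores the block `ρ^{(i)}` at index `i ≥ 1`
(blocks indexed from the right); the largest index of a nonempty block. -/
def topIdx (f : ℕ → List ℕ) : ℕ := sSup {i : ℕ | f i ≠ []}

/-- The concatenation `ρ^{(top)} ⋯ ρ^{(i+1)} ρ^{(i)}` of the blocks of `f` with index `≥ i`. -/
def factWordGe (f : ℕ → List ℕ) (i : ℕ) : List ℕ :=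
  ((((List.range (topIdx f + 1)).reverse).filter (fun j => decide (i ≤ j))).map f).foldr
    (· ++ ·) []

/-- The underlying word of a factorization. -/
def factWord (f : ℕ → List ℕ) : List ℕ := factWordGe f 0

/-- The weak Edelman–Greene recording tableau of a factorization: it has the same shape as
the weak EG insertion tableau of the underlying word, and has entry `i` in all boxes of
`P̂(ρ^{(k)}|⋯|ρ^{(i)})` that are not in `P̂(ρ^{(k)}|⋯|ρ^{(i+1)})`. -/
def hatQfact (f : ℕ → List ℕ) : Tableau := fun r c =>
  sSup {i : ℕ | 1 ≤ i ∧ hatP (factWordGe f i) r c ≠ 0 ∧ hatP (factWordGe f (i + 1)) r c = 0}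

/-- Every block is strictly increasing. -/
def IncreasingFact (f : ℕ → List ℕ) : Prop := ∀ i, List.Chain' (· < ·) (f i)

/-- The factorization is `φ`-flagged: every nonempty block `ρ^{(i)}` has first letter
`ρ^{(i)}_1` with `φ(ρ^{(i)}_1) ≥ i`. -/
def FlaggedFact (φ : ℕ → ℕ) (f : ℕ → List ℕ) : Prop :=
  ∀ i, f i ≠ [] → i ≤ φ ((f i).headI)

/-- `RFC(w, φ)`: all `φ`-flagged increasing factorizations of reduced words for `w`. -/
def RFCset (w : Equiv.Perm ℕ) (φ : ℕ → ℕ) : Set (ℕ → List ℕ) :=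
  {f | f 0 = [] ∧ {i : ℕ | f i ≠ []}.Finite ∧ IncreasingFact f ∧ FlaggedFact φ f ∧
       IsReducedWordFor w (factWord f)}

/-- `RF_n(w)`: increasing factorizations of reduced words for `w` with exactly `n` blocks
(indexed `1, …, n`, possibly empty). -/
def RFn (n : ℕ) (w : Equiv.Perm ℕ) : Set (ℕ → List ℕ) :=
  {f | f 0 = [] ∧ (∀ j, n < j → f j = []) ∧ IncreasingFact f ∧
       IsReducedWordFor w (factWord f)}

/-- `RFC_n(w, φ)`: the `φ`-flagged elements of `RF_n(w)`. -/
def RFCn (n : ℕ) (w : Equiv.Perm ℕ) (φ : ℕ → ℕ) : Set (ℕ → List ℕ) :=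
  {f | f ∈ RFn n w ∧ FlaggedFact φ f}

/-! ### Morse–Schilling crystal operators -/

/-- Pairing procedure: first argument is the block `r^{(i)}` in *decreasing* order, second is
the not-yet-paired part of the block `r^{(i+1)}` (in increasing order). Each letter `b` of
`r^{(i)}`, from largest to smallest, is paired with the smallest still unpaired letter of
`r^{(i+1)}` strictly larger than `b`. Returns the unpaired letters of `r^{(i+1)}`. -/
def unpairedUpper : List ℕ → List ℕ → List ℕ
  | [], A => A
  | b :: bs, A =>
    match A.find? (fun a => decide (b < a)) with
    | some a => unpairedUpper bs (A.erase a)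
    | none => unpairedUpper bs A

/-- As in `unpairedUpper`, but returns the unpaired letters of `r^{(i)}`. -/
def unpairedLower : List ℕ → List ℕ → List ℕ
  | [], _ => []
  | b :: bs, A =>
    match A.find? (fun a => decide (b < a)) with
    | some a => unpairedLower bs (A.erase a)
    | none => b :: unpairedLower bs A

/-- Insert a letter into a weakly increasing list, keeping it increasing. -/
def insAsc (x : ℕ) : List ℕ → List ℕ
  | [] => [x]
  | y :: ys => if x ≤ y then x :: y :: ys else y :: insAsc x ys

/-- The Morse–Schilling raising operator `e_i`: if every letter of block `i+1` is paired,
the result is `none` (i.e. `0`); otherwise the largest unpaired letter `a` of block `i+1` is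
removed and `a + s` is added to block `i`, where `s = min {j ≥ 0 | a+j+1 ∉ r^{(i+1)}}`. -/
def msE (i : ℕ) (f : ℕ → List ℕ) : Option (ℕ → List ℕ) :=
  let B := f i
  let A := f (i + 1)
  let L := unpairedUpper B.reverse A
  if L = [] then none
  else
    let a := L.foldr max 0
    let s := sInf {j : ℕ | (a + j + 1) ∉ A}
    some (Function.update (Function.update f (i + 1) (A.erase a)) i (insAsc (a + s) B))

/-- The Morse–Schilling lowering operator `f_i`: if every letter of block `i` is paired,
the result is `none`; otherwise the smallest unpaired letter `b` of block `i` is removed and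
`b - t` is added to block `i+1`, where `t = min {j ≥ 0 | b-j-1 ∉ r^{(i)}}`. -/
def msF (i : ℕ) (f : ℕ → List ℕ) : Option (ℕ → List ℕ) :=
  let B := f i
  let A := f (i + 1)
  let R := unpairedLower B.reverse A
  if R = [] then none
  else
    let b := R.foldr min R.headI
    let t := sInf {j : ℕ | (b - j - 1) ∉ B}
    some (Function.update (Function.update f i (B.erase b)) (i + 1) (insAsc (b - t) A))

/-- Iteration `e_j^k` of the raising operator. -/
def msEIter (j : ℕ) : ℕ → (ℕ → List ℕ) → Option (ℕ → List ℕ)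
  | 0, f => some f
  | k + 1, f => (msE j f).bind (msEIter j k)

/-- The Demazure operator `𝔇_j` on subsets of the crystal `RF_n(w)`:
`𝔇_j X = {b ∈ RF_n(w) | e_j^k(b) ∈ X for some k ≥ 0}`. -/
def demOp (n : ℕ) (w : Equiv.Perm ℕ) (j : ℕ) (X : Set (ℕ → List ℕ)) : Set (ℕ → List ℕ) :=
  {b | b ∈ RFn n w ∧ ∃ (k : ℕ) (c : ℕ → List ℕ), msEIter j k b = some c ∧ c ∈ X}

/-- `𝔇_{i_1} 𝔇_{i_2} ⋯ 𝔇_{i_k} X` for a word `i_1 i_2 ⋯ i_k` (the head is applied last). -/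
def demWord (n : ℕ) (w : Equiv.Perm ℕ) : List ℕ → Set (ℕ → List ℕ) → Set (ℕ → List ℕ)
  | [], X => X
  | j :: rest, X => demOp n w j (demWord n w rest X)

/-- `𝔇_{b↓a} = 𝔇_{b-1} 𝔇_{b-2} ⋯ 𝔇_a` (the identity when `b ≤ a`). -/
def demDown (n : ℕ) (w : Equiv.Perm ℕ) (b a : ℕ) (X : Set (ℕ → List ℕ)) :
    Set (ℕ → List ℕ) :=
  demWord n w ((List.range' a (b - a)).reverse) X

/-! ### Key tableaux -/

/-- A key tableau: a filling of a left-justified diagram in the positively indexed rows,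
with positive entries, weakly decreasing rows, distinct column entries, and the key
condition (c) of Assaf–Schilling. -/
def IsKeyTableau (T : Tableau) : Prop :=
  (∀ (r : ℤ) (c : ℕ), r ≤ 0 → T r c = 0) ∧
  (∀ r : ℤ, T r 0 = 0) ∧
  {p : ℤ × ℕ | T p.1 p.2 ≠ 0}.Finite ∧
  (∀ (r : ℤ) (c : ℕ), 1 ≤ c → T r (c + 1) ≠ 0 → T r c ≠ 0) ∧
  (∀ (r : ℤ) (c : ℕ), 1 ≤ c → T r (c + 1) ≠ 0 → T r (c + 1) ≤ T r c) ∧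
  (∀ (r r' : ℤ) (c : ℕ), r ≠ r' → T r c ≠ 0 → T r' c ≠ 0 → T r c ≠ T r' c) ∧
  (∀ (r r' : ℤ) (c : ℕ), r < r' → T r c ≠ 0 → T r' c ≠ 0 → T r' c < T r c →
      T r (c + 1) ≠ 0 ∧ T r' c < T r (c + 1))

/-- The tableau is `φ`-flagged: every entry in row `i` is at most `φ(i)`. -/
def FlaggedTab (φ : ℕ → ℕ) (T : Tableau) : Prop := ∀ (i c : ℕ), T (i : ℤ) c ≤ φ i

/-- `SSKT(α, φ)`: the `φ`-flagged key tableaux of shape `α`. -/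
def SSKT (α φ : ℕ → ℕ) : Set Tableau :=
  {T | IsKeyTableau T ∧ shapeOf T = α ∧ FlaggedTab φ T}

/-- The weight of a tableau: `wt(T)_v` is the number of entries equal to `v`. -/
def wtTab (T : Tableau) : ℕ → ℕ := fun v =>
  if v = 0 then 0 else Set.ncard {p : ℤ × ℕ | T p.1 p.2 = v}

/-- The weight of a word: the multiplicity of each positive letter. -/
def wtWord (u : List ℕ) : ℕ → ℕ := fun v => if v = 0 then 0 else u.count v

/-- The statistic `m_i(col(T), j)` where position `j` of the reverse column reading word
(entries read down columns, from right to left) is the box in row `r`, column `c`: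
the number of entries `i+1` weakly after this box minus the number of entries `i`. -/
def mi (T : Tableau) (i : ℕ) (r : ℤ) (c : ℕ) : ℤ :=
  (Set.ncard {p : ℤ × ℕ | T p.1 p.2 = i + 1 ∧ (p.2 < c ∨ (p.2 = c ∧ p.1 ≤ r))} : ℤ) -
  (Set.ncard {p : ℤ × ℕ | T p.1 p.2 = i ∧ (p.2 < c ∨ (p.2 = c ∧ p.1 ≤ r))} : ℤ)

/-- The box `(r, c)` maximizes `m_i` among all boxes of `T`. -/
def isMaxBox (T : Tableau) (i : ℕ) (r : ℤ) (c : ℕ) : Prop :=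
  T r c ≠ 0 ∧ ∀ (r' : ℤ) (c' : ℕ), T r' c' ≠ 0 → mi T i r' c' ≤ mi T i r c

/-- The Assaf–Schilling raising operator `e_i` on key tableaux.  If `m_i(col(T)) ≤ 0` the
result is `none` (i.e. `0`); otherwise, with `q` the largest position of the reverse column
reading word achieving the maximum (i.e. the maximizing box with the smallest column index,
and the smallest row index in that column), all entries `i+1` in the row of `q` weakly to its
right are changed to `i`, and all entries `i` in the same columns as these entries are
changed to `i+1`. -/
def keyE (i : ℕ) (T : Tableau) : Option Tableau :=
  if h : ∃ (r : ℤ) (c : ℕ), isMaxBox T i r c ∧ 1 ≤ mi T i r c then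
    let cq := sInf {c : ℕ | ∃ r : ℤ, isMaxBox T i r c}
    let rq : ℤ := ((sInf {m : ℕ | isMaxBox T i ((m : ℕ) : ℤ) cq} : ℕ) : ℤ)
    some (fun r c =>
      if cq ≤ c ∧ T rq c = i + 1 then
        (if T r c = i + 1 then i else if T r c = i then i + 1 else T r c)
      else T r c)
  else none

/-- The Assaf–Schilling lowering operator `f_i`: the (unique) inverse of `e_i`. -/
def keyF (i : ℕ) (T : Tableau) : Option Tableau :=
  if h : ∃ T', keyE i T' = some T then some h.choose else none

/-- Restriction of a partially defined crystal operator to a subset: the operator returns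
`none` (i.e. `0`) whenever it would leave the subset. -/
def restrictOp {β : Type} (S : Set β) (op : β → Option β) (x : β) : Option β :=
  (op x).bind fun y => if y ∈ S then some y else none

/-! ### Polynomials: divided differences and key polynomials -/

/-- The divided difference operator `∂_i f = (f - s_i · f) / (x_i - x_{i+1})`. -/
def divDiff (i : ℕ) (fp : MvPolynomial ℕ ℤ) : MvPolynomial ℕ ℤ :=
  if h : ∃ g : MvPolynomial ℕ ℤ,
      g * (MvPolynomial.X i - MvPolynomial.X (i + 1)) =
        fp - MvPolynomial.rename (fun j => sPerm i j) fp
  then h.choose else 0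

/-- The isobaric divided difference operator `π_i f = ∂_i (x_i f)`. -/
def piOp (i : ℕ) (fp : MvPolynomial ℕ ℤ) : MvPolynomial ℕ ℤ :=
  divDiff i (MvPolynomial.X i * fp)

/-- `π_{i_1} π_{i_2} ⋯ π_{i_k} f` for a word `i_1 i_2 ⋯ i_k` (the head is applied last). -/
def piWord : List ℕ → MvPolynomial ℕ ℤ → MvPolynomial ℕ ℤ
  | [], fp => fp
  | i :: rest, fp => piOp i (piWord rest fp)

/-- `π_{b↓a} = π_{b-1} π_{b-2} ⋯ π_a` (the identity when `b ≤ a`). -/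
def piDown (b a : ℕ) (fp : MvPolynomial ℕ ℤ) : MvPolynomial ℕ ℤ :=
  piWord ((List.range' a (b - a)).reverse) fp

/-- The conjugate of a weak composition: `conjC α t = #{j ≥ 1 | α_j ≥ t}` for `t ≥ 1`. -/
def conjC (α : ℕ → ℕ) (t : ℕ) : ℕ :=
  Set.ncard {j : ℕ | 1 ≤ j ∧ 1 ≤ t ∧ t ≤ α j}

/-- The partition rearrangement of a weak composition (the conjugate of its conjugate). -/
def sortC (α : ℕ → ℕ) : ℕ → ℕ := conjC (conjC α)

/-- The length of a permutation: the common length of its reduced words. -/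
def permLength (w : Equiv.Perm ℕ) : ℕ :=
  sInf {n : ℕ | ∃ ρ : List ℕ, PosWord ρ ∧ wordPerm ρ = w ∧ ρ.length = n}

/-- The monomial `x^β = x_1^{β_1} x_2^{β_2} ⋯`. -/
def xExp (β : ℕ → ℕ) : MvPolynomial ℕ ℤ :=
  ∏ i ∈ Finset.range (sSup {n : ℕ | β n ≠ 0} + 1), MvPolynomial.X i ^ β i

/-- The key polynomial `κ_α = π_w x^λ` where `λ` is the partition rearrangement of `α` and
`w` is the minimal-length permutation of `S∞` with `α · w = λ`. -/
def keyPoly (α : ℕ → ℕ) : MvPolynomial ℕ ℤ :=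
  if h : ∃ (ρ : List ℕ) (w : Equiv.Perm ℕ), IsReducedWordFor w ρ ∧
      (∀ i, α (w i) = sortC α i) ∧
      (∀ v : Equiv.Perm ℕ, (∃ τ, IsReducedWordFor v τ) → (∀ i, α (v i) = sortC α i) →
        permLength w ≤ permLength v)
  then piWord h.choose (xExp (sortC α)) else 0

/-- The `φ`-flagged key polynomial `κ_{(α,φ)} = Σ_{T ∈ SSKT(α,φ)} x^{wt(T)}`. -/
def flaggedKeyPoly (α φ : ℕ → ℕ) : MvPolynomial ℕ ℤ :=
  ∑ᶠ T ∈ SSKT α φ, xExp (wtTab T)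

/-! ### Column insertion, keys, standardization -/

/-- The number of boxes in column `c` of a tableau. -/
def colHeightN (T : Tableau) (c : ℕ) : ℕ := Set.ncard {r : ℤ | T r c ≠ 0}

/-- One pass of column insertion: insert the value `x` starting at column `c`
(`fuel` bounds the number of columns visited). -/
def colInsertAux : ℕ → Tableau → ℕ → ℕ → Tableau
  | 0, T, _, _ => T
  | fuel + 1, T, c, x =>
    if ∀ r : ℤ, T r c ≠ 0 → T r c < x then
      -- x is greater than every entry of column c: place it at the end of the column
      fun r c' => if c' = c ∧ r = (colHeightN T c + 1 : ℤ) then x else T r c'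
    else if ∃ r : ℤ, T r c = x then
      -- column c contains x: move on to the next column with the same value
      colInsertAux fuel T (c + 1) x
    else
      -- bump the smallest entry of column c that is larger than x
      let y := sInf {v : ℕ | x < v ∧ ∃ r : ℤ, T r c = v}
      colInsertAux fuel (fun r c' => if c' = c ∧ T r c' = y then x else T r c') (c + 1) y

/-- Column insertion of `x` into the semistandard Young tableau `T`. -/
def colInsert (T : Tableau) (x : ℕ) : Tableau :=
  colInsertAux (sSup {c : ℕ | ∃ r : ℤ, T r c ≠ 0} + 2) T 1 x

/-- The insertion tableau `P` of `(v → ∅)`: successively column insert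
`v_n, v_{n-1}, …, v_1` into the empty tableau. -/
def insertP (v : List ℕ) : Tableau :=
  v.reverse.foldl colInsert (fun _ _ => 0)

/-- The recording tableau `Q` of `(v → ∅)`: the standard Young tableau whose restriction to
`{1, …, j}` has the same shape as the insertion tableau of the last `j` letters of `v`. -/
def insertQ (v : List ℕ) : Tableau := fun r c =>
  sInf {j : ℕ | insertP (v.drop (v.length - j)) r c ≠ 0}

/-- The key `key(α)`: the unique semistandard Young tableau of weight `α` such that the set
of entries of column `i+1` is a subset of the entries of column `i`; its column `c` consists
of the elements of `{x ≥ 1 | α_x ≥ c}` in increasing order from bottom to top. -/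
def keyTab (α : ℕ → ℕ) : Tableau := fun r c =>
  if c = 0 then 0
  else sInf {x : ℕ | 1 ≤ x ∧ c ≤ α x ∧
    ((Set.ncard {y : ℕ | 1 ≤ y ∧ c ≤ α y ∧ y ≤ x} : ℕ) : ℤ) = r}

/-- The standardization of a semistandard Young tableau: the `1`'s are replaced from left to
right by `1, …, β_1`, the `2`'s by `β_1 + 1, …, β_1 + β_2`, and so on. -/
def stdTab (T : Tableau) : Tableau := fun r c =>
  if T r c = 0 then 0
  else Set.ncard {p : ℤ × ℕ |
    T p.1 p.2 ≠ 0 ∧ (T p.1 p.2 < T r c ∨ (T p.1 p.2 = T r c ∧ p.2 ≤ c))}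

/-! ### Maximal factorizations (Reiner–Shimozono) -/

/-- Every block is weakly increasing. -/
def WeaklyIncrFact (g : ℕ → List ℕ) : Prop := ∀ i, List.Chain' (· ≤ ·) (g i)

/-- Maximality: the nonempty blocks have maximal length, i.e. there is a strict descent
between any two consecutive nonempty blocks (no letter can be moved from the end of a block
to the front of the next one to the right). -/
def MaxFact (g : ℕ → List ℕ) : Prop :=
  ∀ i j : ℕ, 1 ≤ i → i < j → g i ≠ [] → g j ≠ [] → (∀ m, i < m → m < j → g m = []) →
    (g i).headI < (g j).getLastD 0

/-- Reiner–Shimozono's set `𝒲(α, φ)` of `φ`-flagged maximal factorizations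
`u^• = u^n ⋯ u^2 u^1` with `ℓ(u^i) = α_i` and `(u → ∅) = (P, std(key(α)))`. -/
def Wset (α φ : ℕ → ℕ) : Set (ℕ → List ℕ) :=
  {g | g 0 = [] ∧ (∀ i, (g i).length = α i) ∧ (∀ i, ∀ x ∈ g i, 1 ≤ x) ∧
       WeaklyIncrFact g ∧ MaxFact g ∧ (∀ i, ∀ x ∈ g i, x ≤ φ i) ∧
       insertQ (factWord g) = stdTab (keyTab α)}

/-! ### Shifts and highest weight key tableaux -/

/-- `shift_N`: add `N` to every letter of every block. -/
def shiftFact (N : ℕ) (f : ℕ → List ℕ) : ℕ → List ℕ := fun i => (f i).map (· + N)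

/-- The tableau of shape `α` whose column `i` is filled by `1, 2, …, λ^T_i` in increasing
order from bottom to top (where `λ^T` is the conjugate of the partition rearrangement `λ`
of `α`): the box of column `c` in row `m` (where `α_m ≥ c`) contains the number of indices
`m' ≤ m` with `α_{m'} ≥ c`. -/
def highKeyTab (α : ℕ → ℕ) : Tableau := fun r c =>
  if c = 0 then 0
  else if ∃ m : ℕ, (m : ℤ) = r ∧ 1 ≤ m ∧ c ≤ α m then
    Set.ncard {m : ℕ | 1 ≤ m ∧ c ≤ α m ∧ (m : ℤ) ≤ r}
  else 0


/-- A `gl_n`-crystal isomorphism between two sets of key tableaux, both equipped with the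
Assaf–Schilling operators (restricted to the sets): a weight-preserving bijection commuting
with all raising and lowering operators `e_i, f_i` for `1 ≤ i < n`. -/
def SSKTIso (n : ℕ) (S₁ S₂ : Set Tableau) : Prop :=
  ∃ g : Tableau → Tableau, Set.BijOn g S₁ S₂ ∧
    (∀ T ∈ S₁, wtTab T = wtTab (g T)) ∧
    ∀ T ∈ S₁, ∀ i : ℕ, 1 ≤ i → i < n →
      Option.map g (restrictOp S₁ (keyE i) T) = restrictOp S₂ (keyE i) (g T) ∧
      Option.map g (restrictOp S₁ (keyF i) T) = restrictOp S₂ (keyF i) (g T)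

namespace WeakEG


/-! ### Basic facts on Coxeter–Knuth equivalence -/

theorem ck_refl (u : List ℕ) : CKEquiv u u := Relation.EqvGen.refl u

theorem ck_symm {u v : List ℕ} (h : CKEquiv u v) : CKEquiv v u := Relation.EqvGen.symm _ _ h

theorem ck_trans {u v w : List ℕ} (h : CKEquiv u v) (h' : CKEquiv v w) : CKEquiv u w :=
  Relation.EqvGen.trans _ _ _ h h'

theorem ck_of_eq {u v : List ℕ} (h : u = v) : CKEquiv u v := h ▸ ck_refl u

theorem ckStep_ctx (a b : List ℕ) {u v : List ℕ} (h : CKStep u v) :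
    CKStep (a ++ u ++ b) (a ++ v ++ b) := by
  rcases h with ⟨p, q, x, y, z, h1, h2, rfl, rfl⟩ | ⟨p, q, x, y, z, h1, h2, rfl, rfl⟩ |
    ⟨p, q, i, rfl, rfl⟩
  · exact Or.inl ⟨a ++ p, q ++ b, x, y, z, h1, h2, by simp, by simp⟩
  · exact Or.inr (Or.inl ⟨a ++ p, q ++ b, x, y, z, h1, h2, by simp, by simp⟩)
  · exact Or.inr (Or.inr ⟨a ++ p, q ++ b, i, by simp, by simp⟩)

/-- Induction principle: a map on words sending steps to equivalences preserves equivalence. -/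
theorem ck_map (F : List ℕ → List ℕ) (P : List ℕ → Prop)
    (hP : ∀ u v, CKStep u v → (P u ↔ P v))
    (hF : ∀ u v, P u → CKStep u v → CKEquiv (F u) (F v)) {u v : List ℕ} (h : CKEquiv u v) :
    (P u ↔ P v) ∧ (P u → CKEquiv (F u) (F v)) := by
  induction h with
  | rel u v h => exact ⟨hP u v h, fun hu => hF u v hu h⟩
  | refl u => exact ⟨Iff.rfl, fun _ => ck_refl _⟩
  | symm u v _ ih => exact ⟨ih.1.symm, fun hv => ck_symm (ih.2 (ih.1.2 hv))⟩
  | trans u v w _ _ ih ih' =>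
    exact ⟨ih.1.trans ih'.1, fun hu => ck_trans (ih.2 hu) (ih'.2 (ih.1.1 hu))⟩

theorem ck_ctx (a b : List ℕ) {u v : List ℕ} (h : CKEquiv u v) :
    CKEquiv (a ++ u ++ b) (a ++ v ++ b) :=
  (ck_map (fun u => a ++ u ++ b) (fun _ => True) (fun _ _ _ => Iff.rfl)
    (fun _ _ _ h => Relation.EqvGen.rel _ _ (ckStep_ctx a b h)) h).2 trivial

theorem ck_left (a : List ℕ) {u v : List ℕ} (h : CKEquiv u v) : CKEquiv (a ++ u) (a ++ v) := by
  simpa using ck_ctx a [] h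

theorem ck_right (b : List ℕ) {u v : List ℕ} (h : CKEquiv u v) : CKEquiv (u ++ b) (v ++ b) := by
  simpa using ck_ctx [] b h

theorem ck_one {x y z : ℕ} (h1 : y < x) (h2 : x < z) : CKEquiv [x, y, z] [x, z, y] :=
  Relation.EqvGen.rel _ _ (Or.inl ⟨[], [], x, y, z, h1, h2, rfl, rfl⟩)

theorem ck_two {x y z : ℕ} (h1 : y < z) (h2 : z < x) : CKEquiv [x, y, z] [y, x, z] :=
  Relation.EqvGen.rel _ _ (Or.inr (Or.inl ⟨[], [], x, y, z, h1, h2, rfl, rfl⟩))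

theorem ck_three (i : ℕ) : CKEquiv [i, i + 1, i] [i + 1, i, i + 1] :=
  Relation.EqvGen.rel _ _ (Or.inr (Or.inr ⟨[], [], i, rfl, rfl⟩))

theorem ckStep_reverse {u v : List ℕ} (h : CKStep u v) : CKEquiv u.reverse v.reverse := by
  rcases h with ⟨p, q, x, y, z, h1, h2, rfl, rfl⟩ | ⟨p, q, x, y, z, h1, h2, rfl, rfl⟩ |
    ⟨p, q, i, rfl, rfl⟩
  · simpa using ck_ctx q.reverse p.reverse (ck_two h1 h2)
  · simpa using ck_ctx q.reverse p.reverse (ck_one h1 h2)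
  · simpa using ck_ctx q.reverse p.reverse (ck_three i)

theorem ck_reverse {u v : List ℕ} (h : CKEquiv u v) : CKEquiv u.reverse v.reverse :=
  (ck_map List.reverse (fun _ => True) (fun _ _ _ => Iff.rfl)
    (fun _ _ _ h => ckStep_reverse h) h).2 trivial

theorem ckStep_mem {u v : List ℕ} (h : CKStep u v) (x : ℕ) : x ∈ u ↔ x ∈ v := by
  rcases h with ⟨p, q, x, y, z, h1, h2, rfl, rfl⟩ | ⟨p, q, x, y, z, h1, h2, rfl, rfl⟩ |
    ⟨p, q, i, rfl, rfl⟩ <;> simp <;> tauto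

theorem ck_mem {u v : List ℕ} (h : CKEquiv u v) (x : ℕ) : x ∈ u ↔ x ∈ v :=
  (ck_map id (fun u => x ∈ u) (fun _ _ h => ckStep_mem h x)
    (fun _ _ _ h => Relation.EqvGen.rel _ _ h) h).1

theorem ck_length {u v : List ℕ} (h : CKEquiv u v) : u.length = v.length := by
  have := (ck_map id (fun w => w.length = u.length) (fun u v h => by
    rcases h with ⟨p, q, x, y, z, h1, h2, rfl, rfl⟩ | ⟨p, q, x, y, z, h1, h2, rfl, rfl⟩ |
      ⟨p, q, i, rfl, rfl⟩ <;> simp)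
    (fun _ _ _ h => Relation.EqvGen.rel _ _ h) h).1
  exact (this.1 rfl).symm

theorem compl_step {N : ℕ} {u v : List ℕ} (hu : ∀ x ∈ u, x ≤ N) (h : CKStep u v) :
    CKEquiv (u.map (N - ·)) (v.map (N - ·)) := by
  rcases h with ⟨p, q, x, y, z, h1, h2, rfl, rfl⟩ | ⟨p, q, x, y, z, h1, h2, rfl, rfl⟩ |
    ⟨p, q, i, rfl, rfl⟩
  · have hz : z ≤ N := hu z (by simp)
    have := ck_ctx (p.map (N - ·)) (q.map (N - ·))
      (ck_symm (ck_one (x := N - x) (y := N - z) (z := N - y) (by omega) (by omega)))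
    simpa using this
  · have hz : x ≤ N := hu x (by simp)
    have := ck_ctx (p.map (N - ·)) (q.map (N - ·))
      (ck_symm (ck_two (x := N - y) (y := N - x) (z := N - z) (by omega) (by omega)))
    simpa using this
  · have hz : i + 1 ≤ N := hu _ (by simp)
    have := ck_ctx (p.map (N - ·)) (q.map (N - ·)) (ck_symm (ck_three (N - (i + 1))))
    have e : N - (i + 1) + 1 = N - i := by omega
    rw [e] at this
    simpa using this

theorem ck_compl {N : ℕ} {u v : List ℕ} (hu : ∀ x ∈ u, x ≤ N) (h : CKEquiv u v) :
    CKEquiv (u.map (N - ·)) (v.map (N - ·)) :=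
  (ck_map (List.map (N - ·)) (fun u => ∀ x ∈ u, x ≤ N)
    (fun _ _ h => by simp only [ckStep_mem h])
    (fun _ _ hu h => compl_step hu h) h).2 hu

/-! ### Reducedness -/

theorem wordPerm_append (u v : List ℕ) : wordPerm (u ++ v) = wordPerm u * wordPerm v := by
  simp [wordPerm]

theorem wordPerm_cons (x : ℕ) (v : List ℕ) : wordPerm (x :: v) = sPerm x * wordPerm v := by
  simp [wordPerm]

theorem wordPerm_nil : wordPerm [] = 1 := rfl

theorem sPerm_comm {i j : ℕ} (h : i + 1 < j) : sPerm i * sPerm j = sPerm j * sPerm i := by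
  unfold sPerm
  rw [Equiv.mul_swap_eq_swap_mul, Equiv.swap_apply_of_ne_of_ne, Equiv.swap_apply_of_ne_of_ne] <;>
    omega

theorem sPerm_braid (i : ℕ) :
    sPerm i * (sPerm (i + 1) * sPerm i) = sPerm (i + 1) * (sPerm i * sPerm (i + 1)) := by
  unfold sPerm
  ext x
  simp only [Equiv.Perm.mul_apply, Equiv.swap_apply_def]
  split_ifs <;> omega

theorem ck_wordPerm {u v : List ℕ} (h : CKEquiv u v) : wordPerm u = wordPerm v := by
  have := (ck_map id (fun w => wordPerm w = wordPerm u) (fun u v h => by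
    suffices wordPerm u = wordPerm v by rw [this]
    rcases h with ⟨p, q, x, y, z, h1, h2, rfl, rfl⟩ | ⟨p, q, x, y, z, h1, h2, rfl, rfl⟩ |
      ⟨p, q, i, rfl, rfl⟩
    · simp only [wordPerm_append, wordPerm_cons, wordPerm_nil, mul_one,
        sPerm_comm (show y + 1 < z by omega)]
    · simp only [wordPerm_append, wordPerm_cons, wordPerm_nil, mul_one]
      rw [← mul_assoc (sPerm x), ← mul_assoc (sPerm y), sPerm_comm (show y + 1 < x by omega)]
    · simp only [wordPerm_append, wordPerm_cons, wordPerm_nil, mul_one, sPerm_braid])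
    (fun _ _ _ h => Relation.EqvGen.rel _ _ h) h).1
  exact (this.1 rfl).symm

theorem ck_reduced {u v : List ℕ} (h : CKEquiv u v) (hu : IsReducedWord u) : IsReducedWord v := by
  refine ⟨fun x hx => hu.1 x ((ck_mem h x).2 hx), fun σ hσ hs => ?_⟩
  rw [← ck_length h]
  exact hu.2 σ hσ (by rw [hs, ck_wordPerm h])

theorem reduced_factor {a u b : List ℕ} (h : IsReducedWord (a ++ u ++ b)) : IsReducedWord u := by
  refine ⟨fun x hx => h.1 x (by simp [hx]), fun σ hσ hs => ?_⟩
  have := h.2 (a ++ σ ++ b) (fun x hx => by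
    simp only [List.mem_append] at hx
    rcases hx with (hx | hx) | hx
    · exact h.1 x (by simp [hx])
    · exact hσ x hx
    · exact h.1 x (by simp [hx])) (by simp [wordPerm_append, hs])
  simpa using this

theorem reduced_left {u b : List ℕ} (h : IsReducedWord (u ++ b)) : IsReducedWord u :=
  reduced_factor (a := []) (b := b) (by simpa using h)

theorem reduced_right {a u : List ℕ} (h : IsReducedWord (a ++ u)) : IsReducedWord u :=
  reduced_factor (a := a) (b := []) (by simpa using h)

/-- If `m` carries `s_b` to `s_q` then `q m b` is not reduced. -/
theorem not_reduced_of_apply {q b : ℕ} {m : List ℕ} (h1 : wordPerm m b = q)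
    (h2 : wordPerm m (b + 1) = q + 1) : ¬ IsReducedWord (q :: m ++ [b]) := by
  intro h
  have := h.2 m (fun x hx => h.1 x (by simp [hx])) (by
    rw [List.cons_append, wordPerm_cons, wordPerm_append, wordPerm_cons, wordPerm_nil, mul_one]
    unfold sPerm
    rw [Equiv.mul_swap_eq_swap_mul, h1, h2, ← mul_assoc, Equiv.swap_mul_self, one_mul])
  simp at this

theorem wordPerm_fix {x : ℕ} {m : List ℕ} (h : ∀ y ∈ m, y + 1 < x ∨ x < y) :
    wordPerm m x = x := by
  induction m with
  | nil => simp [wordPerm_nil]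
  | cons y m ih =>
    rw [wordPerm_cons, Equiv.Perm.mul_apply, ih (fun z hz => h z (by simp [hz]))]
    have := h y (by simp)
    unfold sPerm
    rw [Equiv.swap_apply_of_ne_of_ne] <;> omega

/-- The increasing run `q, q+1, …, q+s-1` carries `q+s` to `q`. -/
theorem wordPerm_range' (q s : ℕ) : wordPerm (List.range' q s) (q + s) = q := by
  induction s generalizing q with
  | zero => simp [wordPerm_nil]
  | succ s ih =>
    rw [List.range'_succ, wordPerm_cons, Equiv.Perm.mul_apply,
      show q + (s + 1) = (q + 1) + s by ring, ih]
    unfold sPerm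
    simp

theorem not_reduced_runs {q s : ℕ} {X Y : List ℕ} (hX : ∀ x ∈ X, q + s + 2 ≤ x)
    (hY : ∀ y ∈ Y, y + 2 ≤ q) :
    ¬ IsReducedWord (List.range' q (s + 1) ++ X ++ Y ++ List.range' q (s + 1)) := by
  have e : List.range' q (s + 1) ++ X ++ Y ++ List.range' q (s + 1) =
      q :: (List.range' (q + 1) s ++ X ++ Y ++ List.range' q s) ++ [q + s] := by
    conv_lhs =>
      arg 1
      rw [List.range'_succ]
    rw [List.range'_concat]
    simp
  rw [e]
  apply not_reduced_of_apply
  · simp only [wordPerm_append, Equiv.Perm.mul_apply]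
    rw [wordPerm_range', wordPerm_fix (m := Y), wordPerm_fix (m := X), wordPerm_fix]
    · intro y hy
      rw [List.mem_range'_1] at hy
      omega
    · intro y hy
      have := hX y hy
      omega
    · intro y hy
      have := hY y hy
      omega
  · simp only [wordPerm_append, Equiv.Perm.mul_apply]
    rw [wordPerm_fix (m := List.range' q s), wordPerm_fix (m := Y), wordPerm_fix (m := X),
      show q + s + 1 = (q + 1) + s by ring, wordPerm_range']
    · intro y hy
      have := hX y hy
      omega
    · intro y hy
      have := hY y hy
      omega
    · intro y hy
      rw [List.mem_range'_1] at hy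
      omega

/-- No word in the class contains two occurrences of a letter `b` separated only by letters
commuting with it. -/
def NB (u : List ℕ) : Prop :=
  ∀ a m c b, CKEquiv u (a ++ (b :: m ++ [b]) ++ c) → ¬ ∀ y ∈ m, y + 1 < b ∨ b + 1 < y

theorem nb_of_reduced {u : List ℕ} (hu : IsReducedWord u) : NB u := by
  intro a m c b h hm
  refine not_reduced_of_apply (q := b) (m := m) (b := b) ?_ ?_ (reduced_factor (ck_reduced h hu))
  · apply wordPerm_fix
    intro y hy
    have := hm y hy
    omega
  · apply wordPerm_fix
    intro y hy
    have := hm y hy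
    omega

theorem nb_ck {u v : List ℕ} (h : CKEquiv u v) (hu : NB u) : NB v :=
  fun a m c b h' => hu a m c b (ck_trans h h')

theorem nb_factor {a u b : List ℕ} (h : NB (a ++ u ++ b)) : NB u := by
  intro p m c x h'
  have := ck_ctx a b h'
  refine h (a ++ p) m (c ++ b) x (ck_trans this (ck_of_eq ?_))
  simp

theorem nb_left {u b : List ℕ} (h : NB (u ++ b)) : NB u :=
  nb_factor (a := []) (b := b) (by simpa using h)

theorem nb_right {a u : List ℕ} (h : NB (a ++ u)) : NB u :=
  nb_factor (a := a) (b := []) (by simpa using h)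

theorem nb_reverse {u : List ℕ} (h : NB u) : NB u.reverse := by
  intro a m c b h' hm
  have := ck_reverse h'
  rw [List.reverse_reverse] at this
  exact h c.reverse m.reverse a.reverse b (ck_trans this (ck_of_eq (by simp)))
    (fun y hy => hm y (by simpa using hy))

theorem map_compl_compl {N : ℕ} {u : List ℕ} (hu : ∀ x ∈ u, x ≤ N) :
    (u.map (N - ·)).map (N - ·) = u := by
  rw [List.map_map]
  conv_rhs => rw [← List.map_id u]
  apply List.map_congr_left
  intro x hx
  have := hu x hx
  simp only [Function.comp, id]
  omega

theorem nb_compl {N : ℕ} {u : List ℕ} (hu : ∀ x ∈ u, x ≤ N) (h : NB u) :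
    NB (u.map (N - ·)) := by
  intro a m c b h' hm
  have := ck_compl (N := N) (fun x hx => by
    simp only [List.mem_map] at hx
    obtain ⟨y, _, rfl⟩ := hx
    omega) h'
  rw [map_compl_compl hu] at this
  refine h (a.map (N - ·)) (m.map (N - ·)) (c.map (N - ·)) (N - b)
    (ck_trans this (ck_of_eq (by simp))) ?_
  have hle : ∀ x ∈ (a ++ (b :: m ++ [b]) ++ c), x ≤ N := by
    intro x hx
    have := (ck_mem h' x).2 hx
    simp only [List.mem_map] at this
    obtain ⟨y, _, rfl⟩ := this
    omega
  have hb := hle b (by simp)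
  intro y hy
  simp only [List.mem_map] at hy
  obtain ⟨z, hz, rfl⟩ := hy
  have := hle z (by simp [hz])
  have := hm z hz
  omega


/-! ### Increasing words of finite sets and counting functions -/

/-- The increasing word of a finite set. -/
def inc (S : Finset ℕ) : List ℕ := S.sort (· ≤ ·)

theorem mem_inc {S : Finset ℕ} {x : ℕ} : x ∈ inc S ↔ x ∈ S := by simp [inc]

theorem inc_pairwise (S : Finset ℕ) : (inc S).Pairwise (· < ·) := Finset.sortedLT_sort S |>.pairwise

theorem inc_eq {S : Finset ℕ} {l : List ℕ} (h : l.Pairwise (· < ·)) (hm : ∀ x, x ∈ l ↔ x ∈ S) :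
    inc S = l := by
  apply List.Perm.eq_of_pairwise (le := (· < ·))
  · intro a b _ _ h1 h2; omega
  · exact inc_pairwise S
  · exact h
  · rw [List.perm_ext_iff_of_nodup]
    · intro a; rw [mem_inc, hm]
    · exact (inc_pairwise S).imp (fun h => by omega)
    · exact h.imp (fun h => by omega)

theorem inc_toFinset {l : List ℕ} (h : l.Pairwise (· < ·)) : inc l.toFinset = l :=
  inc_eq h (by simp)

@[simp] theorem inc_empty : inc ∅ = [] := inc_eq (by simp) (by simp)

@[simp] theorem inc_singleton (a : ℕ) : inc {a} = [a] := inc_eq (by simp) (by simp)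

theorem inc_union {S T : Finset ℕ} (h : ∀ x ∈ S, ∀ y ∈ T, x < y) : inc (S ∪ T) = inc S ++ inc T := by
  apply inc_eq
  · rw [List.pairwise_append]
    exact ⟨inc_pairwise S, inc_pairwise T, fun a ha b hb => h a (mem_inc.1 ha) b (mem_inc.1 hb)⟩
  · simp [mem_inc]

theorem inc_insert_min {S : Finset ℕ} {a : ℕ} (h : ∀ x ∈ S, a < x) :
    inc (insert a S) = a :: inc S := by
  rw [Finset.insert_eq, inc_union (by simpa using h)]
  simp

theorem inc_insert_max {S : Finset ℕ} {a : ℕ} (h : ∀ x ∈ S, x < a) :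
    inc (insert a S) = inc S ++ [a] := by
  rw [Finset.insert_eq, Finset.union_comm, inc_union (by simpa using h)]
  simp

theorem inc_split {S : Finset ℕ} {a : ℕ} (h : a ∈ S) :
    inc S = inc (S.filter (· < a)) ++ a :: inc (S.filter (a < ·)) := by
  rw [← inc_insert_min (by simp), ← inc_union]
  · congr 1
    ext x
    simp only [Finset.mem_union, Finset.mem_filter, Finset.mem_insert]
    constructor
    · intro hx
      rcases lt_trichotomy x a with h1 | h1 | h1
      · exact Or.inl ⟨hx, h1⟩
      · exact Or.inr (Or.inl h1)
      · exact Or.inr (Or.inr ⟨hx, h1⟩)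
    · rintro (h1 | rfl | h1)
      · exact h1.1
      · exact h
      · exact h1.1
  · simp only [Finset.mem_filter, Finset.mem_insert]
    rintro x ⟨_, hx⟩ y (rfl | ⟨_, hy⟩) <;> omega

theorem inc_Ico (p q : ℕ) : inc (Finset.Ico p q) = List.range' p (q - p) := by
  apply inc_eq
  · exact List.pairwise_lt_range'
  · intro x
    rw [List.mem_range'_1, Finset.mem_Ico]
    omega

/-- The number of elements below `t`. -/
def lc (S : Finset ℕ) (t : ℕ) : ℕ := (S.filter (· < t)).card

/-- The number of elements that are at least `t`. -/
def gc (S : Finset ℕ) (t : ℕ) : ℕ := (S.filter (t ≤ ·)).card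

theorem lc_zero (S : Finset ℕ) : lc S 0 = 0 := by simp [lc]

theorem lc_succ (S : Finset ℕ) (t : ℕ) : lc S (t + 1) = lc S t + if t ∈ S then 1 else 0 := by
  unfold lc
  split_ifs with h
  · rw [← Finset.card_insert_of_notMem (a := t) (by simp)]
    congr 1
    ext x
    simp only [Finset.mem_filter, Finset.mem_insert]
    constructor
    · rintro ⟨h1, h2⟩
      by_cases hx : x = t
      · exact Or.inl hx
      · exact Or.inr ⟨h1, by omega⟩
    · rintro (rfl | h1)
      · exact ⟨h, by omega⟩
      · exact ⟨h1.1, by omega⟩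
  · rw [add_zero]
    congr 1
    ext x
    simp only [Finset.mem_filter]
    constructor
    · rintro ⟨h1, h2⟩
      refine ⟨h1, ?_⟩
      rcases Nat.lt_succ_iff_lt_or_eq.1 h2 with h3 | rfl
      · exact h3
      · exact absurd h1 h
    · rintro ⟨h1, h2⟩
      exact ⟨h1, by omega⟩

theorem lc_add_gc (S : Finset ℕ) (t : ℕ) : lc S t + gc S t = S.card := by
  unfold lc gc
  have := Finset.card_filter_add_card_filter_not (s := S) (fun x => x < t)
  simpa using this

theorem lc_mono (S : Finset ℕ) {s t : ℕ} (h : s ≤ t) : lc S s ≤ lc S t := by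
  apply Finset.card_le_card
  intro x
  simp only [Finset.mem_filter]
  rintro ⟨h1, h2⟩
  exact ⟨h1, by omega⟩

theorem lc_le_card (S : Finset ℕ) (t : ℕ) : lc S t ≤ S.card := Finset.card_filter_le _ _

theorem lc_subset {S T : Finset ℕ} (h : S ⊆ T) (t : ℕ) : lc S t ≤ lc T t :=
  Finset.card_le_card (Finset.filter_subset_filter _ h)

theorem gc_subset {S T : Finset ℕ} (h : S ⊆ T) (t : ℕ) : gc S t ≤ gc T t :=
  Finset.card_le_card (Finset.filter_subset_filter _ h)

theorem lc_insert {S : Finset ℕ} {x : ℕ} (h : x ∉ S) (t : ℕ) :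
    lc (insert x S) t = lc S t + if x < t then 1 else 0 := by
  unfold lc
  rw [Finset.filter_insert]
  split_ifs with h1
  · rw [Finset.card_insert_of_notMem]
    simp [h]
  · rfl

theorem lc_erase {S : Finset ℕ} {x : ℕ} (h : x ∈ S) (t : ℕ) :
    lc S t = lc (S.erase x) t + if x < t then 1 else 0 := by
  conv_lhs => rw [← Finset.insert_erase h]
  rw [lc_insert (by simp)]

theorem lc_union {S T : Finset ℕ} (h : Disjoint S T) (t : ℕ) :
    lc (S ∪ T) t = lc S t + lc T t := by
  unfold lc
  rw [Finset.filter_union, Finset.card_union_of_disjoint]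
  exact Finset.disjoint_filter_filter h

theorem lc_of_ge {S : Finset ℕ} {t : ℕ} (h : ∀ x ∈ S, x < t) : lc S t = S.card := by
  unfold lc
  congr 1
  exact Finset.filter_true_of_mem h

theorem gc_insert {S : Finset ℕ} {x : ℕ} (h : x ∉ S) (t : ℕ) :
    gc (insert x S) t = gc S t + if t ≤ x then 1 else 0 := by
  unfold gc
  rw [Finset.filter_insert]
  split_ifs with h1
  · rw [Finset.card_insert_of_notMem]
    simp [h]
  · rfl

theorem gc_erase {S : Finset ℕ} {x : ℕ} (h : x ∈ S) (t : ℕ) :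
    gc S t = gc (S.erase x) t + if t ≤ x then 1 else 0 := by
  conv_lhs => rw [← Finset.insert_erase h]
  rw [gc_insert (by simp)]

theorem gc_le_card (S : Finset ℕ) (t : ℕ) : gc S t ≤ S.card := Finset.card_filter_le _ _

theorem gc_anti (S : Finset ℕ) {s t : ℕ} (h : s ≤ t) : gc S t ≤ gc S s := by
  have h1 := lc_add_gc S t
  have h2 := lc_add_gc S s
  have := lc_mono S h
  omega

theorem gc_union {S T : Finset ℕ} (h : Disjoint S T) (t : ℕ) :
    gc (S ∪ T) t = gc S t + gc T t := by
  unfold gc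
  rw [Finset.filter_union, Finset.card_union_of_disjoint]
  exact Finset.disjoint_filter_filter h

/-! ### Row insertion of one letter into an increasing word -/

theorem slide_one {a b : ℕ} {l : List ℕ} (h : (a :: l).Pairwise (· < ·)) (hb : b < a) :
    CKEquiv (a :: l ++ [b]) (a :: b :: l) := by
  induction l generalizing a with
  | nil => exact ck_refl _
  | cons c l ih =>
    rw [List.pairwise_cons] at h
    have hac : a < c := h.1 c (by simp)
    have h1 := ck_left [a] (ih h.2 (by omega))
    refine ck_trans (ck_trans (ck_of_eq ?_) h1) ?_
    · simp
    · have := ck_right l (ck_symm (ck_one hb hac))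
      simpa using this

theorem slide_two {a b : ℕ} {l : List ℕ} (h : (l ++ [b]).Pairwise (· < ·)) (hb : b < a) :
    CKEquiv (l ++ [a, b]) (a :: l ++ [b]) := by
  induction l with
  | nil => exact ck_refl _
  | cons c l ih =>
    rw [List.cons_append, List.pairwise_cons] at h
    have h1 := ck_left [c] (ih h.2)
    refine ck_trans (ck_trans (ck_of_eq ?_) h1) ?_
    · simp
    · cases l with
      | nil =>
        have hc : c < b := h.1 b (by simp)
        exact ck_symm (ck_two hc hb)
      | cons d l =>
        have hc : c < d := h.1 d (by simp)
        have hd : d < b := by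
          have := h.2
          rw [List.cons_append, List.pairwise_cons] at this
          exact this.1 b (by simp)
        have := ck_right (l ++ [b]) (ck_symm (ck_two hc (show d < a by omega)))
        simpa using this

/-- Row insertion of `b` into an increasing word, bumping `a`. -/
theorem row_insert {A : Finset ℕ} {a b : ℕ} (ha : a ∈ A) (hba : b < a)
    (hmin : ∀ x ∈ A, b < x → a ≤ x) (hb : b ∈ A → a = b + 1) :
    CKEquiv (inc A ++ [b]) (a :: inc (if b ∈ A then A else insert b (A.erase a))) := by
  rw [inc_split ha]
  have hp : (a :: inc (A.filter (a < ·))).Pairwise (· < ·) := by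
    rw [List.pairwise_cons]
    refine ⟨fun x hx => ?_, inc_pairwise _⟩
    simp only [mem_inc, Finset.mem_filter] at hx
    exact hx.2
  have h1 := ck_left (inc (A.filter (· < a))) (slide_one hp hba)
  rw [List.append_assoc]
  refine ck_trans h1 ?_
  split_ifs with h
  · obtain rfl := hb h
    have e1 : inc (A.filter (· < b + 1)) = inc (A.filter (· < b)) ++ [b] := by
      rw [← inc_insert_max (by simp)]
      congr 1
      ext x
      simp only [Finset.mem_filter, Finset.mem_insert]
      constructor
      · rintro ⟨hx, hx'⟩
        by_cases hxb : x = b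
        · exact Or.inl hxb
        · exact Or.inr ⟨hx, by omega⟩
      · rintro (rfl | ⟨hx, hx'⟩)
        · exact ⟨h, by omega⟩
        · exact ⟨hx, by omega⟩
    have hp2 : (inc (A.filter (· < b)) ++ [b]).Pairwise (· < ·) := by
      rw [← e1]; exact inc_pairwise _
    rw [inc_split ha, e1]
    have h2 := ck_ctx (inc (A.filter (· < b))) (inc (A.filter (b + 1 < ·))) (ck_three b)
    have h3 := ck_right ((b + 1) :: inc (A.filter (b + 1 < ·)))
      (slide_two hp2 (Nat.lt_succ_self b))
    refine ck_trans (ck_trans (ck_of_eq ?_) h2) (ck_trans (ck_trans (ck_of_eq ?_) h3) (ck_of_eq ?_))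
    · simp
    · simp
    · simp
  · have e1 : inc (insert b (A.erase a)) =
        inc (A.filter (· < a)) ++ b :: inc (A.filter (a < ·)) := by
      apply inc_eq
      · rw [List.pairwise_append, List.pairwise_cons]
        refine ⟨inc_pairwise _, ⟨fun x hx => ?_, inc_pairwise _⟩, fun x hx y hy => ?_⟩
        · simp only [mem_inc, Finset.mem_filter] at hx
          omega
        · simp only [mem_inc, Finset.mem_filter, List.mem_cons] at hx hy
          have hxb : x ≠ b := fun e => h (e ▸ hx.1)
          have := hmin x hx.1
          rcases hy with rfl | hy <;> omega
      · intro x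
        simp only [List.mem_append, List.mem_cons, mem_inc, Finset.mem_filter, Finset.mem_insert,
          Finset.mem_erase]
        constructor
        · rintro (h1 | h1 | h1)
          · exact Or.inr ⟨by omega, h1.1⟩
          · exact Or.inl h1
          · exact Or.inr ⟨by omega, h1.1⟩
        · rintro (h1 | h1)
          · exact Or.inr (Or.inl h1)
          · rcases lt_or_gt_of_ne h1.1 with h2 | h2
            · exact Or.inl ⟨h1.2, h2⟩
            · exact Or.inr (Or.inr ⟨h1.2, h2⟩)
    rw [e1]
    have hp2 : (inc (A.filter (· < a)) ++ [b]).Pairwise (· < ·) := by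
      rw [List.pairwise_append]
      refine ⟨inc_pairwise _, by simp, fun x hx y hy => ?_⟩
      simp only [mem_inc, Finset.mem_filter, List.mem_singleton] at hx hy
      have hxb : x ≠ b := fun e => h (e ▸ hx.1)
      have := hmin x hx.1
      omega
    have h3 := ck_right (inc (A.filter (a < ·))) (slide_two hp2 hba)
    refine ck_trans (ck_trans (ck_of_eq ?_) h3) (ck_of_eq ?_)
    · simp
    · simp

/-- In a word `A b` without bad repetitions, `b ∈ A` forces `b + 1 ∈ A`. -/
theorem succ_mem_of_nb {A : Finset ℕ} {b : ℕ} {c : List ℕ}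
    (h : NB (inc A ++ c ++ [b])) (hc : ∀ x ∈ c, b + 1 < x) (hb : b ∈ A) : b + 1 ∈ A := by
  by_contra hn
  refine h (inc (A.filter (· < b))) (inc (A.filter (b < ·)) ++ c) [] b
    (ck_of_eq ?_) ?_
  · rw [inc_split hb]
    simp
  · intro y hy
    rw [List.mem_append] at hy
    rcases hy with hy | hy
    · simp only [mem_inc, Finset.mem_filter] at hy
      have : y ≠ b + 1 := fun e => hn (e ▸ hy.1)
      omega
    · exact Or.inr (hc y hy)

/-! ### Commuting large letters past a matched word -/

theorem gc_of_le {S : Finset ℕ} {t : ℕ} (h : ∀ x ∈ S, t ≤ x) : gc S t = S.card := by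
  unfold gc
  congr 1
  exact Finset.filter_true_of_mem h

theorem gc_pos {S : Finset ℕ} {t : ℕ} (h : 1 ≤ gc S t) : (S.filter (t ≤ ·)).Nonempty := by
  rw [← Finset.card_pos]
  exact h

/-- The set obtained by row insertion of `b` bumping `a`. -/
def rowIns (A : Finset ℕ) (a b : ℕ) : Finset ℕ := if b ∈ A then A else insert b (A.erase a)

theorem slide_big {x : ℕ} {B : Finset ℕ} : ∀ A : Finset ℕ, (∀ t, gc B t ≤ gc A (t + 1)) →
    (∀ y ∈ A, y < x) →
    (NB (inc A ++ inc B ++ [x]) ∨ NB (inc A ++ [x] ++ inc B)) →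
    CKEquiv (inc A ++ [x] ++ inc B) (inc A ++ inc B ++ [x]) := by
  induction B using Finset.induction_on_min with
  | empty => intro A _ _ _; simpa using ck_refl _
  | insert b B hbB ih =>
    intro A hall hx hnb
    have hbn : b ∉ B := fun h => lt_irrefl _ (hbB b h)
    have hgB : ∀ t, t ≤ b + 1 → gc B t = B.card := fun t ht =>
      gc_of_le (fun y hy => by have := hbB y hy; omega)
    obtain ⟨a, ha, hmin⟩ : ∃ a ∈ A.filter (b + 1 ≤ ·), ∀ y ∈ A.filter (b + 1 ≤ ·), a ≤ y := by
      have hne : (A.filter (b + 1 ≤ ·)).Nonempty := by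
        apply gc_pos
        have := hall b
        rw [gc_insert hbn] at this
        simp at this
        omega
      exact ⟨_, Finset.min'_mem _ hne, fun y hy => Finset.min'_le _ y hy⟩
    simp only [Finset.mem_filter] at ha hmin
    have hmin' : ∀ y ∈ A, b < y → a ≤ y := fun y hy hby => hmin y ⟨hy, hby⟩
    have hax := hx a ha.1
    have hxA : x ∉ A := fun h => lt_irrefl _ (hx x h)
    rw [inc_insert_min hbB] at hnb ⊢
    have hb1 : b ∈ A → a = b + 1 := by
      intro hb
      have : b + 1 ∈ A := by
        rcases hnb with hnb | hnb
        · refine succ_mem_of_nb (c := []) (nb_left (b := inc B ++ [x]) ?_) (by simp) hb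
          simpa using hnb
        · refine succ_mem_of_nb (c := [x]) (nb_left (b := inc B) ?_) (by simp; omega) hb
          simpa using hnb
      have := hmin' _ this (by omega)
      omega
    have hA : CKEquiv (inc A ++ [b]) (a :: inc (rowIns A a b)) :=
      row_insert ha.1 (by omega) hmin' hb1
    have hxr : ∀ y ∈ rowIns A a b, y < x := by
      intro y hy
      unfold rowIns at hy
      split_ifs at hy
      · exact hx y hy
      · simp only [Finset.mem_insert, Finset.mem_erase] at hy
        rcases hy with rfl | hy
        · omega
        · exact hx y hy.2
    have hAx : CKEquiv (inc A ++ [x] ++ [b]) (a :: (inc (rowIns A a b) ++ [x])) := by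
      rw [← inc_insert_max hx, ← inc_insert_max hxr]
      have h1 := row_insert (A := insert x A) (a := a) (b := b) (by simp [ha.1]) (by omega)
        (fun y hy hby => by
          simp only [Finset.mem_insert] at hy
          rcases hy with rfl | hy
          · omega
          · exact hmin' y hy hby)
        (fun hb => by
          simp only [Finset.mem_insert] at hb
          rcases hb with rfl | hb
          · omega
          · exact hb1 hb)
      refine ck_trans h1 (ck_of_eq ?_)
      congr 2
      unfold rowIns
      have : b ≠ x := by omega
      by_cases hbA : b ∈ A
      · simp [hbA]
      · simp only [hbA, this, Finset.mem_insert, or_self, if_false]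
        ext z
        simp only [Finset.mem_insert, Finset.mem_erase]
        have : a ≠ x := by omega
        constructor
        · rintro (h | ⟨h, h' | h'⟩) <;> tauto
        · rintro (rfl | h | h)
          · exact Or.inr ⟨this.symm, Or.inl rfl⟩
          · tauto
          · tauto
    have hall' : ∀ t, gc B t ≤ gc (rowIns A a b) (t + 1) := by
      have key : ∀ t, b + 1 ≤ t → gc B t ≤ gc (rowIns A a b) (t + 1) := by
        intro t ht
        have h1 := hall t
        have h2 := hall b
        rw [gc_insert hbn] at h1 h2
        have h3 := hgB b (by omega)
        have h4 := gc_le_card B t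
        simp only [le_refl, if_true] at h2
        unfold rowIns
        split_ifs with hbA
        · omega
        · rw [gc_insert (by simp [hbA])]
          have h5 := gc_erase ha.1 (t + 1)
          by_cases hta : t + 1 ≤ a
          · have h6 : gc A (t + 1) = gc A (b + 1) := by
              unfold gc
              congr 1
              ext y
              simp only [Finset.mem_filter]
              constructor
              · rintro ⟨h, h'⟩; exact ⟨h, by omega⟩
              · rintro ⟨h, h'⟩
                have := hmin' y h (by omega)
                exact ⟨h, by omega⟩
            rw [if_pos hta] at h5
            omega
          · rw [if_neg hta] at h5
            omega
      intro t
      by_cases ht : b + 1 ≤ t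
      · exact key t ht
      · have h1 := key (b + 1) le_rfl
        have h2 := hgB t (by omega)
        have h3 := hgB (b + 1) le_rfl
        have h4 := gc_anti (rowIns A a b) (show t + 1 ≤ b + 1 + 1 by omega)
        omega
    have e1 : CKEquiv (inc A ++ [x] ++ b :: inc B) (a :: (inc (rowIns A a b) ++ [x] ++ inc B)) := by
      have := ck_right (inc B) hAx
      simpa using this
    have e2 : CKEquiv (inc A ++ b :: inc B ++ [x]) (a :: (inc (rowIns A a b) ++ inc B ++ [x])) := by
      have := ck_right (inc B ++ [x]) hA
      simpa using this
    have hih := ih (rowIns A a b) hall' hxr (by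
      rcases hnb with hnb | hnb
      · left
        exact nb_right (a := [a]) (nb_ck e2 hnb)
      · right
        exact nb_right (a := [a]) (nb_ck e1 hnb))
    exact ck_trans e1 (ck_trans (ck_left [a] hih) (ck_symm e2))

theorem gc_mono_insert (A : Finset ℕ) (x t : ℕ) : gc A t ≤ gc (insert x A) t :=
  gc_subset (Finset.subset_insert _ _) t

/-- An increasing word of large letters commutes past a matched word. -/
theorem slide_bigs {B X : Finset ℕ} : ∀ A : Finset ℕ, (∀ t, gc B t ≤ gc A (t + 1)) →
    (∀ y ∈ A, ∀ x ∈ X, y < x) →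
    (NB (inc A ++ inc B ++ inc X) ∨ NB (inc A ++ inc X ++ inc B)) →
    CKEquiv (inc A ++ inc X ++ inc B) (inc A ++ inc B ++ inc X) := by
  induction X using Finset.induction_on_min with
  | empty => intro A _ _ _; simpa using ck_refl _
  | insert x X hxX ih =>
    intro A hall hx hnb
    rw [inc_insert_min hxX] at hnb ⊢
    have hxA : ∀ y ∈ A, y < x := fun y hy => hx y hy x (by simp)
    have hall' : ∀ t, gc B t ≤ gc (insert x A) (t + 1) := fun t =>
      (hall t).trans (gc_mono_insert _ _ _)
    have hx' : ∀ y ∈ insert x A, ∀ z ∈ X, y < z := by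
      intro y hy z hz
      rw [Finset.mem_insert] at hy
      rcases hy with rfl | hy
      · exact hxX z hz
      · exact hx y hy z (by simp [hz])
    have eA := inc_insert_max hxA
    have ih' := ih (insert x A) hall' hx'
    have sb := slide_big (x := x) (B := B) A hall hxA
    rw [eA] at ih'
    rcases hnb with hnb | hnb
    · have h1 := sb (Or.inl (nb_left (b := inc X) (by simpa using hnb)))
      have h1' := ck_right (inc X) h1
      have h2 := ih' (Or.inl (nb_ck (ck_symm h1') (by simpa using hnb)))
      simpa using ck_trans h2 h1'
    · have h2 := ih' (Or.inr (by simpa using hnb))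
      have h1 := sb (Or.inr (nb_left (b := inc X) (nb_ck h2 (by simpa using hnb))))
      have h1' := ck_right (inc X) h1
      simpa using ck_trans h2 h1'

/-! ### Commuting a small letter into a matched word -/

theorem inc_compl {S : Finset ℕ} {N : ℕ} (hN : ∀ x ∈ S, x ≤ N) :
    inc (S.image (N - ·)) = ((inc S).reverse).map (N - ·) := by
  apply inc_eq
  · rw [List.pairwise_map, List.pairwise_reverse]
    refine (inc_pairwise S).imp_of_mem ?_
    intro a b ha hb h
    have := hN a (mem_inc.1 ha)
    have := hN b (mem_inc.1 hb)
    omega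
  · intro x
    simp [mem_inc]

theorem gc_compl {S : Finset ℕ} {N t : ℕ} (hN : ∀ x ∈ S, x ≤ N) (ht : t ≤ N) :
    gc (S.image (N - ·)) t = lc S (N - t + 1) := by
  unfold gc lc
  rw [Finset.filter_image, Finset.card_image_of_injOn]
  · congr 1
    ext x
    simp only [Finset.mem_filter]
    constructor
    · rintro ⟨h, h'⟩
      have := hN x h
      exact ⟨h, by omega⟩
    · rintro ⟨h, h'⟩
      have := hN x h
      exact ⟨h, by omega⟩
  · intro x hx y hy hxy
    simp only [Finset.coe_filter, Set.mem_ofPred_eq] at hx hy hxy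
    have := hN x hx.1
    have := hN y hy.1
    omega

theorem slide_small {x : ℕ} {A B : Finset ℕ} (hall : ∀ t, lc A (t + 1) ≤ lc B t)
    (hx : ∀ y ∈ B, x < y) (hnb : NB ([x] ++ inc A ++ inc B)) :
    CKEquiv ([x] ++ inc A ++ inc B) (inc A ++ [x] ++ inc B) := by
  obtain ⟨N, hN⟩ : ∃ N, ∀ y ∈ insert x (A ∪ B), y ≤ N := ⟨_, fun y hy => Finset.le_sup (f := id) hy⟩
  have hNx : x ≤ N := hN x (by simp)
  have hNA : ∀ y ∈ A, y ≤ N := fun y hy => hN y (by simp [hy])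
  have hNB : ∀ y ∈ B, y ≤ N := fun y hy => hN y (by simp [hy])
  have hle : ∀ y ∈ [x] ++ inc A ++ inc B, y ≤ N := by
    intro y hy
    simp only [List.mem_append, List.mem_singleton, mem_inc] at hy
    rcases hy with (rfl | h) | h
    · exact hNx
    · exact hNA y h
    · exact hNB y h
  have h := slide_big (x := N - x) (B := A.image (N - ·)) (B.image (N - ·)) (by
      intro t
      by_cases ht : t ≤ N
      · rw [gc_compl hNA ht]
        by_cases ht' : t + 1 ≤ N
        · rw [gc_compl hNB ht']
          have := hall (N - t)
          rw [show N - (t + 1) + 1 = N - t by omega]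
          exact this
        · have h0 := hall 0
          rw [lc_zero] at h0
          have : N - t + 1 = 0 + 1 := by omega
          rw [this]
          omega
      · have : gc (A.image (N - ·)) t = 0 := by
          unfold gc
          rw [Finset.card_eq_zero, Finset.filter_eq_empty_iff]
          intro y hy
          simp only [Finset.mem_image] at hy
          obtain ⟨z, _, rfl⟩ := hy
          omega
        omega) (by
      intro y hy
      simp only [Finset.mem_image] at hy
      obtain ⟨z, hz, rfl⟩ := hy
      have := hx z hz
      have := hNB z hz
      omega) (by
      left
      rw [inc_compl hNA, inc_compl hNB]
      have := nb_reverse (nb_compl hle hnb)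
      simpa using this)
  rw [inc_compl hNA, inc_compl hNB] at h
  have h2 := ck_reverse (ck_compl (N := N) (fun y hy => by
    simp only [List.mem_append, List.mem_singleton, List.mem_map] at hy
    rcases hy with (⟨_, _, rfl⟩ | rfl) | ⟨_, _, rfl⟩ <;> omega) h)
  have e : ∀ S : Finset ℕ, (∀ y ∈ S, y ≤ N) →
      List.map ((fun y => N - y) ∘ fun y => N - y) (inc S) = inc S := by
    intro S hS
    rw [← List.map_map]
    exact map_compl_compl (fun y hy => hS y (mem_inc.1 hy))
  have ex : N - (N - x) = x := by omega
  simp only [List.map_append, List.map_reverse, List.map_map, List.reverse_append,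
    List.reverse_reverse, e A hNA, e B hNB, List.map_cons, List.map_nil, ex,
    List.reverse_singleton] at h2
  exact ck_symm (by simpa using h2)


/-! ### The block exchange underlying the crystal operators and column insertion -/

theorem gc_filter_lt {S : Finset ℕ} {p t : ℕ} (h : t ≤ p) :
    gc (S.filter (· < p)) t + lc S t = lc S p := by
  unfold gc lc
  rw [Finset.filter_filter, ← Finset.card_union_of_disjoint]
  · congr 1
    ext x
    simp only [Finset.mem_union, Finset.mem_filter]
    constructor
    · rintro (h | h)
      · exact ⟨h.1, h.2.1⟩
      · exact ⟨h.1, by omega⟩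
    · rintro ⟨h1, h2⟩
      rcases lt_or_ge x t with h3 | h3
      · exact Or.inr ⟨h1, h3⟩
      · exact Or.inl ⟨h1, h2, h3⟩
  · rw [Finset.disjoint_left]
    intro x
    simp only [Finset.mem_filter]
    rintro ⟨_, _, h⟩ ⟨_, h'⟩
    omega

theorem gc_filter_lt_eq_zero {S : Finset ℕ} {p t : ℕ} (h : p ≤ t) :
    gc (S.filter (· < p)) t = 0 := by
  unfold gc
  rw [Finset.card_eq_zero, Finset.filter_eq_empty_iff]
  intro x
  simp only [Finset.mem_filter]
  omega

theorem lc_filter_gt {S : Finset ℕ} {q t : ℕ} (h : q + 1 ≤ t) :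
    lc (S.filter (q < ·)) t + lc S (q + 1) = lc S t := by
  unfold lc
  rw [Finset.filter_filter, ← Finset.card_union_of_disjoint]
  · congr 1
    ext x
    simp only [Finset.mem_union, Finset.mem_filter]
    constructor
    · rintro (h | h)
      · exact ⟨h.1, h.2.2⟩
      · exact ⟨h.1, by omega⟩
    · rintro ⟨h1, h2⟩
      rcases lt_or_ge x (q + 1) with h3 | h3
      · exact Or.inr ⟨h1, h3⟩
      · exact Or.inl ⟨h1, by omega, h2⟩
  · rw [Finset.disjoint_left]
    intro x
    simp only [Finset.mem_filter]
    rintro ⟨_, h, _⟩ ⟨_, h'⟩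
    omega

theorem lc_filter_gt_eq_zero {S : Finset ℕ} {q t : ℕ} (h : t ≤ q + 1) :
    lc (S.filter (q < ·)) t = 0 := by
  unfold lc
  rw [Finset.card_eq_zero, Finset.filter_eq_empty_iff]
  intro x
  simp only [Finset.mem_filter]
  omega

theorem gc_Ico_succ (p q t : ℕ) : gc (Finset.Ico (p + 1) (q + 1)) (t + 1) = gc (Finset.Ico p q) t := by
  unfold gc
  rw [← Finset.card_image_of_injective ((Finset.Ico p q).filter (t ≤ ·)) Nat.succ_injective]
  congr 1
  ext x
  simp only [Finset.mem_filter, Finset.mem_image, Finset.mem_Ico]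
  constructor
  · rintro ⟨h1, h2⟩
    exact ⟨x - 1, by omega, by omega⟩
  · rintro ⟨y, h1, rfl⟩
    omega

theorem run_exchange_aux (p q : ℕ) : ∀ k, p + k ≤ q →
    CKEquiv (inc (Finset.Ico p (q + 1)) ++ inc (Finset.Ico p (p + k)))
      (inc (Finset.Ico (p + 1) (p + k + 1)) ++ inc (Finset.Ico p (q + 1))) := by
  intro k
  induction k with
  | zero => intro _; simpa using ck_refl _
  | succ k ih =>
    intro hk
    have h1 : Finset.Ico p (p + (k + 1)) = insert (p + k) (Finset.Ico p (p + k)) := by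
      ext x; simp only [Finset.mem_Ico, Finset.mem_insert]; omega
    have h2 : Finset.Ico (p + 1) (p + (k + 1) + 1) =
        insert (p + k + 1) (Finset.Ico (p + 1) (p + k + 1)) := by
      ext x; simp only [Finset.mem_Ico, Finset.mem_insert]; omega
    rw [h1, h2, inc_insert_max (by simp), inc_insert_max (by simp)]
    have h3 := ck_right [p + k] (ih (by omega))
    have h4 := row_insert (A := Finset.Ico p (q + 1)) (a := p + k + 1) (b := p + k)
      (by simp; omega) (by omega) (fun x _ h => h) (fun _ => rfl)
    rw [if_pos (by simp; omega)] at h4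
    have h5 := ck_left (inc (Finset.Ico (p + 1) (p + k + 1))) h4
    refine ck_trans (ck_trans (ck_of_eq ?_) h3) (ck_trans (ck_trans (ck_of_eq ?_) h5)
      (ck_of_eq ?_)) <;> simp

theorem run_exchange {p q : ℕ} (h : p ≤ q) :
    CKEquiv (inc (Finset.Ico p (q + 1)) ++ inc (Finset.Ico p q))
      (inc (Finset.Ico (p + 1) (q + 1)) ++ inc (Finset.Ico p (q + 1))) := by
  have := run_exchange_aux p q (q - p) (by omega)
  rwa [show p + (q - p) = q by omega] at this

/-- Moving a letter from an increasing block to the next increasing block. -/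
theorem block_exchange {K C : Finset ℕ} {p q : ℕ} (hpq : p ≤ q) (hp : p ∉ K)
    (hK : ∀ y, p < y → y ≤ q → y ∈ K) (hC : ∀ y, p ≤ y → y < q → y ∈ C) (hq : q ∉ C)
    (h1 : ∀ t, t < p → lc C p + lc K (t + 1) ≤ lc K p + lc C t)
    (h2 : ∀ t, q < t → lc K (t + 1) + lc C (q + 1) ≤ lc C t + lc K (q + 1))
    (hnb : NB (inc (insert p K) ++ inc C)) :
    CKEquiv (inc (insert p K) ++ inc C) (inc K ++ inc (insert q C)) := by
  have eK1 : insert p K = K.filter (· < p) ∪ Finset.Ico p (q + 1) ∪ K.filter (q < ·) := by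
    ext x
    simp only [Finset.mem_insert, Finset.mem_union, Finset.mem_filter, Finset.mem_Ico]
    constructor
    · rintro (rfl | h)
      · omega
      · by_cases hx : x < p
        · exact Or.inl (Or.inl ⟨h, hx⟩)
        · by_cases hx' : x ≤ q
          · omega
          · exact Or.inr ⟨h, by omega⟩
    · rintro ((h | h) | h)
      · exact Or.inr h.1
      · by_cases hx : x = p
        · exact Or.inl hx
        · exact Or.inr (hK x (by omega) (by omega))
      · exact Or.inr h.1
  have eK2 : K = K.filter (· < p) ∪ Finset.Ico (p + 1) (q + 1) ∪ K.filter (q < ·) := by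
    ext x
    simp only [Finset.mem_union, Finset.mem_filter, Finset.mem_Ico]
    constructor
    · intro h
      have : x ≠ p := fun e => hp (e ▸ h)
      by_cases hx : x < p
      · exact Or.inl (Or.inl ⟨h, hx⟩)
      · by_cases hx' : x ≤ q
        · omega
        · exact Or.inr ⟨h, by omega⟩
    · rintro ((h | h) | h)
      · exact h.1
      · exact hK x (by omega) (by omega)
      · exact h.1
  have eC1 : C = C.filter (· < p) ∪ Finset.Ico p q ∪ C.filter (q < ·) := by
    ext x
    simp only [Finset.mem_union, Finset.mem_filter, Finset.mem_Ico]
    constructor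
    · intro h
      have : x ≠ q := fun e => hq (e ▸ h)
      by_cases hx : x < p
      · exact Or.inl (Or.inl ⟨h, hx⟩)
      · by_cases hx' : x < q
        · omega
        · exact Or.inr ⟨h, by omega⟩
    · rintro ((h | h) | h)
      · exact h.1
      · exact hC x (by omega) (by omega)
      · exact h.1
  have eC2 : insert q C = C.filter (· < p) ∪ Finset.Ico p q ∪ insert q (C.filter (q < ·)) := by
    conv_lhs => rw [eC1]
    ext x
    simp only [Finset.mem_union, Finset.mem_insert]
    tauto
  set K1 := K.filter (· < p) with hK1
  set K2 := K.filter (q < ·) with hK2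
  set C1 := C.filter (· < p) with hC1
  set C2 := C.filter (q < ·) with hC2
  have hC1K1 : ∀ t, gc C1 t ≤ gc K1 (t + 1) := by
    intro t
    by_cases ht : t < p
    · have := h1 t ht
      have a1 := gc_filter_lt (S := C) (show t ≤ p by omega)
      have a2 := gc_filter_lt (S := K) (show t + 1 ≤ p by omega)
      rw [← hC1] at a1
      rw [← hK1] at a2
      omega
    · rw [hC1, gc_filter_lt_eq_zero (by omega)]
      omega
  have hK2C2 : ∀ t, lc K2 (t + 1) ≤ lc C2 t := by
    intro t
    by_cases ht : q < t
    · have := h2 t ht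
      have a1 := lc_filter_gt (S := K) (show q + 1 ≤ t + 1 by omega)
      have a2 := lc_filter_gt (S := C) (show q + 1 ≤ t by omega)
      rw [← hK2] at a1
      rw [← hC2] at a2
      omega
    · rw [hK2, lc_filter_gt_eq_zero (by omega)]
      omega
  have mK1 : ∀ y ∈ K1, y < p := fun y hy => (Finset.mem_filter.1 hy).2
  have mK2 : ∀ y ∈ K2, q < y := fun y hy => (Finset.mem_filter.1 hy).2
  have mC1 : ∀ y ∈ C1, y < p := fun y hy => (Finset.mem_filter.1 hy).2
  have mC2 : ∀ y ∈ C2, q < y := fun y hy => (Finset.mem_filter.1 hy).2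
  have uC : ∀ t, gc (C1 ∪ Finset.Ico p q) t ≤ gc (K1 ∪ Finset.Ico (p + 1) (q + 1)) (t + 1) := by
    intro t
    rw [gc_union, gc_union, gc_Ico_succ]
    · have := hC1K1 t
      omega
    · rw [Finset.disjoint_left]
      intro x hx
      have := mK1 x hx
      simp only [Finset.mem_Ico]
      omega
    · rw [Finset.disjoint_left]
      intro x hx
      have := mC1 x hx
      simp only [Finset.mem_Ico]
      omega
  have uC' : ∀ t, gc (C1 ∪ Finset.Ico p q) t ≤ gc (K1 ∪ Finset.Ico p (q + 1)) (t + 1) := fun t =>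
    (uC t).trans (gc_subset (Finset.union_subset_union_right
      (Finset.Ico_subset_Ico_left (by omega))) _)
  have i1 : inc (K1 ∪ Finset.Ico p (q + 1)) = inc K1 ++ inc (Finset.Ico p (q + 1)) :=
    inc_union (fun x hx y hy => by have := mK1 x hx; rw [Finset.mem_Ico] at hy; omega)
  have i2 : inc (K1 ∪ Finset.Ico (p + 1) (q + 1)) = inc K1 ++ inc (Finset.Ico (p + 1) (q + 1)) :=
    inc_union (fun x hx y hy => by have := mK1 x hx; rw [Finset.mem_Ico] at hy; omega)
  have i3 : inc (C1 ∪ Finset.Ico p q) = inc C1 ++ inc (Finset.Ico p q) :=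
    inc_union (fun x hx y hy => by have := mC1 x hx; rw [Finset.mem_Ico] at hy; omega)
  have i4 : inc (insert p K) = inc K1 ++ inc (Finset.Ico p (q + 1)) ++ inc K2 := by
    rw [eK1, inc_union, i1]
    intro x hx y hy
    have := mK2 y hy
    rw [Finset.mem_union, Finset.mem_Ico] at hx
    rcases hx with hx | hx
    · have := mK1 x hx
      omega
    · omega
  have i5 : inc K = inc K1 ++ inc (Finset.Ico (p + 1) (q + 1)) ++ inc K2 := by
    rw [eK2, inc_union, i2]
    intro x hx y hy
    have := mK2 y hy
    rw [Finset.mem_union, Finset.mem_Ico] at hx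
    rcases hx with hx | hx
    · have := mK1 x hx
      omega
    · omega
  have i6 : inc C = inc C1 ++ inc (Finset.Ico p q) ++ inc C2 := by
    rw [eC1, inc_union, i3]
    intro x hx y hy
    have := mC2 y hy
    rw [Finset.mem_union, Finset.mem_Ico] at hx
    rcases hx with hx | hx
    · have := mC1 x hx
      omega
    · omega
  have i7 : inc (insert q C) = inc C1 ++ inc (Finset.Ico p q) ++ q :: inc C2 := by
    rw [eC2, inc_union, i3, inc_insert_min mC2]
    intro x hx y hy
    rw [Finset.mem_union, Finset.mem_Ico] at hx
    rw [Finset.mem_insert] at hy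
    have hy' : q ≤ y := by
      rcases hy with rfl | hy
      · exact le_rfl
      · have := mC2 y hy
        omega
    rcases hx with hx | hx
    · have := mC1 x hx
      omega
    · omega
  have i8 : inc (Finset.Ico p (q + 1)) = inc (Finset.Ico p q) ++ [q] := by
    rw [← inc_insert_max (by simp)]
    congr 1
    ext x
    simp only [Finset.mem_Ico, Finset.mem_insert]
    omega
  rw [i4, i6] at hnb ⊢
  rw [i5, i7]
  have s1 := ck_right (inc C2) (slide_bigs (X := K2) _ uC' (by
    intro y hy x hx
    have := mK2 x hx
    rw [Finset.mem_union, Finset.mem_Ico] at hy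
    rcases hy with hy | hy
    · have := mK1 y hy
      omega
    · omega) (Or.inr (by
      rw [i1, i3]
      refine nb_left (b := inc C2) ?_
      simpa using hnb)))
  rw [i1, i3] at s1
  have n1 := nb_ck s1 (by simpa using hnb)
  have s2 := ck_right (inc (Finset.Ico p q) ++ inc K2 ++ inc C2)
    (slide_bigs (X := Finset.Ico p (q + 1)) K1 hC1K1 (by
      intro y hy x hx
      have := mK1 y hy
      rw [Finset.mem_Ico] at hx
      omega) (Or.inr (nb_left (b := inc (Finset.Ico p q) ++ inc K2 ++ inc C2)
        (by simpa using n1))))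
  have n2 := nb_ck s2 (by simpa using n1)
  have s3 := ck_ctx (inc K1 ++ inc C1) (inc K2 ++ inc C2) (run_exchange hpq)
  have n3 := nb_ck s3 (by simpa using n2)
  rw [i8] at n3
  have s4 := ck_left (inc K1 ++ inc C1 ++ inc (Finset.Ico (p + 1) (q + 1)) ++ inc (Finset.Ico p q))
    (slide_small hK2C2 mC2 (nb_right (a := inc K1 ++ inc C1 ++ inc (Finset.Ico (p + 1) (q + 1)) ++
      inc (Finset.Ico p q)) (by simpa using n3)))
  have n4 := nb_ck s4 (by simpa using n3)
  have s5 := ck_right (inc (Finset.Ico p q) ++ inc K2 ++ [q] ++ inc C2)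
    (slide_bigs (X := Finset.Ico (p + 1) (q + 1)) K1 hC1K1 (by
      intro y hy x hx
      have := mK1 y hy
      rw [Finset.mem_Ico] at hx
      omega) (Or.inl (nb_left (b := inc (Finset.Ico p q) ++ inc K2 ++ [q] ++ inc C2)
        (by simpa using n4))))
  have n5 := nb_ck (ck_symm s5) (by simpa using n4)
  have s6 := ck_right ([q] ++ inc C2) (slide_bigs (X := K2) _ uC (by
    intro y hy x hx
    have := mK2 x hx
    rw [Finset.mem_union, Finset.mem_Ico] at hy
    rcases hy with hy | hy
    · have := mK1 y hy
      omega
    · omega) (Or.inl (by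
      rw [i2, i3]
      refine nb_left (b := [q] ++ inc C2) ?_
      simpa using n5)))
  rw [i2, i3] at s6
  simp only [List.append_assoc, List.cons_append, List.nil_append] at s1 s2 s3 s4 s5 s6 ⊢
  rw [i8] at s1 s2 s3
  rw [i8]
  simp only [List.append_assoc, List.cons_append, List.nil_append] at s1 s2 s3 s4 s5 s6 ⊢
  exact ck_trans s1 (ck_trans s2 (ck_trans s3 (ck_trans s4 (ck_trans (ck_symm s5) (ck_symm s6)))))


/-! ### The raising operator is a block exchange -/

theorem find_min {A : List ℕ} (hA : A.Pairwise (· < ·)) {b a : ℕ}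
    (h : A.find? (fun a => decide (b < a)) = some a) :
    a ∈ A ∧ b < a ∧ ∀ x ∈ A, b < x → a ≤ x := by
  rw [List.find?_eq_some_iff_append] at h
  obtain ⟨h1, as, bs, rfl, h2⟩ := h
  refine ⟨by simp, by simpa using h1, fun x hx hbx => ?_⟩
  rw [List.pairwise_append, List.pairwise_cons] at hA
  simp only [List.mem_append, List.mem_cons] at hx
  rcases hx with hx | rfl | hx
  · have := h2 x hx
    simp at this
    omega
  · exact le_rfl
  · exact (hA.2.1.1 x hx).le

theorem erase_toFinset {A : List ℕ} (hA : A.Pairwise (· < ·)) (a : ℕ) :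
    (A.erase a).toFinset = A.toFinset.erase a := by
  ext x
  have : A.Nodup := hA.imp (fun h => by omega)
  simp [this.mem_erase_iff]

theorem unpairedUpper_spec {p : ℕ} {L : List ℕ} (hL : L.Pairwise (· > ·)) :
    ∀ A : List ℕ, A.Pairwise (· < ·) → p ∈ unpairedUpper L A →
      p ∈ A ∧ (∀ t, t < p → lc L.toFinset p + lc A.toFinset (t + 1) ≤
        lc A.toFinset p + lc L.toFinset t) ∧
      ((∀ x ∈ unpairedUpper L A, x ≤ p) → ∀ t, p < t →
        lc A.toFinset (t + 1) + lc L.toFinset p ≤ lc L.toFinset t + lc A.toFinset (p + 1)) := by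
  induction L with
  | nil =>
    intro A hA hp
    unfold unpairedUpper at hp ⊢
    refine ⟨hp, fun t ht => ?_, fun hm t ht => ?_⟩
    · have := lc_mono A.toFinset (show t + 1 ≤ p by omega)
      simp [lc] at this ⊢
      omega
    · have h1 : ∀ s, p + 1 ≤ s → lc A.toFinset s = A.toFinset.card := fun s hs =>
        lc_of_ge (fun x hx => by have := hm x (by simpa using hx); omega)
      rw [h1 _ le_rfl, h1 _ (by omega)]
      simp [lc]
  | cons b bs ih =>
    intro A hA hp
    rw [List.pairwise_cons] at hL
    have hb : b ∉ bs.toFinset := by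
      intro h
      have := hL.1 b (by simpa using h)
      omega
    unfold unpairedUpper at hp ⊢
    rw [List.toFinset_cons]
    cases hfind : A.find? (fun a => decide (b < a)) with
    | some a =>
      rw [hfind] at hp
      obtain ⟨ha, hba, hmin⟩ := find_min hA hfind
      obtain ⟨h1, h2, h3⟩ := ih hL.2 (A.erase a) (hA.sublist List.erase_sublist) hp
      have hnd : A.Nodup := hA.imp (fun h => by omega)
      rw [hnd.mem_erase_iff] at h1
      rw [erase_toFinset hA] at h2 h3
      have ha' : a ∈ A.toFinset := by simpa using ha
      refine ⟨h1.2, fun t ht => ?_, fun hm t ht => ?_⟩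
      · have := h2 t ht
        have e1 := lc_erase ha' (t + 1)
        have e2 := lc_erase ha' p
        have := hmin p h1.2
        rw [lc_insert hb, lc_insert hb]
        split_ifs at e1 e2 ⊢ <;> omega
      · have := h3 hm t ht
        have e1 := lc_erase ha' (t + 1)
        have e2 := lc_erase ha' (p + 1)
        have := hmin p h1.2
        rw [lc_insert hb, lc_insert hb]
        split_ifs at e1 e2 ⊢ <;> omega
    | none =>
      rw [hfind] at hp
      obtain ⟨h1, h2, h3⟩ := ih hL.2 A hA hp
      have hbp : ¬ b < p := by
        rw [List.find?_eq_none] at hfind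
        simpa using hfind p h1
      refine ⟨h1, fun t ht => ?_, fun hm t ht => ?_⟩
      · have := h2 t ht
        rw [lc_insert hb, lc_insert hb]
        split_ifs <;> omega
      · have := h3 hm t ht
        rw [lc_insert hb, lc_insert hb]
        split_ifs <;> omega

theorem foldr_max_spec {l : List ℕ} (h : l ≠ []) :
    l.foldr max 0 ∈ l ∧ ∀ x ∈ l, x ≤ l.foldr max 0 := by
  induction l with
  | nil => exact absurd rfl h
  | cons a l ih =>
    by_cases hl : l = []
    · subst hl
      simp
    · obtain ⟨h1, h2⟩ := ih hl
      simp only [List.foldr_cons]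
      constructor
      · rcases max_choice a (l.foldr max 0) with h | h <;> rw [h]
        · simp
        · simp [h1]
      · intro x hx
        rw [List.mem_cons] at hx
        rcases hx with rfl | hx
        · exact le_max_left _ _
        · exact (h2 x hx).trans (le_max_right _ _)

theorem mem_insAsc {x y : ℕ} {l : List ℕ} : y ∈ insAsc x l ↔ y = x ∨ y ∈ l := by
  induction l with
  | nil => simp [insAsc]
  | cons a l ih =>
    unfold insAsc
    split_ifs
    · simp
    · simp only [List.mem_cons, ih]
      tauto

theorem insAsc_pairwise {x : ℕ} {l : List ℕ} (h : l.Pairwise (· < ·)) (hx : x ∉ l) :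
    (insAsc x l).Pairwise (· < ·) := by
  induction l with
  | nil => simp [insAsc]
  | cons a l ih =>
    have hxa : x ≠ a := fun e => hx (by simp [e])
    have hh := List.pairwise_cons.1 h
    unfold insAsc
    split_ifs with h1
    · rw [List.pairwise_cons]
      refine ⟨fun y hy => ?_, h⟩
      rw [List.mem_cons] at hy
      rcases hy with rfl | hy
      · omega
      · have := hh.1 y hy
        omega
    · rw [List.pairwise_cons]
      refine ⟨fun y hy => ?_, ih hh.2 (fun h => hx (by simp [h]))⟩
      rw [mem_insAsc] at hy
      rcases hy with rfl | hy
      · omega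
      · exact hh.1 y hy

theorem msE_spec {i : ℕ} {f g : ℕ → List ℕ} (hg : msE i f = some g)
    (hA : (f (i + 1)).Pairwise (· < ·)) (hB : (f i).Pairwise (· < ·))
    (hred : IsReducedWord (f (i + 1) ++ f i)) :
    ∃ (K C : Finset ℕ) (p q : ℕ), p ∉ K ∧ q ∉ C ∧ f (i + 1) = inc (insert p K) ∧ f i = inc C ∧
      g = Function.update (Function.update f (i + 1) (inc K)) i (inc (insert q C)) ∧
      CKEquiv (inc (insert p K) ++ inc C) (inc K ++ inc (insert q C)) := by
  unfold msE at hg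
  simp only at hg
  split_ifs at hg with hL
  obtain ⟨hmem, hmax⟩ := foldr_max_spec hL
  set p := (unpairedUpper (f i).reverse (f (i + 1))).foldr max 0 with hp
  set A := (f (i + 1)).toFinset with hAd
  set C := (f i).toFinset with hCd
  have hrev : (f i).reverse.toFinset = C := by simp [hCd]
  obtain ⟨h1, h2, h3⟩ := unpairedUpper_spec (by
    rw [List.pairwise_reverse]; exact hB) _ hA hmem
  rw [hrev, ← hAd] at h2 h3
  have h3 := h3 hmax
  have hpA : p ∈ A := by simpa [hAd] using h1
  have eA : f (i + 1) = inc A := (inc_toFinset hA).symm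
  have eB : f i = inc C := (inc_toFinset hB).symm
  have hne : {j : ℕ | p + j + 1 ∉ f (i + 1)}.Nonempty := by
    by_contra hcon
    rw [Set.not_nonempty_iff_eq_empty] at hcon
    have : ∀ j, p + j + 1 ∈ A := by
      intro j
      by_contra hj
      have : j ∈ {j : ℕ | p + j + 1 ∉ f (i + 1)} := by
        simpa [hAd] using hj
      rw [hcon] at this
      exact this
    have h4 := this (A.sup id)
    have := Finset.le_sup (f := id) h4
    simp only [id] at this
    omega
  set s := sInf {j : ℕ | p + j + 1 ∉ f (i + 1)} with hs
  have hs1 : p + s + 1 ∉ A := by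
    have := Nat.sInf_mem hne
    simpa [hAd] using this
  have hs2 : ∀ j, j < s → p + j + 1 ∈ A := by
    intro j hj
    have := Nat.notMem_of_lt_sInf hj
    simpa [hAd] using this
  set q := p + s with hq
  have hAi : ∀ y, p ≤ y → y ≤ q → y ∈ A := by
    intro y hy hyq
    by_cases e : y = p
    · rw [e]; exact hpA
    · have := hs2 (y - p - 1) (by omega)
      rwa [show p + (y - p - 1) + 1 = y by omega] at this
  -- counting inside the run
  have hrun : ∀ k, k ≤ s → lc A (p + k + 1) = lc A (p + 1) + k := by
    intro k
    induction k with
    | zero => intro _; rfl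
    | succ k ih =>
      intro hk
      rw [lc_succ, if_pos (hAi _ (by omega) (by omega)), show p + (k + 1) = p + k + 1 by ring,
        ih (by omega)]
      ring
  have hCrun : ∀ k, k ≤ s → lc C (p + k) = lc C p + k ∧ ∀ y, p ≤ y → y < p + k → y ∈ C := by
    intro k
    induction k with
    | zero => intro _; exact ⟨rfl, fun y _ _ => by omega⟩
    | succ k ih =>
      intro hk
      obtain ⟨e1, e2⟩ := ih (by omega)
      have h4 := h3 (p + (k + 1)) (by omega)
      rw [hrun _ hk, show p + (k + 1) = p + k + 1 by ring, lc_succ C, e1] at h4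
      have hin : p + k ∈ C := by
        by_contra hn
        rw [if_neg hn] at h4
        omega
      refine ⟨?_, fun y hy hy' => ?_⟩
      · rw [show p + (k + 1) = p + k + 1 by ring, lc_succ, e1, if_pos hin]
        ring
      · by_cases e : y = p + k
        · rw [e]; exact hin
        · exact e2 y hy (by omega)
  obtain ⟨hCq, hCi⟩ := hCrun s le_rfl
  have hqC : q ∉ C := by
    intro hqC
    have r1 : inc A = inc (A.filter (· < p)) ++ List.range' p (s + 1) ++
        inc (A.filter (q < ·)) := by
      apply inc_eq
      · rw [List.pairwise_append, List.pairwise_append]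
        refine ⟨⟨inc_pairwise _, List.pairwise_lt_range', ?_⟩, inc_pairwise _, ?_⟩
        · intro x hx y hy
          rw [mem_inc, Finset.mem_filter] at hx
          rw [List.mem_range'_1] at hy
          omega
        · intro x hx y hy
          rw [mem_inc, Finset.mem_filter] at hy
          rw [List.mem_append, mem_inc, Finset.mem_filter, List.mem_range'_1] at hx
          omega
      · intro x
        simp only [List.mem_append, mem_inc, Finset.mem_filter, List.mem_range'_1]
        constructor
        · rintro ((h | h) | h)
          · exact h.1
          · exact hAi x (by omega) (by omega)
          · exact h.1
        · intro h
          by_cases h5 : x < p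
          · exact Or.inl (Or.inl ⟨h, h5⟩)
          · by_cases h6 : x ≤ q
            · omega
            · exact Or.inr ⟨h, by omega⟩
    have r2 : inc C = inc (C.filter (· < p)) ++ List.range' p (s + 1) ++
        inc (C.filter (q < ·)) := by
      apply inc_eq
      · rw [List.pairwise_append, List.pairwise_append]
        refine ⟨⟨inc_pairwise _, List.pairwise_lt_range', ?_⟩, inc_pairwise _, ?_⟩
        · intro x hx y hy
          rw [mem_inc, Finset.mem_filter] at hx
          rw [List.mem_range'_1] at hy
          omega
        · intro x hx y hy
          rw [mem_inc, Finset.mem_filter] at hy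
          rw [List.mem_append, mem_inc, Finset.mem_filter, List.mem_range'_1] at hx
          omega
      · intro x
        simp only [List.mem_append, mem_inc, Finset.mem_filter, List.mem_range'_1]
        constructor
        · rintro ((h | h) | h)
          · exact h.1
          · by_cases e : x = q
            · rw [e]; exact hqC
            · exact hCi x (by omega) (by omega)
          · exact h.1
        · intro h
          by_cases h5 : x < p
          · exact Or.inl (Or.inl ⟨h, h5⟩)
          · by_cases h6 : x ≤ q
            · omega
            · exact Or.inr ⟨h, by omega⟩
    rw [eA, eB, r1, r2] at hred
    refine not_reduced_runs (q := p) (s := s) (X := inc (A.filter (q < ·)))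
      (Y := inc (C.filter (· < p))) ?_ ?_ (reduced_factor (a := inc (A.filter (· < p)))
        (b := inc (C.filter (q < ·))) (by simpa using hred))
    · intro x hx
      rw [mem_inc, Finset.mem_filter] at hx
      have : x ≠ p + s + 1 := fun e => hs1 (e ▸ hx.1)
      omega
    · intro y hy
      rw [mem_inc, Finset.mem_filter] at hy
      have h5 := h2 (p - 1) (by omega)
      have h6 := lc_succ C (p - 1)
      rw [show p - 1 + 1 = p by omega] at h5 h6
      have : y ≠ p - 1 := by
        rintro rfl
        rw [if_pos hy.1] at h6
        omega
      omega
  have eK : inc (A.erase p) = (f (i + 1)).erase p := by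
    rw [hAd, ← erase_toFinset hA]
    exact inc_toFinset (hA.sublist List.erase_sublist)
  have eQ : inc (insert q C) = insAsc q (f i) := by
    apply inc_eq
    · exact insAsc_pairwise hB (by simpa [hCd] using hqC)
    · intro x
      rw [mem_insAsc]
      simp [hCd]
  refine ⟨A.erase p, C, p, q, by simp, hqC, ?_, eB, ?_, ?_⟩
  · rw [Finset.insert_erase hpA]; exact eA
  · rw [eK, eQ]
    simpa using hg.symm
  · have hlc : ∀ t, p + 1 ≤ t → lc A t = lc (A.erase p) t + 1 := by
      intro t ht
      have := lc_erase hpA t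
      rw [if_pos (by omega)] at this
      exact this
    have hlc' : ∀ t, t ≤ p → lc A t = lc (A.erase p) t := by
      intro t ht
      have := lc_erase hpA t
      rw [if_neg (by omega)] at this
      exact this
    apply block_exchange (by omega) (by simp)
    · intro y hy hyq
      rw [Finset.mem_erase]
      exact ⟨by omega, hAi y hy.le hyq⟩
    · intro y hy hyq
      exact hCi y hy hyq
    · exact hqC
    · intro t ht
      have := h2 t ht
      rw [hlc' _ le_rfl, hlc' _ (by omega)] at this
      exact this
    · intro t ht
      have h5 := h3 t (by omega)
      have h6 := hrun s le_rfl
      have h7 := lc_succ C q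
      rw [if_neg hqC] at h7
      rw [hlc (t + 1) (by omega), hlc (p + 1) (by omega)] at h5
      rw [hlc (p + s + 1) (by omega), hlc (p + 1) (by omega)] at h6
      rw [← hq] at h6 hCq
      omega
    · rw [Finset.insert_erase hpA, ← eA, ← eB]
      exact nb_of_reduced hred


/-! ### Bracket matching of finite sets -/

theorem eq_of_lc {S T : Finset ℕ} (h : ∀ t, lc S t = lc T t) : S = T := by
  ext x
  have h1 := lc_succ S x
  have h2 := lc_succ T x
  rw [h, h] at h1
  split_ifs at h1 h2 <;> first | tauto | omega

/-- Every element of `D` can be matched with its own strictly smaller element of `C`. -/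
def Matched (C D : Finset ℕ) : Prop := ∀ t, lc D (t + 1) ≤ lc C t

/-- The number of unmatched openers below `s`, before closing those above. -/
def ht (C D : Finset ℕ) (s : ℕ) : ℕ := lc C s - lc D (s + 1)

/-- The minimum of the height function from `t` on. -/
def mn (C D : Finset ℕ) (t : ℕ) : ℕ := sInf {v | ∃ s, t ≤ s ∧ v = ht C D s}

/-- The elements of `C` matched with an element of `D`. -/
def mat (C D : Finset ℕ) : Finset ℕ := C.filter (fun o => ∃ s, o < s ∧ ht C D s ≤ ht C D o)

theorem mn_le {C D : Finset ℕ} {s t : ℕ} (h : t ≤ s) : mn C D t ≤ ht C D s :=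
  Nat.sInf_le ⟨s, h, rfl⟩

theorem mn_att (C D : Finset ℕ) (t : ℕ) : ∃ s, t ≤ s ∧ mn C D t = ht C D s :=
  Nat.sInf_mem (s := {v | ∃ s, t ≤ s ∧ v = ht C D s}) ⟨_, t, le_rfl, rfl⟩

theorem mn_mono (C D : Finset ℕ) {s t : ℕ} (h : s ≤ t) : mn C D s ≤ mn C D t := by
  obtain ⟨r, h1, h2⟩ := mn_att C D t
  rw [h2]
  exact mn_le (h.trans h1)

theorem matched_ht {C D : Finset ℕ} (h : Matched C D) (s : ℕ) :
    ht C D s + lc D (s + 1) = lc C s := by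
  have := h s
  unfold ht
  omega

theorem matched_subset {C D D' : Finset ℕ} (h : Matched C D) (hd : D' ⊆ D) : Matched C D' :=
  fun t => (lc_subset hd _).trans (h t)

theorem matched_superset {C C' D : Finset ℕ} (h : Matched C D) (hd : C ⊆ C') : Matched C' D :=
  fun t => (h t).trans (lc_subset hd _)

theorem mat_subset (C D : Finset ℕ) : mat C D ⊆ C := Finset.filter_subset _ _

theorem lc_mat {C D : Finset ℕ} (h : Matched C D) (t : ℕ) :
    lc (mat C D) t + mn C D t = lc C t := by
  induction t with
  | zero =>
    have h1 := mn_le (C := C) (D := D) (le_refl 0)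
    have h2 := matched_ht h 0
    have z1 := lc_zero C
    have z2 := lc_zero (mat C D)
    omega
  | succ t ih =>
    rw [lc_succ, lc_succ C]
    have hm : t ∈ mat C D ↔ t ∈ C ∧ ∃ s, t < s ∧ ht C D s ≤ ht C D t := by
      simp [mat]
    have e1 := matched_ht h t
    have e2 := matched_ht h (t + 1)
    have e3 := lc_succ C t
    have e4 := lc_mono D (show t + 1 ≤ t + 1 + 1 by omega)
    have m1 := mn_le (C := C) (D := D) (le_refl t)
    have m2 := mn_le (C := C) (D := D) (le_refl (t + 1))
    have m3 := mn_mono C D (show t ≤ t + 1 by omega)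
    obtain ⟨s, hs1, hs2⟩ := mn_att C D t
    obtain ⟨s', hs1', hs2'⟩ := mn_att C D (t + 1)
    by_cases hex : ∃ s, t < s ∧ ht C D s ≤ ht C D t
    · have key : mn C D (t + 1) = mn C D t := by
        obtain ⟨r, hr, hr'⟩ := hex
        have := mn_le (C := C) (D := D) (show t + 1 ≤ r from hr)
        rcases Nat.lt_or_ge t s with h1 | h1
        · have := mn_le (C := C) (D := D) (show t + 1 ≤ s from h1)
          omega
        · have : s = t := by omega
          subst this
          omega
      by_cases htC : t ∈ C
      · rw [if_pos htC, if_pos (hm.2 ⟨htC, hex⟩)]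
        omega
      · rw [if_neg htC, if_neg (fun h => htC (hm.1 h).1)]
        omega
    · have hno : ∀ r, t < r → ht C D t < ht C D r := by
        intro r hr
        by_contra hc
        exact hex ⟨r, hr, by omega⟩
      have h1 := hno (t + 1) (by omega)
      have htC : t ∈ C := by
        by_contra hc
        rw [if_neg hc] at e3
        omega
      rw [if_pos htC] at e3 ⊢
      rw [if_neg (fun h => hex (hm.1 h).2)]
      have h2 := hno s' (by omega)
      have h3 : mn C D t = ht C D t := by
        rcases Nat.lt_or_ge t s with h1 | h1
        · have := hno s h1
          omega
        · have : s = t := by omega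
          rw [hs2, this]
      omega

theorem mat_eq {C D X : Finset ℕ} (h : Matched C D) (hX : ∀ t, lc X t + mn C D t = lc C t) :
    mat C D = X := by
  apply eq_of_lc
  intro t
  have := lc_mat h t
  have := hX t
  omega

theorem mat_congr {C D D' : Finset ℕ} (h : Matched C D) (h' : Matched C D')
    (hm : ∀ t, mn C D t = mn C D' t) : mat C D = mat C D' := by
  apply mat_eq h
  intro t
  rw [hm]
  exact lc_mat h' t

theorem mat_mono {C D D' : Finset ℕ} (h : Matched C D') (hd : D ⊆ D') : mat C D ⊆ mat C D' := by
  intro o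
  unfold mat
  simp only [Finset.mem_filter]
  rintro ⟨ho, s, hs, hle⟩
  refine ⟨ho, s, hs, ?_⟩
  have h1 := matched_ht (matched_subset h hd) s
  have h2 := matched_ht (matched_subset h hd) o
  have h3 := matched_ht h s
  have h4 := matched_ht h o
  have h5 : lc D (s + 1) + lc D' (o + 1) ≤ lc D' (s + 1) + lc D (o + 1) := by
    have hsd : Disjoint D (D' \ D) := Finset.disjoint_sdiff
    have e := Finset.union_sdiff_of_subset hd
    have e1 := lc_union hsd (s + 1)
    have e2 := lc_union hsd (o + 1)
    rw [e] at e1 e2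
    have := lc_mono (D' \ D) (show o + 1 ≤ s + 1 by omega)
    omega
  omega

theorem card_mat {C D : Finset ℕ} (h : Matched C D) : (mat C D).card = D.card := by
  obtain ⟨N, hN⟩ : ∃ N, ∀ x ∈ C ∪ D, x < N :=
    ⟨(C ∪ D).sup id + 1, fun x hx => Nat.lt_succ_of_le (Finset.le_sup (f := id) hx)⟩
  have hC : ∀ t, N ≤ t → lc C t = C.card := fun t ht =>
    lc_of_ge (fun x hx => (hN x (by simp [hx])).trans_le ht)
  have hD : ∀ t, N ≤ t → lc D t = D.card := fun t ht =>
    lc_of_ge (fun x hx => (hN x (by simp [hx])).trans_le ht)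
  have hM : lc (mat C D) N = (mat C D).card :=
    lc_of_ge (fun x hx => hN x (by simp [mat_subset C D hx]))
  have h1 := lc_mat h N
  obtain ⟨s, hs, hs'⟩ := mn_att C D N
  have h2 := matched_ht h s
  rw [hC s hs, hD (s + 1) (by omega)] at h2
  rw [hM, hC N le_rfl] at h1
  omega

/-- Below a point of height zero all openers are matched. -/
theorem lc_mat_of_zero {C D : Finset ℕ} (h : Matched C D) {s t : ℕ} (hz : lc C s ≤ lc D (s + 1))
    (ht : t ≤ s) : lc (mat C D) t = lc C t := by
  have h1 := mn_le (C := C) (D := D) ht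
  have h2 := matched_ht h s
  have h3 := lc_mat h t
  omega

/-- Adding a closer to a matching adds one matched opener. -/
theorem mat_insert {C D : Finset ℕ} {p : ℕ} (hp : p ∉ D) (h : Matched C (insert p D)) :
    ∃ r ∈ C, r ∉ mat C D ∧ r < p ∧ mat C (insert p D) = insert r (mat C D) ∧
      (∀ z ∈ C, r < z → z < p → z ∈ mat C D) ∧
      ∀ D1 ⊆ D, (∀ t, t ≤ p + 1 → lc D1 t = lc D t) →
        ∀ t, t ≤ r + 1 → lc (mat C D1) t = lc (mat C D) t := by
  have hD : Matched C D := matched_subset h (Finset.subset_insert _ _)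
  have hht : ∀ s, ht C (insert p D) s + (if p ≤ s then 1 else 0) = ht C D s := by
    intro s
    have h1 := matched_ht h s
    have h2 := matched_ht hD s
    rw [lc_insert hp] at h1
    split_ifs at h1 ⊢ <;> omega
  have hpos : 1 ≤ mn C D p := by
    obtain ⟨s, hs, hs'⟩ := mn_att C D p
    have := hht s
    rw [if_pos hs] at this
    omega
  have hzero : mn C D 0 = 0 := by
    have h1 := mn_le (C := C) (D := D) (le_refl 0)
    have h2 := matched_ht hD 0
    rw [lc_zero] at h2
    omega
  -- the last position where the minimum is smaller
  obtain ⟨r, hr1, hr2⟩ : ∃ r, mn C D r < mn C D p ∧ mn C D (r + 1) = mn C D p := by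
    have hex : ∃ k, mn C D p ≤ mn C D k := ⟨p, le_rfl⟩
    have h1 := Nat.find_spec hex
    have h2 : Nat.find hex ≠ 0 := by
      intro h0
      rw [h0, hzero] at h1
      omega
    obtain ⟨r, hr⟩ := Nat.exists_eq_succ_of_ne_zero h2
    have h3 := Nat.find_min hex (show r < Nat.find hex by omega)
    have h4 : Nat.find hex ≤ p := Nat.find_min' hex le_rfl
    have h5 := mn_mono C D h4
    rw [hr] at h1 h5
    exact ⟨r, by omega, by rw [Nat.succ_eq_add_one] at *; omega⟩
  have hrp : r < p := by
    by_contra hc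
    have := mn_mono C D (show p ≤ r by omega)
    omega
  have hrr : mn C D r = ht C D r := by
    obtain ⟨s, hs, hs'⟩ := mn_att C D r
    rcases Nat.lt_or_ge r s with h1 | h1
    · have := mn_le (C := C) (D := D) (show r + 1 ≤ s from h1)
      omega
    · rw [hs', show s = r by omega]
  have l1 := lc_mat hD r
  have l2 := lc_mat hD (r + 1)
  rw [lc_succ, lc_succ C] at l2
  have hrC : r ∈ C := by
    by_contra hc
    rw [if_neg hc] at l2
    split_ifs at l2 <;> omega
  have hrM : r ∉ mat C D := by
    intro hc
    rw [if_pos hc] at l2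
    split_ifs at l2
    omega
  rw [if_pos hrC, if_neg hrM] at l2
  refine ⟨r, hrC, hrM, hrp, ?_, ?_, ?_⟩
  · apply mat_eq h
    intro t
    rw [lc_insert hrM]
    have e := lc_mat hD t
    suffices mn C (insert p D) t + (if r < t then 1 else 0) = mn C D t by omega
    obtain ⟨s, hs, hs'⟩ := mn_att C (insert p D) t
    obtain ⟨s2, hs2, hs2'⟩ := mn_att C D t
    have b1 := hht s
    have b2 := hht s2
    have b3 := mn_le (C := C) (D := D) hs
    have b4 := mn_le (C := C) (D := insert p D) hs2
    split_ifs with hrt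
    · apply le_antisymm
      · by_cases hps : p ≤ s2
        · rw [if_pos hps] at b2
          omega
        · obtain ⟨s3, hs3, hs3'⟩ := mn_att C D p
          have c1 := mn_mono C D (show r + 1 ≤ t from hrt)
          have c2 := mn_mono C D (show t ≤ p by omega)
          have c3 := hht s3
          rw [if_pos hs3] at c3
          have c4 := mn_le (C := C) (D := insert p D) (show t ≤ s3 by omega)
          omega
      · split_ifs at b1 <;> omega
    · have c1 := mn_mono C D (show t ≤ r by omega)
      apply le_antisymm
      · split_ifs at b2 <;> omega
      · by_cases hps : p ≤ s
        · rw [if_pos hps] at b1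
          have := mn_le (C := C) (D := D) hps
          omega
        · rw [if_neg hps] at b1
          omega
  · intro z hz hrz hzp
    by_contra hc
    have c1 := lc_mat hD z
    have c2 := lc_mat hD (z + 1)
    rw [lc_succ, lc_succ C, if_pos hz, if_neg hc] at c2
    have c3 := mn_mono C D (show r + 1 ≤ z from hrz)
    have c4 := mn_mono C D (show z + 1 ≤ p from hzp)
    omega
  · intro D1 hD1 hlc
    have hM1 : Matched C D1 := matched_subset hD hD1
    have key : ∀ t, t ≤ r → lc (mat C D1) t = lc (mat C D) t := by
      intro t htr
      have e1 := lc_mat hD t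
      have e2 := lc_mat hM1 t
      suffices mn C D1 t = mn C D t by omega
      apply le_antisymm
      · obtain ⟨s, hs, hs'⟩ := mn_att C D t
        by_cases hsp : s ≤ p
        · have b1 := mn_le (C := C) (D := D1) hs
          have b2 := matched_ht hD s
          have b3 := matched_ht hM1 s
          rw [hlc (s + 1) (by omega)] at b3
          omega
        · have b1 := mn_le (C := C) (D := D1) htr
          have b2 := matched_ht hD r
          have b3 := matched_ht hM1 r
          rw [hlc (r + 1) (by omega)] at b3
          have b4 := mn_le (C := C) (D := D) (show p ≤ s by omega)
          omega
      · obtain ⟨s, hs, hs'⟩ := mn_att C D1 t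
        have b1 := mn_le (C := C) (D := D) hs
        have b2 := matched_ht hD s
        have b3 := matched_ht hM1 s
        have b4 := lc_subset hD1 (s + 1)
        omega
    intro t htr
    by_cases hc : t ≤ r
    · exact key t hc
    · have : t = r + 1 := by omega
      subst this
      rw [lc_succ, lc_succ, key r le_rfl, if_neg hrM,
        if_neg (fun hh => hrM (mat_mono hD hD1 hh))]

/-- Exchanging a closer below a point of height zero does not change the matched openers. -/
theorem mat_closer_exchange {C K K' : Finset ℕ} {e : ℕ} (h : Matched C K) (h' : Matched C K')
    (hle : ∀ s, lc K (s + 1) ≤ lc K' (s + 1)) (heq : ∀ s, e ≤ s → lc K (s + 1) = lc K' (s + 1))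
    (hz : lc C e ≤ lc K (e + 1)) : mat C K = mat C K' := by
  apply mat_congr h h'
  intro t
  by_cases hte : t ≤ e
  · have h1 := mn_le (C := C) (D := K) hte
    have h2 := mn_le (C := C) (D := K') hte
    have h3 := matched_ht h e
    have h4 := matched_ht h' e
    have h5 := hle e
    omega
  · obtain ⟨s, hs, hs'⟩ := mn_att C K t
    obtain ⟨s2, hs2, hs2'⟩ := mn_att C K' t
    have h1 := mn_le (C := C) (D := K') hs
    have h2 := mn_le (C := C) (D := K) hs2
    have h3 := heq s (by omega)
    have h4 := heq s2 (by omega)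
    have h5 := matched_ht h s
    have h6 := matched_ht h s2
    have h7 := matched_ht h' s
    have h8 := matched_ht h' s2
    omega

/-- An opener that stays unmatched can be added freely. -/
theorem mat_opener_insert {C F : Finset ℕ} {e : ℕ} (h : Matched C F) (he : e ∉ C)
    (hF : ∀ t, e < t → lc F (t + 1) + lc C e ≤ lc C t + lc F (e + 1)) :
    mat (insert e C) F = mat C F := by
  have h' : Matched (insert e C) F := matched_superset h (Finset.subset_insert _ _)
  have hht : ∀ s, ht (insert e C) F s = ht C F s + if e < s then 1 else 0 := by
    intro s
    have h1 := matched_ht h s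
    have h2 := matched_ht h' s
    rw [lc_insert he] at h2
    omega
  have hge : ∀ s, e ≤ s → ht C F e ≤ ht C F s := by
    intro s hs
    rcases Nat.lt_or_ge e s with h1 | h1
    · have h2 := matched_ht h e
      have h3 := matched_ht h s
      have := hF s h1
      omega
    · rw [show s = e by omega]
  apply mat_eq h'
  intro t
  rw [lc_insert he]
  have e1 := lc_mat h t
  suffices mn (insert e C) F t = mn C F t + if e < t then 1 else 0 by omega
  obtain ⟨s, hs, hs'⟩ := mn_att (insert e C) F t
  obtain ⟨s2, hs2, hs2'⟩ := mn_att C F t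
  have b1 := mn_le (C := insert e C) (D := F) hs2
  have b2 := mn_le (C := C) (D := F) hs
  rw [hht] at hs' b1
  split_ifs with het
  · rw [if_pos (by omega)] at hs' b1
    omega
  · apply le_antisymm
    · by_cases hc : e < s2
      · have := hge s2 hc.le
        have := mn_le (C := insert e C) (D := F) (show t ≤ e by omega)
        rw [hht, if_neg (by omega)] at this
        omega
      · rw [if_neg hc] at b1
        omega
    · omega

/-- Removing the first failing opener does not change the iterated matching. -/
theorem mat_opener_erase {C C2 F : Finset ℕ} {e : ℕ} (he : e ∈ C)
    (hF : Matched (C.erase e) F) (h2 : Matched C2 (C.erase e))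
    (hnf : ∀ s, s < e → lc C (s + 1) ≤ lc C2 s) (hfail : lc C2 e ≤ lc C e) :
    Matched C2 (mat C F) ∧ mat C2 (mat (C.erase e) F) = mat C2 (mat C F) := by
  have hFC : Matched C F := matched_superset hF (Finset.erase_subset _ _)
  have hht : ∀ s, ht (C.erase e) F s + (if e < s then 1 else 0) = ht C F s := by
    intro s
    have h1 := matched_ht hF s
    have h2 := matched_ht hFC s
    rw [lc_erase he] at h2
    omega
  have f1 : ∀ t, e < t → lc (mat (C.erase e) F) t = lc (mat C F) t := by
    intro t hte
    have e1 := lc_mat hF t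
    have e2 := lc_mat hFC t
    rw [lc_erase he, if_pos hte] at e2
    suffices mn (C.erase e) F t + 1 = mn C F t by omega
    obtain ⟨s, hs, hs'⟩ := mn_att (C.erase e) F t
    obtain ⟨s2, hs2, hs2'⟩ := mn_att C F t
    have b1 := mn_le (C := C.erase e) (D := F) hs2
    have b2 := mn_le (C := C) (D := F) hs
    have b3 := hht s
    have b4 := hht s2
    rw [if_pos (by omega)] at b3 b4
    omega
  have f2 : ∀ t, t ≤ e → lc (mat C F) t ≤ lc (mat (C.erase e) F) t := by
    intro t hte
    have e1 := lc_mat hF t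
    have e2 := lc_mat hFC t
    rw [lc_erase he, if_neg (by omega)] at e2
    obtain ⟨s2, hs2, hs2'⟩ := mn_att C F t
    have b1 := mn_le (C := C.erase e) (D := F) hs2
    have b4 := hht s2
    omega
  have f3 : ∀ t, t ≤ e → lc (mat C F) t < lc (mat (C.erase e) F) t →
      mn (C.erase e) F e ≤ mn (C.erase e) F t := by
    intro t hte hlt
    have e1 := lc_mat hF t
    have e2 := lc_mat hFC t
    rw [lc_erase he, if_neg (by omega)] at e2
    obtain ⟨s, hs, hs'⟩ := mn_att (C.erase e) F t
    have b2 := mn_le (C := C) (D := F) hs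
    have b3 := hht s
    by_cases hse : e < s
    · rw [hs']
      exact mn_le hse.le
    · rw [if_neg hse] at b3
      omega
  have hm' : Matched C2 (mat (C.erase e) F) := matched_subset h2 (mat_subset _ _)
  have hle : ∀ t, lc (mat C F) t ≤ lc (mat (C.erase e) F) t := by
    intro t
    by_cases hte : t ≤ e
    · exact f2 t hte
    · exact (f1 t (by omega)).ge
  have hm : Matched C2 (mat C F) := fun t => (hle _).trans (hm' t)
  refine ⟨hm, mat_congr hm' hm ?_⟩
  intro t
  apply le_antisymm
  · obtain ⟨s, hs, hs'⟩ := mn_att C2 (mat C F) t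
    have b1 := mn_le (C := C2) (D := mat (C.erase e) F) hs
    have b2 := matched_ht hm s
    have b3 := matched_ht hm' s
    have := hle (s + 1)
    omega
  · obtain ⟨s, hs, hs'⟩ := mn_att C2 (mat (C.erase e) F) t
    have b1 := mn_le (C := C2) (D := mat C F) hs
    have b2 := matched_ht hm s
    have b3 := matched_ht hm' s
    rcases (hle (s + 1)).lt_or_eq with hlt | heq
    · have hse : s < e := by
        by_contra hc
        have := f1 (s + 1) (by omega)
        omega
      have c1 := f3 (s + 1) (by omega) hlt
      have c2 := lc_mat hF (s + 1)
      have c3 := lc_mat hF e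
      have c4 := hnf s hse
      have c5 := lc_erase he (s + 1)
      have c6 := lc_erase he e
      rw [if_neg (by omega)] at c5 c6
      have c7 := matched_ht hm e
      have c8 := mn_le (C := C2) (D := mat C F) (show t ≤ e by omega)
      have c9 := f1 (e + 1) (by omega)
      have c10 := lc_mono (mat (C.erase e) F) (show e ≤ e + 1 by omega)
      omega
    · omega


/-! ### Row insertion and uniqueness of tableaux -/

/-- Row insertion of `x` into `R`, giving the row `R'` and the bumped letters. -/
inductive Bump (R : Finset ℕ) (x : ℕ) (R' : Finset ℕ) : List ℕ → Prop
  | top (h : ∀ q ∈ R, q < x) (h' : ∀ t, t ∈ R' ↔ t ∈ R ∨ t = x) : Bump R x R' []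
  | bump (p : ℕ) (hp : p ∈ R) (hx : x < p) (hm : ∀ q ∈ R, x < q → p ≤ q) (hn : x ∉ R)
      (h' : ∀ t, t ∈ R' ↔ t = x ∨ (t ∈ R ∧ t ≠ p)) : Bump R x R' [p]
  | pass (hx : x ∈ R) (hp : x + 1 ∈ R) (h' : ∀ t, t ∈ R' ↔ t ∈ R) : Bump R x R' [x + 1]

theorem bump_det {R : Finset ℕ} {x : ℕ} {R1 R2 : Finset ℕ} {o1 o2 : List ℕ}
    (h1 : Bump R x R1 o1) (h2 : Bump R x R2 o2) : R1 = R2 ∧ o1 = o2 := by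
  cases h1 <;> cases h2
  case bump.bump p hp hx hm hn h' p2 hp2 hx2 hm2 hn2 h2' =>
    have e : p = p2 := le_antisymm (hm _ hp2 hx2) (hm2 _ hp hx)
    subst e
    refine ⟨?_, rfl⟩
    ext t
    rw [h', h2']
  all_goals first
    | (refine ⟨?_, rfl⟩; ext t; grind)
    | grind

theorem bump_exists {R : Finset ℕ} {x : ℕ} (h : x ∈ R → x + 1 ∈ R) :
    ∃ R' o, Bump R x R' o := by
  by_cases hx : x ∈ R
  · exact ⟨R, _, .pass hx (h hx) fun _ => Iff.rfl⟩
  · by_cases he : ∃ p, p ∈ R ∧ x < p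
    · have h1 := Nat.find_spec he
      refine ⟨insert x (R.erase (Nat.find he)), _, .bump (Nat.find he) h1.1 h1.2
        (fun q hq hxq => Nat.find_min' he ⟨hq, hxq⟩) hx ?_⟩
      intro t
      simp only [Finset.mem_insert, Finset.mem_erase]
      tauto
    · push Not at he
      refine ⟨insert x R, _, .top (fun q hq => lt_of_le_of_ne (he q hq) ?_) ?_⟩
      · rintro rfl; exact hx hq
      · intro t
        simp only [Finset.mem_insert]
        tauto

theorem bump_ck {R : Finset ℕ} {x : ℕ} {R' : Finset ℕ} {o : List ℕ} (h : Bump R x R' o) :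
    CKEquiv (inc R ++ [x]) (o ++ inc R') := by
  cases h with
  | top h h' =>
    have : R' = insert x R := by ext t; rw [h']; simp; tauto
    rw [this, inc_insert_max h]
    exact ck_refl _
  | bump p hp hx hm hn h' =>
    have : R' = insert x (R.erase p) := by ext t; rw [h']; simp; tauto
    have h := row_insert hp hx hm (fun h => absurd h hn)
    rw [if_neg hn, ← this] at h
    exact h
  | pass hx hp h' =>
    have : R' = R := by ext t; rw [h']
    have h := row_insert hp (Nat.lt_succ_self x) (fun q _ hq => hq) (fun _ => rfl)
    rw [if_pos hx, ← this] at h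
    rw [this] at h ⊢
    exact h

/-- Row insertion of a word. -/
inductive Tr : Finset ℕ → List ℕ → Finset ℕ → List ℕ → Prop
  | nil (R) : Tr R [] R []
  | cons {R x R1 o w R2 o2} (h : Bump R x R1 o) (h2 : Tr R1 w R2 o2) : Tr R (x :: w) R2 (o ++ o2)

theorem tr_det {R : Finset ℕ} {w : List ℕ} {R1 R2 : Finset ℕ} {o1 o2 : List ℕ}
    (h1 : Tr R w R1 o1) (h2 : Tr R w R2 o2) : R1 = R2 ∧ o1 = o2 := by
  induction h1 generalizing R2 o2 with
  | nil => cases h2; exact ⟨rfl, rfl⟩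
  | cons h _ ih =>
    cases h2 with
    | cons h' h2' =>
      obtain ⟨rfl, rfl⟩ := bump_det h h'
      obtain ⟨rfl, rfl⟩ := ih h2'
      exact ⟨rfl, rfl⟩

theorem tr_append {R : Finset ℕ} {u v : List ℕ} {R1 R2 : Finset ℕ} {o1 o2 : List ℕ}
    (h1 : Tr R u R1 o1) (h2 : Tr R1 v R2 o2) : Tr R (u ++ v) R2 (o1 ++ o2) := by
  induction h1 with
  | nil => exact h2
  | cons h _ ih => rw [List.append_assoc]; exact .cons h (ih h2)

theorem tr_split {R : Finset ℕ} {u v : List ℕ} {R2 : Finset ℕ} {o : List ℕ}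
    (h : Tr R (u ++ v) R2 o) : ∃ R1 o1 o2, Tr R u R1 o1 ∧ Tr R1 v R2 o2 ∧ o = o1 ++ o2 := by
  induction u generalizing R o with
  | nil => exact ⟨R, [], o, .nil R, h, rfl⟩
  | cons x u ih =>
    cases h with
    | cons h1 h2 =>
      obtain ⟨R1, o1, o2, h3, h4, rfl⟩ := ih h2
      exact ⟨R1, _, o2, .cons h1 h3, h4, by simp⟩

theorem tr_ck {R : Finset ℕ} {w : List ℕ} {R' : Finset ℕ} {o : List ℕ} (h : Tr R w R' o) :
    CKEquiv (inc R ++ w) (o ++ inc R') := by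
  induction h with
  | nil => simpa using ck_refl _
  | @cons R x R1 o w R2 o2 h _ ih =>
    have h1 := ck_right w (bump_ck h)
    have h2 := ck_left o ih
    simp only [List.append_assoc, List.singleton_append] at h1 h2 ⊢
    exact ck_trans h1 h2

theorem tr_one {R : Finset ℕ} {x : ℕ} {R1 : Finset ℕ} {o : List ℕ} (h : Bump R x R1 o) :
    Tr R [x] R1 o := by
  have := Tr.cons h (.nil R1)
  simpa using this

theorem tr_three {R : Finset ℕ} {x y z : ℕ} {R1 R2 R3 : Finset ℕ} {o1 o2 o3 : List ℕ}
    (h1 : Bump R x R1 o1) (h2 : Bump R1 y R2 o2) (h3 : Bump R2 z R3 o3) :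
    Tr R [x, y, z] R3 (o1 ++ (o2 ++ o3)) := .cons h1 (.cons h2 (tr_one h3))

theorem tr_nb_pass {R : Finset ℕ} {x : ℕ} {w : List ℕ} (h : NB (inc R ++ x :: w)) (hx : x ∈ R) :
    x + 1 ∈ R := by
  refine succ_mem_of_nb (c := []) (A := R) (b := x) ?_ (by simp) hx
  refine nb_left (b := w) ?_
  simpa using h

theorem tr_exists {R : Finset ℕ} {w : List ℕ} (h : NB (inc R ++ w)) : ∃ R' o, Tr R w R' o := by
  induction w generalizing R with
  | nil => exact ⟨R, [], .nil R⟩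
  | cons x w ih =>
    obtain ⟨R1, o1, h1⟩ := bump_exists (tr_nb_pass h)
    have h2 := ck_right w (bump_ck h1)
    have h3 : NB (o1 ++ (inc R1 ++ w)) := by
      refine nb_ck (ck_trans h2 (ck_of_eq (by simp))) (by simpa using h)
    obtain ⟨R2, o2, h4⟩ := ih (nb_right h3)
    exact ⟨R2, _, .cons h1 h4⟩

theorem bump_comm_right {R : Finset ℕ} {x y z : ℕ} {R2 R3 : Finset ℕ} {o2 o3 : List ℕ} (hx : x ∈ R)
    (hyx : y < x) (hxz : x < z) (h2 : Bump R y R2 o2) (h3 : Bump R2 z R3 o3) :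
    ∃ R', Bump R z R' o3 ∧ Bump R' y R3 o2 := by
  have hR := h3
  cases h2 with
  | top h h' => have := h x hx; omega
  | bump q hq hyq hm hn h' =>
    have hqx := hm x hx hyx
    cases h3 with
    | top g g' => exact ⟨insert z R, .top (by grind) (by grind), .bump q (by grind) hyq (by grind) (by grind) (by grind)⟩
    | bump r hr hzr hmr hnr g' =>
      exact ⟨insert z (R.erase r), .bump r (by grind) hzr (by grind) (by grind) (by grind),
        .bump q (by grind) hyq (by grind) (by grind) (by grind)⟩
    | pass g1 g2 g' =>
      exact ⟨R, .pass (by grind) (by grind) (by grind),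
        .bump q (by grind) hyq (by grind) (by grind) (by grind)⟩
  | pass hq hq' h' =>
    cases h3 with
    | top g g' => exact ⟨insert z R, .top (by grind) (by grind), .pass (by grind) (by grind) (by grind)⟩
    | bump r hr hzr hmr hnr g' =>
      exact ⟨insert z (R.erase r), .bump r (by grind) hzr (by grind) (by grind) (by grind),
        .pass (by grind) (by grind) (by grind)⟩
    | pass g1 g2 g' =>
      exact ⟨R, .pass (by grind) (by grind) (by grind), .pass (by grind) (by grind) (by grind)⟩

theorem bump_comm_left {R : Finset ℕ} {x y q0 : ℕ} {R1 R2 : Finset ℕ} {o1 o2 : List ℕ}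
    (hq0 : q0 ∈ R) (hy : y < q0) (hx : q0 < x) (h1 : Bump R x R1 o1) (h2 : Bump R1 y R2 o2) :
    ∃ R', Bump R y R' o2 ∧ Bump R' x R2 o1 := by
  cases h1 with
  | top h h' =>
    cases h2 with
    | top g g' => have := g q0 (by grind); omega
    | bump q hq hyq hm hn g' =>
      have := hm q0 (by grind) hy
      exact ⟨insert y (R.erase q), .bump q (by grind) hyq (by grind) (by grind) (by grind),
        .top (by grind) (by grind)⟩
    | pass hq hq' g' => exact ⟨R, .pass (by grind) (by grind) (by grind), .top (by grind) (by grind)⟩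
  | bump p hp hxp hmp hnp h' =>
    cases h2 with
    | top g g' => have := g q0 (by grind); omega
    | bump q hq hyq hm hn g' =>
      have := hm q0 (by grind) hy
      exact ⟨insert y (R.erase q), .bump q (by grind) hyq (by grind) (by grind) (by grind),
        .bump p (by grind) hxp (by grind) (by grind) (by grind)⟩
    | pass hq hq' g' =>
      exact ⟨R, .pass (by grind) (by grind) (by grind),
        .bump p (by grind) hxp (by grind) (by grind) (by grind)⟩
  | pass hp hp' h' =>
    cases h2 with
    | top g g' => have := g q0 (by grind); omega
    | bump q hq hyq hm hn g' =>
      have := hm q0 (by grind) hy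
      exact ⟨insert y (R.erase q), .bump q (by grind) hyq (by grind) (by grind) (by grind),
        .pass (by grind) (by grind) (by grind)⟩
    | pass hq hq' g' =>
      exact ⟨R, .pass (by grind) (by grind) (by grind), .pass (by grind) (by grind) (by grind)⟩

theorem bump_inner {R : Finset ℕ} {x y : ℕ} {R1 : Finset ℕ} {o : List ℕ} (hx : x ∈ R)
    (hyx : y < x) (h : Bump R y R1 o) : ∃ q, o = [q] ∧ y < q ∧ q ≤ x := by
  cases h with
  | top h h' => have := h x hx; omega
  | bump q hq hyq hm hn h' => exact ⟨q, rfl, hyq, hm x hx hyx⟩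
  | pass hq hq' h' => exact ⟨y + 1, rfl, by omega, by omega⟩

theorem bump_self_mem {R : Finset ℕ} {x : ℕ} {R1 : Finset ℕ} {o : List ℕ} (h : Bump R x R1 o) :
    x ∈ R1 := by
  cases h <;> grind

theorem tr_triple_one {R : Finset ℕ} {x y z : ℕ} {R3 : Finset ℕ} {o : List ℕ} (hyx : y < x)
    (hxz : x < z) (h : Tr R [x, y, z] R3 o) : ∃ o', Tr R [x, z, y] R3 o' ∧ CKEquiv o o' := by
  cases h with
  | @cons _ _ R1 o1 _ _ o2 h1 h =>
  cases h with
  | @cons _ _ R2 o2 _ _ o3 h2 h =>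
  cases h with
  | @cons _ _ R3 o3 _ _ o4 h3 h =>
  cases h with
  | nil =>
  have hx := bump_self_mem h1
  obtain ⟨R', g1, g2⟩ := bump_comm_right hx hyx hxz h2 h3
  refine ⟨_, tr_three h1 g1 g2, ?_⟩
  obtain ⟨q, rfl, hyq, hqx⟩ := bump_inner hx hyx h2
  cases g1 with
  | top => simpa using ck_refl _
  | bump r hr hzr hmr hnr g' =>
    cases h1 with
    | top => grind
    | bump p hp hxp hmp hnp h' => exact ck_one (by grind) (by grind)
    | pass => exact ck_one (by grind) (by grind)
  | pass hz hz' g' =>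
    cases h1 with
    | top => grind
    | bump p hp hxp hmp hnp h' => exact ck_one (by grind) (by grind)
    | pass => exact ck_one (by grind) (by grind)

theorem tr_triple_two {R : Finset ℕ} {x y z : ℕ} {R3 : Finset ℕ} {o : List ℕ} (hyz : y < z)
    (hzx : z < x) (h : Tr R [x, y, z] R3 o) (hp : x ∈ R → x + 1 ∈ R) :
    ∃ o', Tr R [y, x, z] R3 o' ∧ CKEquiv o o' := by
  cases h with
  | @cons _ _ R1 o1 _ _ o2 h1 h =>
  cases h with
  | @cons _ _ R2 o2 _ _ o3 h2 h =>
  cases h with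
  | @cons _ _ R3 o3 _ _ o4 h3 h =>
  cases h with
  | nil =>
  have hx := bump_self_mem h1
  by_cases hq : ∃ q0 ∈ R, y < q0 ∧ q0 < x
  · obtain ⟨q0, hq0, hyq, hqx⟩ := hq
    obtain ⟨R', g1, g2⟩ := bump_comm_left hq0 hyq hqx h1 h2
    refine ⟨_, tr_three g1 g2 h3, ?_⟩
    obtain ⟨q, rfl, hyq, hqx⟩ := bump_inner hq0 hyq g1
    have hx2 : x ∈ R2 := by cases h2 <;> grind
    obtain ⟨s, rfl, hzs, hsx⟩ := bump_inner hx2 hzx h3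
    have hqs : q < s := by cases h2 <;> cases h3 <;> grind
    cases h1 with
    | top => simpa using ck_refl _
    | bump p hp hxp hmp hnp h' => exact ck_two (by grind) (by grind)
    | pass => exact ck_two (by grind) (by grind)
  · push Not at hq
    have hyR : y ∉ R := by
      intro hy
      cases h1 <;> cases h2 <;> grind
    by_cases hxR : x ∈ R
    · have hx1 := hp hxR
      have e1 : R1 = R ∧ o1 = [x + 1] := by cases h1 <;> grind
      obtain ⟨rfl, rfl⟩ := e1
      have e2 : o2 = [x] ∧ ∀ t, t ∈ R2 ↔ t = y ∨ (t ∈ R1 ∧ t ≠ x) := by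
        cases h2 <;> grind
      obtain ⟨rfl, e2⟩ := e2
      have e3 : o3 = [x + 1] ∧ ∀ t, t ∈ R3 ↔ t = z ∨ (t ∈ R2 ∧ t ≠ x + 1) := by
        cases h3 <;> grind
      obtain ⟨rfl, e3⟩ := e3
      refine ⟨_, tr_three (R1 := R2) (R2 := insert x (R2.erase (x + 1)))
        (.bump x hxR (by omega) (by grind) hyR (by grind))
        (.bump (x + 1) (by grind) (by omega) (by grind) (by grind) (by grind))
        (.bump x (by grind) (by omega) (by grind) (by grind) (by grind)), ?_⟩
      exact ck_symm (ck_three x)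
    · have hzR2 : o3 = [] ∨ o3 ≠ [] := by tauto
      cases h1 with
      | top h h' =>
        have e2 : o2 = [x] ∧ ∀ t, t ∈ R2 ↔ t = y ∨ (t ∈ R1 ∧ t ≠ x) := by
          cases h2 <;> grind
        obtain ⟨rfl, e2⟩ := e2
        have e3 : o3 = [] ∧ ∀ t, t ∈ R3 ↔ t = z ∨ t ∈ R2 := by
          cases h3 <;> grind
        obtain ⟨rfl, e3⟩ := e3
        refine ⟨_, tr_three (R1 := R2) (R2 := insert x R2) (.top (by grind) (by grind))
          (.top (by grind) (by grind)) (.bump x (by grind) (by omega) (by grind) (by grind)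
          (by grind)), ?_⟩
        simpa using ck_refl _
      | bump p hp hxp hmp hnp h' =>
        have e2 : o2 = [x] ∧ ∀ t, t ∈ R2 ↔ t = y ∨ (t ∈ R1 ∧ t ≠ x) := by
          cases h2 <;> grind
        obtain ⟨rfl, e2⟩ := e2
        have g1 : Bump R y R2 [p] := .bump p hp (by omega) (by grind) hyR (by grind)
        cases h3 with
        | top g g' =>
          refine ⟨_, tr_three g1 (.top (R' := insert x R2) (by grind) (by grind))
            (.bump x (by grind) (by omega) (by grind) (by grind) (by grind)), ?_⟩
          simpa using ck_refl _
        | bump r hr hzr hmr hnr g' =>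
          refine ⟨_, tr_three g1 (.bump (R' := insert x (R2.erase r)) r hr (by grind) (by grind)
            (by grind) (by grind))
            (.bump x (by grind) (by omega) (by grind) (by grind) (by grind)), ?_⟩
          exact ck_one (by grind) (by grind)
        | pass hz hz' g' => grind
      | pass => grind

theorem tr_triple_three {R : Finset ℕ} {i : ℕ} {R3 : Finset ℕ} {o : List ℕ}
    (h : Tr R [i, i + 1, i] R3 o) (hp : i + 1 ∈ R → i + 2 ∈ R) :
    ∃ o', Tr R [i + 1, i, i + 1] R3 o' ∧ CKEquiv o o' := by
  cases h with
  | @cons _ _ R1 o1 _ _ o2 h1 h =>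
  cases h with
  | @cons _ _ R2 o2 _ _ o3 h2 h =>
  cases h with
  | @cons _ _ R3 o3 _ _ o4 h3 h =>
  cases h with
  | nil =>
  by_cases hi1 : i + 1 ∈ R
  · have hi2 := hp hi1
    by_cases hi : i ∈ R
    · have e1 : R1 = R ∧ o1 = [i + 1] := by cases h1 <;> grind
      obtain ⟨rfl, rfl⟩ := e1
      have e2 : R2 = R1 ∧ o2 = [i + 2] := by cases h2 <;> grind
      obtain ⟨rfl, rfl⟩ := e2
      have e3 : R3 = R2 ∧ o3 = [i + 1] := by cases h3 <;> grind
      obtain ⟨rfl, rfl⟩ := e3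
      exact ⟨_, tr_three h2 h1 h2, ck_three (i + 1)⟩
    · have e1 : o1 = [i + 1] ∧ ∀ t, t ∈ R1 ↔ t = i ∨ (t ∈ R ∧ t ≠ i + 1) := by
        cases h1 <;> grind
      obtain ⟨rfl, e1⟩ := e1
      have e2 : o2 = [i + 2] ∧ ∀ t, t ∈ R2 ↔ t = i + 1 ∨ (t ∈ R1 ∧ t ≠ i + 2) := by
        cases h2 <;> grind
      obtain ⟨rfl, e2⟩ := e2
      have e3 : R3 = R2 ∧ o3 = [i + 1] := by cases h3 <;> grind
      obtain ⟨rfl, rfl⟩ := e3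
      refine ⟨_, tr_three (R1 := R) (R2 := R1) (.pass hi1 hi2 (by grind)) h1
        (.bump (i + 2) (by grind) (by omega) (by grind) (by grind) e2), ?_⟩
      exact ck_three (i + 1)
  · have hi : i ∉ R := by intro hi; cases h1 <;> grind
    cases h1 with
    | top h h' =>
      have e2 : o2 = [] ∧ ∀ t, t ∈ R2 ↔ t ∈ R1 ∨ t = i + 1 := by cases h2 <;> grind
      obtain ⟨rfl, e2⟩ := e2
      have e3 : R3 = R2 ∧ o3 = [i + 1] := by cases h3 <;> grind
      obtain ⟨rfl, rfl⟩ := e3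
      refine ⟨_, tr_three (R1 := insert (i + 1) R) (R2 := R1) (.top (by grind) (by grind))
        (.bump (i + 1) (by grind) (by omega) (by grind) (by grind) (by grind))
        (.top (by grind) (by grind)), ?_⟩
      simpa using ck_refl _
    | bump p hp hxp hmp hnp h' =>
      have e3 : R3 = R2 ∧ o3 = [i + 1] := by cases h2 <;> cases h3 <;> grind
      obtain ⟨rfl, rfl⟩ := e3
      have g1 : Bump R (i + 1) (insert (i + 1) (R.erase p)) [p] :=
        .bump p hp (by grind) (by grind) hi1 (by grind)
      have g2 : Bump (insert (i + 1) (R.erase p)) i R1 [i + 1] :=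
        .bump (i + 1) (by grind) (by omega) (by grind) (by grind) (by grind)
      refine ⟨_, tr_three g1 g2 h2, ?_⟩
      cases h2 with
      | top => simpa using ck_refl _
      | bump r hr hzr hmr hnr g' => exact ck_symm (ck_one (by grind) (by grind))
      | pass => grind
    | pass => grind

theorem tr_step {R : Finset ℕ} {u v : List ℕ} {R' : Finset ℕ} {o : List ℕ} (hnb : NB (inc R ++ u))
    (hs : CKStep u v) (h : Tr R u R' o) : ∃ o', Tr R v R' o' ∧ CKEquiv o o' := by
  have hck : CKEquiv u v := Relation.EqvGen.rel _ _ hs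
  have main : ∀ a b m m', CKEquiv (a ++ m ++ b) (a ++ m' ++ b) → u = a ++ m ++ b → v = a ++ m' ++ b →
      (∀ S S' om, NB (inc S ++ m) → NB (inc S ++ m') → Tr S m S' om →
        ∃ o', Tr S m' S' o' ∧ CKEquiv om o') →
      ∃ o', Tr R v R' o' ∧ CKEquiv o o' := by
    rintro a b m m' hck rfl rfl H
    obtain ⟨R2, o2, o3, h1, h3, rfl⟩ := tr_split h
    obtain ⟨R1, oa, om, h0, h2, rfl⟩ := tr_split h1
    have nb1 : NB (inc R1 ++ m) := by
      have := ck_right (m ++ b) (tr_ck h0)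
      refine nb_factor (a := oa) (b := b) (nb_ck (ck_trans (ck_trans (ck_of_eq ?_) this)
        (ck_of_eq ?_)) hnb) <;> simp
    have nb2 : NB (inc R1 ++ m') := by
      have h4 := ck_right (m' ++ b) (tr_ck h0)
      have h5 := ck_left (inc R) hck
      refine nb_factor (a := oa) (b := b) (nb_ck (ck_trans h5 (ck_trans (ck_trans (ck_of_eq ?_) h4)
        (ck_of_eq ?_))) hnb) <;> simp
    obtain ⟨o', h4, h5⟩ := H R1 R2 om nb1 nb2 h2
    exact ⟨_, tr_append (tr_append h0 h4) h3, ck_ctx oa o3 h5⟩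
  rcases hs with ⟨a, b, x, y, z, h1, h2, hu, hv⟩ | ⟨a, b, x, y, z, h1, h2, hu, hv⟩ |
    ⟨a, b, i, hu, hv⟩
  · exact main a b _ _ (hu ▸ hv ▸ hck) hu hv fun S S' om _ _ h => tr_triple_one h1 h2 h
  · exact main a b _ _ (hu ▸ hv ▸ hck) hu hv fun S S' om n1 _ h =>
      tr_triple_two h1 h2 h (tr_nb_pass n1)
  · exact main a b _ _ (hu ▸ hv ▸ hck) hu hv fun S S' om _ n2 h =>
      tr_triple_three h (tr_nb_pass n2)

theorem tr_equiv {R : Finset ℕ} {u v : List ℕ} (h : CKEquiv u v) :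
    ∀ {R1 R2 : Finset ℕ} {o1 o2 : List ℕ}, NB (inc R ++ u) → Tr R u R1 o1 → Tr R v R2 o2 →
    R1 = R2 ∧ CKEquiv o1 o2 := by
  induction h with
  | rel u v hs =>
    intro R1 R2 o1 o2 hnb h1 h2
    obtain ⟨o', h3, h4⟩ := tr_step hnb hs h1
    obtain ⟨rfl, rfl⟩ := tr_det h2 h3
    exact ⟨rfl, h4⟩
  | refl =>
    intro R1 R2 o1 o2 hnb h1 h2
    obtain ⟨rfl, rfl⟩ := tr_det h1 h2
    exact ⟨rfl, ck_refl _⟩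
  | symm u v h ih =>
    intro R1 R2 o1 o2 hnb h1 h2
    obtain ⟨rfl, h⟩ := ih (nb_ck (ck_left _ (ck_symm h)) hnb) h2 h1
    exact ⟨rfl, ck_symm h⟩
  | trans u v w h1 h2 ih1 ih2 =>
    intro R1 R2 o1 o2 hnb h3 h4
    have hn := nb_ck (ck_left _ h1) hnb
    obtain ⟨S, o, h5⟩ := tr_exists hn
    obtain ⟨rfl, h6⟩ := ih1 hnb h3 h5
    obtain ⟨rfl, h7⟩ := ih2 hn h5 h4
    exact ⟨rfl, ck_trans h6 h7⟩

theorem lc_eq_zero {S : Finset ℕ} {t : ℕ} (h : ∀ x ∈ S, t ≤ x) : lc S t = 0 := by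
  unfold lc
  rw [Finset.card_eq_zero, Finset.filter_eq_empty_iff]
  intro x hx
  have := h x hx
  omega

theorem tr_inc {C : Finset ℕ} : ∀ {P K : Finset ℕ}, (∀ x ∈ P, ∀ y ∈ C, x < y) → Matched C K →
    Tr (P ∪ K) (inc C) (P ∪ C) (inc K) := by
  induction C using Finset.induction_on_min with
  | empty =>
    intro P K _ h
    have : K = ∅ := by
      apply eq_of_lc
      intro t
      have h1 := h t
      have h2 : lc K t ≤ lc K (t + 1) := lc_mono K (Nat.le_succ t)
      have h3 : lc ∅ t = 0 := lc_eq_zero (by simp)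
      omega
    subst this
    simpa using Tr.nil P
  | insert c C hc ih =>
    intro P K hP h
    have hcC : c ∉ C := fun hh => lt_irrefl _ (hc c hh)
    rw [inc_insert_min hc]
    have key : ∀ k ∈ K, c < k := by
      intro k hk
      by_contra hkc
      have h1 := h k
      have h2 := lc_succ K k
      rw [if_pos hk, lc_insert hcC, if_neg hkc, lc_eq_zero (S := C)] at *
      · omega
      · intro x hx
        have := hc x hx
        omega
    have e : P ∪ insert c C = insert c P ∪ C := by ext; simp
    have hP' : ∀ x ∈ insert c P, ∀ y ∈ C, x < y := by
      intro x hx y hy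
      rcases Finset.mem_insert.1 hx with rfl | hx
      · exact hc y hy
      · exact hP x hx y (Finset.mem_insert_of_mem hy)
    rw [e]
    rcases K.eq_empty_or_nonempty with rfl | hK
    · have h1 : Matched C ∅ := by intro t; simp [lc]
      have := Tr.cons (R := P ∪ ∅) (R1 := insert c P ∪ ∅)
        (.top (x := c) (by intro q hq; exact hP q (by simpa using hq) c (by simp)) (by simp; tauto))
        (ih hP' h1)
      simpa using this
    · obtain ⟨k, hk, hmin⟩ : ∃ k ∈ K, ∀ q ∈ K, k ≤ q := ⟨K.min' hK, K.min'_mem hK, fun q hq => K.min'_le q hq⟩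
      have hck := key k hk
      have h1 : Matched C (K.erase k) := by
        intro t
        have h1 := h t
        have h2 := lc_erase hk (t + 1)
        rw [lc_insert hcC] at h1
        by_cases hkt : k < t + 1
        · rw [if_pos hkt] at h2
          split_ifs at h1 <;> omega
        · have := lc_eq_zero (S := K) (t := t + 1) (fun x hx => by have := hmin x hx; omega)
          omega
      have e2 : inc K = [k] ++ inc (K.erase k) := by
        conv_lhs => rw [← Finset.insert_erase hk]
        rw [inc_insert_min]
        · rfl
        · intro x hx
          have := hmin x (Finset.mem_of_mem_erase hx)
          have := Finset.ne_of_mem_erase hx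
          omega
      rw [e2]
      refine Tr.cons (.bump k (by simp [hk]) hck ?_ ?_ ?_) (ih hP' h1)
      · intro q hq hcq
        rcases Finset.mem_union.1 hq with hq | hq
        · have := hP q hq c (by simp)
          omega
        · exact hmin q hq
      · intro hq
        rcases Finset.mem_union.1 hq with hq | hq
        · have := hP c hq c (by simp)
          omega
        · have := key c hq
          omega
      · intro t
        simp only [Finset.mem_union, Finset.mem_insert, Finset.mem_erase]
        constructor
        · rintro ((rfl | h) | ⟨h, h'⟩)
          · tauto
          · right
            refine ⟨Or.inl h, ?_⟩
            have := hP t h c (by simp)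
            omega
          · tauto
        · tauto

/-- A tableau, given by its columns. -/
def IsTab (C : ℕ → Finset ℕ) : Prop := (∀ j, Matched (C j) (C (j + 1))) ∧ ∃ N, ∀ j, N ≤ j → C j = ∅

/-- The reading word of the first `n` columns, from the last to the first. -/
def colw : ℕ → (ℕ → Finset ℕ) → List ℕ
  | 0, _ => []
  | n + 1, C => colw n (fun j => C (j + 1)) ++ inc (C 0)

theorem tr_colw (n : ℕ) : ∀ C : ℕ → Finset ℕ, (∀ j, Matched (C j) (C (j + 1))) →
    (∀ j, n ≤ j → C j = ∅) → Tr ∅ (colw n C) (C 0) (colw (n - 1) (fun j => C (j + 1))) := by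
  induction n with
  | zero =>
    intro C hC hN
    rw [hN 0 le_rfl]
    exact .nil _
  | succ n ih =>
    intro C hC hN
    have h1 := ih (fun j => C (j + 1)) (fun j => hC (j + 1)) (fun j hj => hN _ (by omega))
    have h2 := tr_inc (P := ∅) (by simp) (hC 0)
    rw [Finset.empty_union, Finset.empty_union] at h2
    have h3 := tr_append h1 h2
    have e : colw (n + 1 - 1) (fun j => C (j + 1)) =
        colw (n - 1) (fun j => C (j + 1 + 1)) ++ inc (C (0 + 1)) := by
      cases n with
      | zero =>
        have : C 1 = ∅ := hN 1 le_rfl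
        simp [colw, this]
      | succ n => rfl
    exact e ▸ h3

theorem tab_unique (n : ℕ) : ∀ C D : ℕ → Finset ℕ, (∀ j, Matched (C j) (C (j + 1))) →
    (∀ j, Matched (D j) (D (j + 1))) → (∀ j, n ≤ j → C j = ∅) → (∀ j, n ≤ j → D j = ∅) →
    NB (colw n C) → CKEquiv (colw n C) (colw n D) → C = D := by
  induction n with
  | zero =>
    intro C D _ _ hC hD _ _
    funext j
    rw [hC j (by omega), hD j (by omega)]
  | succ n ih =>
    intro C D mC mD hC hD hnb h
    obtain ⟨h0, h1⟩ := tr_equiv h (by simpa using hnb) (tr_colw _ C mC hC) (tr_colw _ D mD hD)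
    have h2 := ih _ _ (fun j => mC (j + 1)) (fun j => mD (j + 1)) (fun j hj => hC _ (by omega))
      (fun j hj => hD _ (by omega)) (nb_left hnb) h1
    funext j
    cases j with
    | zero => exact h0
    | succ j => exact congrFun h2 j


/-! ### Column insertion -/

theorem wordPerm_reverse (u : List ℕ) : wordPerm u.reverse = (wordPerm u)⁻¹ := by
  induction u with
  | nil => simp [wordPerm_nil]
  | cons x u ih =>
    rw [List.reverse_cons, wordPerm_append, ih, wordPerm_cons, wordPerm_cons, wordPerm_nil, mul_one,
      mul_inv_rev]
    congr 1

theorem reduced_reverse {u : List ℕ} (h : IsReducedWord u) : IsReducedWord u.reverse := by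
  refine ⟨fun x hx => h.1 x (by simpa using hx), fun σ hσ he => ?_⟩
  have := h.2 σ.reverse (fun x hx => hσ x (by simpa using hx)) (by
    rw [wordPerm_reverse, he, wordPerm_reverse, inv_inv])
  simpa using this

/-- Inserting into the column `K` next to `C` first violates the matching condition at `e`;
the letter `h` is passed on to the column `C`. -/
structure Fail (C K : Finset ℕ) (e h : ℕ) : Prop where
  le : e ≤ h
  no : ∀ t, t < e → lc K (t + 1) ≤ lc C t
  eq : lc C e = lc K e
  run : ∀ y, e ≤ y → y ≤ h → y ∈ K
  nxt : h + 1 ∉ K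
  cov : ∀ y, e ≤ y → y < h → y ∈ C
  nh : h ∉ C

theorem lc_run {S : Finset ℕ} {p k : ℕ} (h : ∀ y, p ≤ y → y < p + k → y ∈ S) :
    lc S (p + k) = lc S p + k := by
  induction k with
  | zero => rfl
  | succ k ih =>
    rw [← Nat.add_assoc, lc_succ, ih (fun y h1 h2 => h y h1 (by omega)),
      if_pos (h _ (by omega) (by omega))]
    omega

theorem lc_run_le {S : Finset ℕ} {p q : ℕ} (hpq : p ≤ q) (h : ∀ y, p ≤ y → y < q → y ∈ S) :
    lc S q + p = lc S p + q := by
  obtain ⟨k, rfl⟩ := Nat.exists_eq_add_of_le hpq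
  rw [lc_run h]
  omega

/-- In a reduced word of two columns, `q` cannot end runs of `K` and of `C` of equal length. -/
theorem run_left {K C : Finset ℕ} {q s : ℕ} (hK : ∀ y, q ≤ y → y ≤ q + s → y ∈ K)
    (hK' : q + s + 1 ∉ K) (hC : ∀ y, q ≤ y → y ≤ q + s → y ∈ C) (hq : 1 ≤ q)
    (hred : IsReducedWord (inc K ++ inc C)) : q - 1 ∈ C := by
  by_contra hn
  have e1 : inc K = inc (K.filter (· < q)) ++ List.range' q (s + 1) ++ inc (K.filter (q + s < ·)) := by
    have := inc_Ico q (q + s + 1)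
    rw [show q + s + 1 - q = s + 1 by omega] at this
    rw [← this, ← inc_union, ← inc_union]
    · congr 1
      ext x
      simp only [Finset.mem_union, Finset.mem_filter, Finset.mem_Ico]
      have := hK x
      grind
    · intro x hx y hy
      simp only [Finset.mem_union, Finset.mem_filter, Finset.mem_Ico] at hx hy
      omega
    · intro x hx y hy
      simp only [Finset.mem_filter, Finset.mem_Ico] at hx hy
      omega
  have e2 : inc C = inc (C.filter (· < q)) ++ List.range' q (s + 1) ++ inc (C.filter (q + s < ·)) := by
    have := inc_Ico q (q + s + 1)
    rw [show q + s + 1 - q = s + 1 by omega] at this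
    rw [← this, ← inc_union, ← inc_union]
    · congr 1
      ext x
      simp only [Finset.mem_union, Finset.mem_filter, Finset.mem_Ico]
      have := hC x
      grind
    · intro x hx y hy
      simp only [Finset.mem_union, Finset.mem_filter, Finset.mem_Ico] at hx hy
      omega
    · intro x hx y hy
      simp only [Finset.mem_filter, Finset.mem_Ico] at hx hy
      omega
  rw [e1, e2] at hred
  refine not_reduced_runs (q := q) (s := s) (X := inc (K.filter (q + s < ·)))
    (Y := inc (C.filter (· < q))) ?_ ?_ (reduced_factor (a := inc (K.filter (· < q)))
    (b := inc (C.filter (q + s < ·))) (by simpa using hred))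
  · intro x hx
    simp only [mem_inc, Finset.mem_filter] at hx
    have : x ≠ q + s + 1 := fun h => hK' (h ▸ hx.1)
    omega
  · intro x hx
    simp only [mem_inc, Finset.mem_filter] at hx
    have : x ≠ q - 1 := fun h => hn (h ▸ hx.1)
    omega

/-- Dually on the right end. -/
theorem run_right {K C : Finset ℕ} {q s : ℕ} (hK : ∀ y, q ≤ y → y ≤ q + s → y ∈ K)
    (hC' : ∀ y, y + 1 = q → y ∉ C) (hC : ∀ y, q ≤ y → y ≤ q + s → y ∈ C)
    (hred : IsReducedWord (inc K ++ inc C)) : q + s + 1 ∈ K := by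
  by_contra hn
  rcases Nat.eq_zero_or_pos q with rfl | hq
  · have := hred.1 0 (by simp [mem_inc, hK 0 le_rfl (by omega)])
    omega
  · exact hC' (q - 1) (by omega) (run_left hK hn hC hq hred)

theorem fail_exists {C D : Finset ℕ} {x : ℕ} (hm : Matched C D) (hx : x ∉ D)
    (hn : ¬ Matched C (insert x D)) (hred : IsReducedWord (inc (insert x D) ++ inc C)) :
    ∃ e h, Fail C (insert x D) e h ∧ CKEquiv (inc (insert x D) ++ inc C)
      (inc ((insert x D).erase e) ++ inc (insert h C)) := by
  set K := insert x D with hKdef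
  unfold Matched at hn
  push Not at hn
  have h1 := Nat.find_spec hn
  have h2 : ∀ t, t < Nat.find hn → lc K (t + 1) ≤ lc C t := by
    intro t ht
    have := Nat.find_min hn ht
    omega
  set e := Nat.find hn
  have hKD : ∀ t, lc K t = lc D t + if x < t then 1 else 0 := fun t => lc_insert hx t
  have hme := hm e
  have h3 := hKD (e + 1)
  have hKe := lc_succ K e
  have heq : lc C e = lc K e ∧ e ∈ K := by
    rcases Nat.eq_zero_or_pos e with h0 | h0
    · rw [h0] at h1 hKe ⊢
      have z1 := lc_zero C
      have z2 := lc_zero K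
      split_ifs at hKe with hh
      · exact ⟨by omega, hh⟩
      · omega
    · have h4 := h2 (e - 1) (by omega)
      rw [Nat.sub_add_cancel h0] at h4
      have h5 := lc_mono C (show e - 1 ≤ e by omega)
      split_ifs at hKe with hh
      · refine ⟨?_, hh⟩
        split_ifs at h3 <;> omega
      · omega
  obtain ⟨heq, heK⟩ := heq
  have hex : ∃ s, e + s + 1 ∉ K := by
    by_contra hc
    push Not at hc
    have : ∀ n, n ≤ lc K (e + n) := by
      intro n
      have := lc_run (S := K) (p := e) (k := n) (fun y h5 h6 => by
        rcases Nat.eq_or_lt_of_le h5 with h7 | h7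
        · exact h7 ▸ heK
        · have := hc (y - e - 1)
          rwa [show e + (y - e - 1) + 1 = y by omega] at this)
      omega
    have h6 := this (K.card + 1)
    have h7 := lc_le_card K (e + (K.card + 1))
    omega
  have hs1 := Nat.find_spec hex
  have hs2 : ∀ s, s < Nat.find hex → e + s + 1 ∈ K := fun s hs => not_not.1 (Nat.find_min hex hs)
  set s := Nat.find hex
  have run : ∀ y, e ≤ y → y ≤ e + s → y ∈ K := by
    intro y h5 h6
    rcases Nat.eq_or_lt_of_le h5 with h7 | h7
    · exact h7 ▸ heK
    · have := hs2 (y - e - 1) (by omega)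
      rwa [show e + (y - e - 1) + 1 = y by omega] at this
  have hbelow : ∀ y, y + 1 = e → y ∉ C := by
    rintro y hy hyC
    have h4 := h2 y (by omega)
    have h5 := lc_succ C y
    rw [if_pos hyC, hy] at h5
    rw [hy] at h4
    omega
  have hnh : ∃ y, e ≤ y ∧ y ≤ e + s ∧ y ∉ C := by
    by_contra hc
    push Not at hc
    exact hs1 (run_right run hbelow hc hred)
  have hn1 := Nat.find_spec hnh
  have hn2 : ∀ y, e ≤ y → y < Nat.find hnh → y ∈ C := by
    intro y h5 h6
    by_contra h7
    exact Nat.find_min hnh h6 ⟨h5, by omega, h7⟩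
  set h := Nat.find hnh
  obtain ⟨hh1, hh2, hh3⟩ := hn1
  have hhs : h = e + s := by
    by_contra hne
    have hlt : h < e + s := by omega
    have h5 : h + 1 ∈ K := run _ (by omega) (by omega)
    have c1 := lc_run_le hh1 hn2
    have c2 := lc_run_le (S := K) (p := e) (q := h + 1 + 1) (by omega)
      (fun y h1 h2 => run y h1 (by omega))
    have c3 := hm (h + 1)
    have c4 := lc_succ C h
    rw [if_neg hh3] at c4
    have c5 := hKD (h + 1 + 1)
    split_ifs at c5 <;> omega
  have hF : Fail C K e h := ⟨hh1, h2, heq, fun y a b => run y a (by omega), by rw [hhs]; exact hs1,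
    hn2, hh3⟩
  refine ⟨e, h, hF, ?_⟩
  have hK : insert e (K.erase e) = K := Finset.insert_erase heK
  have he1 := fun t => lc_erase heK t
  have := block_exchange (K := K.erase e) (C := C) (p := e) (q := h) hh1 (by simp)
    (fun y a b => Finset.mem_erase.2 ⟨by omega, hF.run y (by omega) b⟩) hn2 hh3 ?_ ?_ ?_
  · rwa [hK] at this
  · intro t ht
    have a1 := h2 t ht
    have a2 := he1 (t + 1)
    have a3 := he1 e
    rw [if_neg (by omega)] at a2 a3
    omega
  · intro t ht
    have a1 := hm t
    have a2 := he1 (t + 1)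
    have a3 := he1 (h + 1)
    rw [if_pos (by omega)] at a2 a3
    have a4 := lc_succ C h
    rw [if_neg hh3] at a4
    have c1 := lc_run_le hh1 hn2
    have c2 := lc_run_le (S := K) (p := e) (q := h + 1) (by omega)
      (fun y h1 h2 => run y h1 (by omega))
    have a5 := hKD (t + 1)
    split_ifs at a5 <;> omega
  · rw [hK]
    exact nb_of_reduced hred

theorem fail_mem {C K : Finset ℕ} {e h : ℕ} (hF : Fail C K e h) : e ∈ K := hF.run e le_rfl hF.le

theorem fail_zero {C K : Finset ℕ} {e h : ℕ} (hF : Fail C K e h) :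
    lc C h = lc (K.erase e) (h + 1) := by
  have c1 := lc_run_le hF.le hF.cov
  have c2 := lc_run_le (S := K) (p := e) (q := h + 1) (by have := hF.le; omega)
      (fun y h1 h2 => hF.run y h1 (by omega))
  have c3 := lc_erase (fail_mem hF) (h + 1)
  rw [if_pos (by have := hF.le; omega)] at c3
  have := hF.eq
  omega

theorem fail_le {C D : Finset ℕ} {x e h : ℕ} (hm : Matched C D) (hx : x ∉ D)
    (hF : Fail C (insert x D) e h) : x ≤ e := by
  have h1 := hm e
  have h2 := lc_insert hx (e + 1)
  have h3 := lc_succ (insert x D) e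
  rw [if_pos (fail_mem hF), ← hF.eq] at h3
  split_ifs at h2 <;> omega

theorem fail_not_matched {C K : Finset ℕ} {e h : ℕ} (hF : Fail C K e h) : ¬ Matched C K := by
  intro hm
  have h1 := hm e
  have h3 := lc_succ K e
  rw [if_pos (fail_mem hF), ← hF.eq] at h3
  omega

theorem lc_insert_erase {D : Finset ℕ} {x e : ℕ} (hx : x ∉ D) (he : e ∈ insert x D) (t : ℕ) :
    lc ((insert x D).erase e) t + (if e < t then 1 else 0) = lc D t + if x < t then 1 else 0 := by
  rw [← lc_erase he, lc_insert hx]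

theorem fail_matched {C D : Finset ℕ} {x e h : ℕ} (hm : Matched C D) (hx : x ∉ D)
    (hF : Fail C (insert x D) e h) : Matched C ((insert x D).erase e) := by
  intro t
  have h1 := hm t
  have h2 := lc_insert_erase hx (fail_mem hF) (t + 1)
  have h3 := hF.no t
  have h4 := lc_insert hx (t + 1)
  have h5 := fail_le hm hx hF
  split_ifs at h2 h4 <;> omega

theorem matched_insert_erase {D F : Finset ℕ} {x e : ℕ} (hm : Matched D F) (hx : x ∉ D)
    (he : e ∈ insert x D) (hxe : x ≤ e) : Matched ((insert x D).erase e) F := by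
  intro t
  have h1 := hm t
  have h2 := lc_insert_erase hx he t
  split_ifs at h2 <;> omega

/-- Column insertion: `Ins C j x c C'` holds when inserting `x` into column `j` of `C`, and passing
letters on to smaller columns, leads to `C'`, with a new box in column `c`. -/
inductive Ins : (ℕ → Finset ℕ) → ℕ → ℕ → ℕ → (ℕ → Finset ℕ) → Prop
  | zero {C x} (hx : x ∉ C 0) : Ins C 0 x 0 (Function.update C 0 (insert x (C 0)))
  | land {C j x} (hx : x ∉ C (j + 1)) (h : Matched (C j) (insert x (C (j + 1)))) :
      Ins C (j + 1) x (j + 1) (Function.update C (j + 1) (insert x (C (j + 1))))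
  | step {C j x e h c C'} (hx : x ∉ C (j + 1)) (hF : Fail (C j) (insert x (C (j + 1))) e h)
      (h' : Ins (Function.update C (j + 1) ((insert x (C (j + 1))).erase e)) j h c C') :
      Ins C (j + 1) x c C'

/-- All adjacent columns are matched. -/
def AllM (C : ℕ → Finset ℕ) : Prop := ∀ j, Matched (C j) (C (j + 1))

theorem allM_update {C : ℕ → Finset ℕ} (hC : AllM C) {j : ℕ} {X : Finset ℕ}
    (h1 : ∀ i, i + 1 = j → Matched (C i) X) (h2 : Matched X (C (j + 1))) :
    AllM (Function.update C j X) := by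
  intro i
  by_cases hi : i = j
  · subst hi
    simpa using h2
  · by_cases hi' : i + 1 = j
    · subst hi'
      simpa [hi] using h1 i rfl
    · simpa [hi, hi'] using hC i

theorem allM_step {C : ℕ → Finset ℕ} (hC : AllM C) {j x e h : ℕ} (hx : x ∉ C (j + 1))
    (hF : Fail (C j) (insert x (C (j + 1))) e h) :
    AllM (Function.update C (j + 1) ((insert x (C (j + 1))).erase e)) := by
  refine allM_update hC ?_ (matched_insert_erase (hC _) hx (fail_mem hF) (fail_le (hC j) hx hF))
  intro i hi
  obtain rfl : i = j := by omega
  exact fail_matched (hC i) hx hF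

theorem ins_allM {C : ℕ → Finset ℕ} {j x c : ℕ} {C' : ℕ → Finset ℕ} (hi : Ins C j x c C')
    (hC : AllM C) : AllM C' := by
  induction hi with
  | zero hx => exact allM_update hC (by omega) (matched_superset (hC _) (Finset.subset_insert _ _))
  | land hx h =>
    refine allM_update hC ?_ (matched_superset (hC _) (Finset.subset_insert _ _))
    intro i hi
    obtain rfl := Nat.succ_injective hi
    exact h
  | step hx hF _ ih => exact ih (allM_step hC hx hF)

theorem ins_le {C : ℕ → Finset ℕ} {j x c : ℕ} {C' : ℕ → Finset ℕ} (hi : Ins C j x c C') : c ≤ j := by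
  induction hi with
  | zero => exact le_rfl
  | land => exact le_rfl
  | step _ _ _ ih => exact ih.trans (Nat.le_succ _)

theorem ins_above {C : ℕ → Finset ℕ} {j x c : ℕ} {C' : ℕ → Finset ℕ} (hi : Ins C j x c C') {J : ℕ}
    (hJ : j < J) : C' J = C J := by
  induction hi with
  | zero => rw [Function.update_of_ne (by omega)]
  | land => rw [Function.update_of_ne (by omega)]
  | step _ _ _ ih => rw [ih (by omega), Function.update_of_ne (by omega)]

theorem ins_below {C : ℕ → Finset ℕ} {j x c : ℕ} {C' : ℕ → Finset ℕ} (hi : Ins C j x c C') {J : ℕ}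
    (hJ : J < c) : C' J = C J := by
  induction hi with
  | zero => rw [Function.update_of_ne (by omega)]
  | land => rw [Function.update_of_ne (by omega)]
  | step _ _ h ih =>
    have := ins_le h
    rw [ih (by omega), Function.update_of_ne (by omega)]

theorem colw_update_two {n j : ℕ} (hj : j + 1 < n) (C : ℕ → Finset ℕ) :
    ∃ A B, ∀ X Y, colw n (Function.update (Function.update C (j + 1) X) j Y) =
      A ++ (inc X ++ inc Y) ++ B := by
  induction n generalizing C j with
  | zero => omega
  | succ n ih =>
    cases j with
    | zero =>
      cases n with
      | zero => omega
      | succ n =>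
        refine ⟨colw n (fun j => C (j + 1 + 1)), [], fun X Y => ?_⟩
        simp [colw]
    | succ j =>
      obtain ⟨A, B, h⟩ := ih (j := j) (by omega) (fun j => C (j + 1))
      refine ⟨A, B ++ inc (C 0), fun X Y => ?_⟩
      have : (fun i => Function.update (Function.update C (j + 1 + 1) X) (j + 1) Y (i + 1)) =
          Function.update (Function.update (fun j => C (j + 1)) (j + 1) X) j Y := by
        funext i
        by_cases hi : i = j
        · subst hi; simp
        · rw [Function.update_of_ne hi, Function.update_of_ne (by omega)]
          by_cases hi' : i = j + 1
          · subst hi'; simp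
          · rw [Function.update_of_ne hi', Function.update_of_ne (by omega)]
      simp [colw, this, h]

theorem ins_exists {n : ℕ} : ∀ (j : ℕ) (C : ℕ → Finset ℕ) (x : ℕ), AllM C → x ∉ C j → j < n →
    IsReducedWord (colw n (Function.update C j (insert x (C j)))) →
    ∃ c C', Ins C j x c C' ∧ CKEquiv (colw n (Function.update C j (insert x (C j)))) (colw n C') := by
  intro j
  induction j with
  | zero => intro C x _ hx _ _; exact ⟨0, _, .zero hx, ck_refl _⟩
  | succ j ih =>
    intro C x hC hx hj hred
    by_cases hm : Matched (C j) (insert x (C (j + 1)))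
    · exact ⟨_, _, .land hx hm, ck_refl _⟩
    · obtain ⟨A, B, hAB⟩ := colw_update_two hj C
      have e1 : colw n (Function.update C (j + 1) (insert x (C (j + 1)))) =
          A ++ (inc (insert x (C (j + 1))) ++ inc (C j)) ++ B := by
        rw [← hAB]
        congr 1
        rw [eq_comm, Function.update_eq_self_iff, Function.update_of_ne (by omega)]
      rw [e1] at hred
      obtain ⟨e, h, hF, hck⟩ := fail_exists (hC j) hx hm (reduced_factor hred)
      have h2 := ck_ctx A B hck
      set C2 := Function.update C (j + 1) ((insert x (C (j + 1))).erase e) with hC2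
      have hCj : C2 j = C j := Function.update_of_ne (by omega) _ _
      have e2 : colw n (Function.update C2 j (insert h (C2 j))) =
          A ++ (inc ((insert x (C (j + 1))).erase e) ++ inc (insert h (C j))) ++ B := by
        rw [← hAB, hCj]
      rw [← e2] at h2
      obtain ⟨c, C', hI, hck'⟩ := ih C2 h (allM_step hC hx hF) (hCj ▸ hF.nh) (by omega)
        (ck_reduced h2 hred)
      exact ⟨c, C', .step hx hF hI, e1 ▸ ck_trans h2 hck'⟩


theorem ins_zero_inv {C : ℕ → Finset ℕ} {x c : ℕ} {C' : ℕ → Finset ℕ} (h : Ins C 0 x c C') :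
    x ∉ C 0 ∧ c = 0 ∧ C' = Function.update C 0 (insert x (C 0)) := by
  cases h with
  | zero hx => exact ⟨hx, rfl, rfl⟩

theorem ins_succ_inv {C : ℕ → Finset ℕ} {j x c : ℕ} {C' : ℕ → Finset ℕ} (h : Ins C (j + 1) x c C') :
    x ∉ C (j + 1) ∧ ((Matched (C j) (insert x (C (j + 1))) ∧ c = j + 1 ∧
      C' = Function.update C (j + 1) (insert x (C (j + 1)))) ∨
      ∃ e h, Fail (C j) (insert x (C (j + 1))) e h ∧
        Ins (Function.update C (j + 1) ((insert x (C (j + 1))).erase e)) j h c C') := by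
  cases h with
  | land hx h => exact ⟨hx, .inl ⟨h, rfl, rfl⟩⟩
  | step hx hF h => exact ⟨hx, .inr ⟨_, _, hF, h⟩⟩

theorem ins_notMem {C : ℕ → Finset ℕ} {j x c : ℕ} {C' : ℕ → Finset ℕ} (h : Ins C j x c C') :
    x ∉ C j := by
  cases h <;> assumption

theorem fail_lt {C K : Finset ℕ} {e h : ℕ} (hF : Fail C K e h) : lc C e < lc K (e + 1) := by
  have h3 := lc_succ K e
  rw [if_pos (fail_mem hF), ← hF.eq] at h3
  omega

theorem fail_first {C K K' : Finset ℕ} {e h e' h' : ℕ} (hF : Fail C K e h) (hF' : Fail C K' e' h')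
    (he : e = e') : h = h' := by
  subst he
  by_contra hne
  rcases Nat.lt_or_gt_of_ne hne with h1 | h1
  · exact hF.nh (hF'.cov _ hF.le h1)
  · exact hF'.nh (hF.cov _ hF'.le h1)

theorem fail_unique {C K : Finset ℕ} {e h e' h' : ℕ} (hF : Fail C K e h) (hF' : Fail C K e' h') :
    e = e' ∧ h = h' := by
  have he : e = e' := by
    have h1 := fail_lt hF
    have h2 := fail_lt hF'
    by_contra hne
    rcases Nat.lt_or_gt_of_ne hne with h3 | h3
    · have := hF'.no _ h3; omega
    · have := hF.no _ h3; omega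
  exact ⟨he, fail_first hF hF' he⟩

theorem update_agree {C D : ℕ → Finset ℕ} {j : ℕ} (h : ∀ J, J ≤ j → C J = D J) (X Y : Finset ℕ)
    (J : ℕ) (hJ : J ≤ j) :
    Function.update C (j + 1) X J = Function.update D (j + 1) Y J := by
  rw [Function.update_of_ne (by omega), Function.update_of_ne (by omega), h J hJ]

/-- The new column and the changed columns only depend on the columns up to the starting one. -/
theorem ins_unique {j : ℕ} : ∀ {C D : ℕ → Finset ℕ} {x c d : ℕ} {C' D' : ℕ → Finset ℕ},
    Ins C j x c C' → Ins D j x d D' → (∀ J, J ≤ j → C J = D J) →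
      c = d ∧ ∀ J, J ≤ j → C' J = D' J := by
  induction j with
  | zero =>
    intro C D x c d C' D' h1 h2 h
    obtain ⟨-, rfl, rfl⟩ := ins_zero_inv h1
    obtain ⟨-, rfl, rfl⟩ := ins_zero_inv h2
    refine ⟨rfl, fun J hJ => ?_⟩
    obtain rfl : J = 0 := by omega
    simp [h 0 le_rfl]
  | succ j ih =>
    intro C D x c d C' D' h1 h2 h
    have hj := h j (by omega)
    have hj1 := h (j + 1) le_rfl
    obtain ⟨-, ⟨m1, rfl, rfl⟩ | ⟨e, g, F1, I1⟩⟩ := ins_succ_inv h1 <;>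
    obtain ⟨-, ⟨m2, rfl, rfl⟩ | ⟨e', g', F2, I2⟩⟩ := ins_succ_inv h2
    · refine ⟨rfl, fun J hJ => ?_⟩
      by_cases hJ' : J = j + 1
      · subst hJ'; simp [hj1]
      · simp [hJ', h J hJ]
    · rw [← hj, ← hj1] at F2
      exact absurd m1 (fail_not_matched F2)
    · rw [← hj, ← hj1] at m2
      exact absurd m2 (fail_not_matched F1)
    · rw [← hj, ← hj1] at F2
      obtain ⟨rfl, rfl⟩ := fail_unique F1 F2
      have hag := update_agree (fun J hJ => h J (Nat.le_succ_of_le hJ))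
        ((insert x (C (j + 1))).erase e) ((insert x (D (j + 1))).erase e)
      obtain ⟨q1, q2⟩ := ih I1 I2 hag
      refine ⟨q1, fun J hJ => ?_⟩
      by_cases hJ' : J = j + 1
      · subst hJ'
        rw [ins_above I1 (by omega), ins_above I2 (by omega)]
        simp [hj1]
      · exact q2 J (by omega)

theorem ins_congr {j : ℕ} : ∀ {C D : ℕ → Finset ℕ} {x c : ℕ} {C' : ℕ → Finset ℕ},
    Ins C j x c C' → (∀ J, J ≤ j → C J = D J) →
      ∃ D', Ins D j x c D' ∧ ∀ J, J ≤ j → C' J = D' J := by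
  induction j with
  | zero =>
    intro C D x c C' h1 h
    have h1' := h1
    obtain ⟨hx, rfl, rfl⟩ := ins_zero_inv h1
    have := Ins.zero (C := D) (x := x) (h 0 le_rfl ▸ hx)
    exact ⟨_, this, (ins_unique h1' this h).2⟩
  | succ j ih =>
    intro C D x c C' h1 h
    have h1' := h1
    have hj := h j (by omega)
    have hj1 := h (j + 1) le_rfl
    obtain ⟨hx, ⟨m1, rfl, rfl⟩ | ⟨e, g, F1, I1⟩⟩ := ins_succ_inv h1
    · have := Ins.land (C := D) (x := x) (hj1 ▸ hx) (by rwa [← hj, ← hj1])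
      exact ⟨_, this, (ins_unique h1' this h).2⟩
    · have hag := update_agree (fun J hJ => h J (Nat.le_succ_of_le hJ))
        ((insert x (C (j + 1))).erase e) ((insert x (D (j + 1))).erase e)
      obtain ⟨D', I2, -⟩ := ih I1 hag
      have := Ins.step (C := D) (x := x) (hj1 ▸ hx) (by rwa [← hj, ← hj1]) I2
      exact ⟨_, this, (ins_unique h1' this h).2⟩

theorem ins_top {C : ℕ → Finset ℕ} {j x c : ℕ} {C' : ℕ → Finset ℕ} (h : Ins C j x c C')
    (hC : AllM C) : ∃ e, x ≤ e ∧ (C' j = insert x (C j) ∧ c = j ∨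
      C' j = (insert x (C j)).erase e ∧ e ∈ insert x (C j)) := by
  cases h with
  | zero hx => exact ⟨x, le_rfl, .inl ⟨by simp, rfl⟩⟩
  | land hx h => exact ⟨x, le_rfl, .inl ⟨by simp, rfl⟩⟩
  | step hx hF h =>
    refine ⟨_, fail_le (hC _) hx hF, .inr ⟨?_, fail_mem hF⟩⟩
    rw [ins_above h (by omega)]
    simp

theorem ins_lc_eq {C : ℕ → Finset ℕ} {j x c : ℕ} {C' : ℕ → Finset ℕ} (h : Ins C j x c C')
    (hC : AllM C) {t : ℕ} (ht : t ≤ x) : lc (C' j) t = lc (C j) t := by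
  have hx := ins_notMem h
  obtain ⟨e, he, ⟨h1, -⟩ | ⟨h1, h2⟩⟩ := ins_top h hC
  · rw [h1, lc_insert hx, if_neg (by omega)]; rfl
  · have := lc_insert_erase hx h2 t
    rw [← h1] at this
    split_ifs at this <;> omega

theorem ins_lc_le {C : ℕ → Finset ℕ} {j x c : ℕ} {C' : ℕ → Finset ℕ} (h : Ins C j x c C')
    (hC : AllM C) (t : ℕ) : lc (C j) t ≤ lc (C' j) t := by
  have hx := ins_notMem h
  obtain ⟨e, he, ⟨h1, -⟩ | ⟨h1, h2⟩⟩ := ins_top h hC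
  · rw [h1, lc_insert hx]; omega
  · have := lc_insert_erase hx h2 t
    rw [← h1] at this
    split_ifs at this <;> omega

theorem ins_mem_lt {C : ℕ → Finset ℕ} {j x c : ℕ} {C' : ℕ → Finset ℕ} (h : Ins C j x c C')
    (hC : AllM C) {t : ℕ} (ht : t < x) : t ∈ C' j ↔ t ∈ C j := by
  obtain ⟨e, he, ⟨h1, -⟩ | ⟨h1, h2⟩⟩ := ins_top h hC <;> rw [h1] <;>
    simp only [Finset.mem_insert, Finset.mem_erase] <;> grind

theorem ins_mem_of_ne {C : ℕ → Finset ℕ} {j x c : ℕ} {C' : ℕ → Finset ℕ} (h : Ins C j x c C')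
    (hC : AllM C) {t : ℕ} (ht : t ≠ x) (hm : t ∈ C' j) : t ∈ C j := by
  obtain ⟨e, he, ⟨h1, -⟩ | ⟨h1, h2⟩⟩ := ins_top h hC <;> rw [h1] at hm <;>
    simp only [Finset.mem_insert, Finset.mem_erase] at hm <;> grind

/-- After inserting `x`, the insertion of a larger letter ends in a later column. -/
theorem ins_lt_ins {C : ℕ → Finset ℕ} {j x c : ℕ} {C' : ℕ → Finset ℕ} (h : Ins C j x c C') :
    AllM C → ∀ {y d : ℕ} {C'' : ℕ → Finset ℕ}, x < y → Ins C' (j + 1) y d C'' → c < d := by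
  have key : ∀ {j x : ℕ} {C : ℕ → Finset ℕ}, x ∉ C j → AllM C → ∀ {y d : ℕ} {C''}, x < y →
      Ins (Function.update C j (insert x (C j))) (j + 1) y d C'' → j < d := by
    intro j x C hx hC y d C'' hxy h2
    obtain ⟨hy, ⟨m1, rfl, rfl⟩ | ⟨e, g, F1, I1⟩⟩ := ins_succ_inv h2
    · omega
    · rw [Function.update_self, Function.update_of_ne (by omega)] at F1
      refine absurd ?_ (fail_not_matched F1)
      rw [Function.update_of_ne (by omega)] at hy
      intro t
      have := hC j t
      rw [lc_insert hx, lc_insert hy]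
      split_ifs <;> omega
  induction h with
  | zero hx => intro hC y d C'' hxy h2; exact key hx hC hxy h2
  | land hx h => intro hC y d C'' hxy h2; exact key hx hC hxy h2
  | @step C j x e h c C' hx hF h' ih =>
    intro hC y d C'' hxy h2
    have hcj := ins_le h'
    obtain ⟨hy, ⟨m1, rfl, rfl⟩ | ⟨f, g, F1, I1⟩⟩ := ins_succ_inv h2
    · omega
    · have e1 : C' (j + 1) = (insert x (C (j + 1))).erase e := by
        rw [ins_above h' (by omega)]; simp
      have e2 : C' (j + 1 + 1) = C (j + 1 + 1) := by
        rw [ins_above h' (by omega)]; simp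
      rw [e2] at hy
      rw [e1, e2] at F1
      obtain ⟨D', I2, -⟩ := ins_congr I1 (D := C') (fun J hJ => by
        rw [Function.update_of_ne (by omega)])
      refine ih (allM_step hC hx hF) ?_ I2
      have hef : e < f := by
        by_contra hle
        have h1 := fail_lt F1
        have h2 := lc_insert_erase hx (fail_mem hF) f
        rw [lc_insert hy] at h1
        have h3 := hC (j + 1) f
        split_ifs at h1 h2 <;> omega
      by_contra hgh
      have hg := F1.nh
      exact hg (Finset.mem_erase.2 ⟨by have := F1.le; omega,
        hF.run g (by have := F1.le; omega) (by omega)⟩)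

/-- After inserting `x`, the insertion of a smaller letter ends in a column weakly before. -/
theorem ins_ins_le {C : ℕ → Finset ℕ} {j x c : ℕ} {C' : ℕ → Finset ℕ} (h : Ins C j x c C') :
    AllM C → ∀ {y d : ℕ} {C'' : ℕ → Finset ℕ}, y < x → Ins C' j y d C'' → d ≤ c := by
  induction h with
  | zero hx => intro hC y d C'' hxy h2; exact ins_le h2
  | land hx h => intro hC y d C'' hxy h2; exact ins_le h2
  | @step C j x e h c C' hx hF h' ih =>
    intro hC y d C'' hxy h2
    have hxe := fail_le (hC j) hx hF
    have e1 : C' (j + 1) = (insert x (C (j + 1))).erase e := by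
      rw [ins_above h' (by omega)]; simp
    have hC2 := allM_step hC hx hF
    have hlow : lc (C' j) e = lc (C j) e := by
      rw [ins_lc_eq h' hC2 hF.le, Function.update_of_ne (by omega)]
    obtain ⟨hy, hcase⟩ := ins_succ_inv h2
    rw [e1] at hy hcase
    have hlt : lc (C' j) e < lc (insert y ((insert x (C (j + 1))).erase e)) (e + 1) := by
      rw [lc_insert hy, hlow, hF.eq, if_pos (by omega)]
      have := lc_erase (fail_mem hF) (e + 1)
      have h3 := lc_succ (insert x (C (j + 1))) e
      rw [if_pos (fail_mem hF)] at h3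
      rw [if_pos (by omega)] at this
      omega
    obtain ⟨m1, -, -⟩ | ⟨f, g, F1, I1⟩ := hcase
    · have := m1 e; omega
    · obtain ⟨D', I2, -⟩ := ins_congr I1 (D := C') (fun J hJ => by
        rw [Function.update_of_ne (by omega)])
      refine ih hC2 ?_ I2
      have hfe : f ≤ e := by
        by_contra hlt'
        have := F1.no e (by omega)
        omega
      by_contra hgh
      have := F1.run e hfe (by have := hF.le; omega)
      simp only [Finset.mem_insert, Finset.mem_erase] at this
      omega

/-- Comparing the insertions of two letters `a < b` in either order. -/
theorem ins_dichotomy {j : ℕ} : ∀ {C : ℕ → Finset ℕ} {a b ca cb : ℕ} {Ca Cb : ℕ → Finset ℕ},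
    AllM C → a < b → Ins C j a ca Ca → Ins C j b cb Cb →
    ca ≤ cb ∧ (ca < cb → (∀ t, b ≤ t → lc (Ca j) t = lc (C j) t) ∧
      (∀ {d D}, Ins Ca j b d D → d = cb) ∧ (∀ {d D}, Ins Cb j a d D → d = ca)) := by
  induction j with
  | zero =>
    intro C a b ca cb Ca Cb hC hab ha hb
    obtain ⟨-, rfl, rfl⟩ := ins_zero_inv ha
    obtain ⟨-, rfl, rfl⟩ := ins_zero_inv hb
    simp
  | succ j ih =>
    intro C a b ca cb Ca Cb hC hab ha hb
    have hb0 := hb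
    have ha0 := ha
    obtain ⟨hax, ⟨ma, rfl, rfl⟩ | ⟨e, h, Fa, Ia⟩⟩ := ins_succ_inv ha
    · obtain ⟨hbx, ⟨mb, rfl, rfl⟩ | ⟨f, g, Fb, Ib⟩⟩ := ins_succ_inv hb
      · simp
      · refine absurd ?_ (fail_not_matched Fb)
        intro t
        have h1 := ma t
        rw [lc_insert hax] at h1
        rw [lc_insert hbx]
        split_ifs at h1 ⊢ <;> omega
    have hae := fail_le (hC j) hax Fa
    have hCa := allM_step hC hax Fa
    have eaj1 : Ca (j + 1) = (insert a (C (j + 1))).erase e := by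
      rw [ins_above Ia (by omega)]; simp
    have la := lc_insert_erase hax (fail_mem Fa)
    have hlea : ∀ t, lc (C j) t ≤ lc (Ca j) t := fun t => by
      have := ins_lc_le Ia hCa t
      rwa [Function.update_of_ne (by omega)] at this
    have hiv : e < b → ∀ t, b ≤ t → lc (Ca (j + 1)) t = lc (C (j + 1)) t := by
      intro heb t ht
      have := la t
      rw [eaj1]
      split_ifs at this <;> omega
    obtain ⟨hbx, ⟨mb, rfl, rfl⟩ | ⟨f, g, Fb, Ib⟩⟩ := ins_succ_inv hb
    · have hcj := ins_le Ia
      have heb : e < b := by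
        by_contra hle
        have h1 := mb e
        have h2 := fail_lt Fa
        rw [lc_insert hbx] at h1
        rw [lc_insert hax] at h2
        split_ifs at h1 h2 <;> omega
      refine ⟨by omega, fun _ => ⟨hiv heb, ?_, ?_⟩⟩
      · intro d D hI
        obtain ⟨hy, ⟨m1, rfl, rfl⟩ | ⟨f, g, F1, I1⟩⟩ := ins_succ_inv hI
        · rfl
        · refine absurd ?_ (fail_not_matched F1)
          rw [eaj1] at hy ⊢
          intro t
          refine le_trans ?_ (hlea t)
          rw [lc_insert hy]
          have h1 := la (t + 1)
          have h2 := mb t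
          have h3 := Fa.no t
          rw [lc_insert hbx] at h2
          rw [lc_insert hax] at h3
          split_ifs at h1 h2 h3 ⊢ <;> omega
      · intro d D hI
        obtain ⟨hy, hcase⟩ := ins_succ_inv hI
        rw [Function.update_self, Function.update_of_ne (by omega)] at hcase
        rw [Function.update_self] at hy
        have hlt : lc (C j) e < lc (insert a (insert b (C (j + 1)))) (e + 1) := by
          have := fail_lt Fa
          rw [lc_insert hy, lc_insert hbx]
          rw [lc_insert hax] at this
          split_ifs at this ⊢ <;> omega
        obtain ⟨m1, -, -⟩ | ⟨f, g, F1, I1⟩ := hcase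
        · have := m1 e; omega
        · have hfe : e = f := by
            rcases Nat.lt_trichotomy e f with h1 | h1 | h1
            · have := F1.no e h1; omega
            · exact h1
            · have h2 := fail_lt F1
              have h3 := Fa.no f h1
              rw [lc_insert hy, lc_insert hbx] at h2
              rw [lc_insert hax] at h3
              split_ifs at h2 h3 <;> omega
          obtain rfl := fail_first Fa F1 hfe
          refine (ins_unique I1 Ia ?_).1
          intro J hJ
          rw [Function.update_of_ne (by omega), Function.update_of_ne (by omega),
            Function.update_of_ne (by omega)]
    · have hbf := fail_le (hC j) hbx Fb
      have hCb := allM_step hC hbx Fb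
      have ebj1 : Cb (j + 1) = (insert b (C (j + 1))).erase f := by
        rw [ins_above Ib (by omega)]; simp
      have lb := lc_insert_erase hbx (fail_mem Fb)
      have hag : ∀ X Y J, J ≤ j →
          Function.update C (j + 1) X J = Function.update C (j + 1) Y J := fun X Y J hJ =>
        update_agree (fun _ _ => rfl) X Y J hJ
      by_cases hgh : h = g
      · subst hgh
        obtain ⟨rfl, -⟩ := ins_unique Ia Ib (hag _ _)
        exact ⟨le_rfl, fun h => absurd h (lt_irrefl _)⟩
      have hef : e < b := by
        by_contra hle
        apply hgh
        refine fail_first Fa Fb ?_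
        rcases Nat.lt_trichotomy e f with h1 | h1 | h1
        · have h2 := fail_lt Fa
          have h3 := Fb.no e h1
          rw [lc_insert hbx] at h3
          rw [lc_insert hax] at h2
          split_ifs at h2 h3 <;> omega
        · exact h1
        · have h2 := fail_lt Fb
          have h3 := Fa.no f h1
          rw [lc_insert hbx] at h2
          rw [lc_insert hax] at h3
          split_ifs at h2 h3 <;> omega
      have hhf : h < f := by
        by_contra hle
        apply hgh
        rcases Nat.lt_trichotomy h g with h1 | h1 | h1
        · exact absurd (Fb.cov h (by omega) h1) Fa.nh
        · exact h1
        · exact absurd (Fa.cov g (by have := Fb.le; omega) h1) Fb.nh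
      have hfg := Fb.le
      obtain ⟨Cb2, Ib2, hag2⟩ := ins_congr Ib
        (D := Function.update C (j + 1) ((insert a (C (j + 1))).erase e)) (hag _ _)
      obtain ⟨q1, q2⟩ := ih hCa (by omega : h < g) Ia Ib2
      refine ⟨q1, fun hlt => ⟨hiv hef, ?_, ?_⟩⟩
      · obtain ⟨r1, r2, -⟩ := q2 hlt
        intro d D hI
        obtain ⟨hy, hcase⟩ := ins_succ_inv hI
        rw [eaj1] at hy hcase
        have hlt' : lc (Ca j) g < lc (insert b ((insert a (C (j + 1))).erase e)) (g + 1) := by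
          rw [r1 g le_rfl, lc_insert hy, Function.update_of_ne (by omega)]
          have h1 := fail_zero Fb
          have h2 := la (g + 1)
          have h3 := lb (g + 1)
          split_ifs at h2 h3 ⊢ <;> omega
        obtain ⟨m1, -, -⟩ | ⟨f', g', F1, I1⟩ := hcase
        · have := m1 g; omega
        · have hf'g : f' ≤ g := by
            by_contra hc
            have := F1.no g (by omega)
            omega
          have hff' : f ≤ f' := by
            by_contra hc
            have h1 := fail_lt F1
            have h2 := hlea f'
            have h3 := Fb.no f' (by omega)
            have h4 := Fa.no f'
            have h5 := la (f' + 1)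
            have h6 := hC j f'
            rw [lc_insert hy] at h1
            rw [lc_insert hbx] at h3
            rw [lc_insert hax] at h4
            split_ifs at h1 h3 h4 h5 <;> omega
          have hle' := F1.le
          have hg' : g' = g := by
            rcases Nat.lt_trichotomy g' g with h1 | h1 | h1
            · have h2 := Fb.run (g' + 1) (by omega) (by omega)
              refine absurd ?_ F1.nxt
              simp only [Finset.mem_insert, Finset.mem_erase] at h2 ⊢
              rcases h2 with h2 | h2
              · exact .inl h2
              · exact .inr ⟨by omega, .inr h2⟩
            · exact h1
            · have h2 := F1.cov g hf'g h1
              have h3 := ins_mem_of_ne Ia hCa (by omega) h2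
              rw [Function.update_of_ne (by omega)] at h3
              exact absurd h3 Fb.nh
          subst hg'
          obtain ⟨D', I2, -⟩ := ins_congr I1 (D := Ca) (fun J hJ => by
            rw [Function.update_of_ne (by omega)])
          exact r2 I2
      · obtain ⟨-, -, r3⟩ := q2 hlt
        intro d D hI
        obtain ⟨hy, hcase⟩ := ins_succ_inv hI
        rw [ebj1] at hy hcase
        have hlow : ∀ t, t ≤ g → lc (Cb j) t = lc (C j) t := fun t ht => by
          rw [ins_lc_eq Ib hCb ht, Function.update_of_ne (by omega)]
        have hlt' : lc (Cb j) e < lc (insert a ((insert b (C (j + 1))).erase f)) (e + 1) := by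
          rw [hlow e (by omega), lc_insert hy]
          have h1 := fail_lt Fa
          have h3 := lb (e + 1)
          rw [lc_insert hax] at h1
          split_ifs at h1 h3 ⊢ <;> omega
        obtain ⟨m1, -, -⟩ | ⟨f', g', F1, I1⟩ := hcase
        · have := m1 e; omega
        · have hf'e : f' = e := by
            rcases Nat.lt_trichotomy f' e with h1 | h1 | h1
            · have h2 := fail_lt F1
              have h3 := lb (f' + 1)
              have h4 := Fa.no f' h1
              rw [lc_insert hy, hlow f' (by omega)] at h2
              rw [lc_insert hax] at h4
              split_ifs at h2 h3 h4 <;> omega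
            · exact h1
            · have := F1.no e h1
              omega
          subst hf'e
          have hmem : ∀ t, t < g → (t ∈ Cb j ↔ t ∈ C j) := fun t ht => by
            rw [ins_mem_lt Ib hCb ht, Function.update_of_ne (by omega)]
          have hg' : g' = h := by
            have hle1 := F1.le
            have hle2 := Fa.le
            rcases Nat.lt_trichotomy g' h with h1 | h1 | h1
            · refine absurd ?_ F1.nh
              rw [hmem _ (by omega)]
              exact Fa.cov g' hle1 h1
            · exact h1
            · have := F1.cov h hle2 h1
              rw [hmem _ (by omega)] at this
              exact absurd this Fa.nh
          subst hg'
          obtain ⟨D', I2, -⟩ := ins_congr I1 (D := Cb2) (fun J hJ => by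
            rw [Function.update_of_ne (by omega), hag2 J hJ])
          exact r3 I2


/-- Successive matched openers of a set `D` in column `j`, down to column `0`. -/
def proj (C : ℕ → Finset ℕ) : ℕ → Finset ℕ → Finset ℕ
  | 0, D => D
  | j + 1, D => proj C j (mat (C j) D)

/-- The column `j` of the left key. -/
def keyCol (C : ℕ → Finset ℕ) (j : ℕ) : Finset ℕ := proj C j (C j)

theorem proj_congr {j : ℕ} : ∀ {C C' : ℕ → Finset ℕ} (D : Finset ℕ), (∀ J, J < j → C J = C' J) →
    proj C j D = proj C' j D := by
  induction j with
  | zero => intros; rfl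
  | succ j ih =>
    intro C C' D h
    rw [proj, proj, h j (by omega), ih _ (fun J hJ => h J (by omega))]

theorem keyCol_congr {j : ℕ} {C C' : ℕ → Finset ℕ} (h : ∀ J, J ≤ j → C J = C' J) :
    keyCol C j = keyCol C' j := by
  unfold keyCol
  rw [h j le_rfl, proj_congr _ (fun J hJ => h J hJ.le)]

theorem proj_mono {C : ℕ → Finset ℕ} (hC : AllM C) {j : ℕ} : ∀ {D D' : Finset ℕ}, D ⊆ D' →
    (∀ i, i + 1 = j → Matched (C i) D') → proj C j D ⊆ proj C j D' := by
  induction j with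
  | zero => intro D D' h _; exact h
  | succ j ih =>
    intro D D' h hm
    refine ih (mat_mono (hm j rfl) h) ?_
    intro i hi
    subst hi
    exact matched_subset (hC i) (mat_subset _ _)

theorem card_proj {C : ℕ → Finset ℕ} (hC : AllM C) {j : ℕ} : ∀ {D : Finset ℕ},
    (∀ i, i + 1 = j → Matched (C i) D) → (proj C j D).card = D.card := by
  induction j with
  | zero => intros; rfl
  | succ j ih =>
    intro D hm
    rw [proj, ih, card_mat (hm j rfl)]
    intro i hi
    subst hi
    exact matched_subset (hC i) (mat_subset _ _)

theorem card_keyCol {C : ℕ → Finset ℕ} (hC : AllM C) (j : ℕ) : (keyCol C j).card = (C j).card :=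
  card_proj hC (fun i hi => by subst hi; exact hC i)

theorem keyCol_succ_subset {C : ℕ → Finset ℕ} (hC : AllM C) (j : ℕ) :
    keyCol C (j + 1) ⊆ keyCol C j :=
  proj_mono hC (mat_subset _ _) (fun i hi => by subst hi; exact hC i)

theorem keyCol_anti {C : ℕ → Finset ℕ} (hC : AllM C) {i j : ℕ} (h : i ≤ j) :
    keyCol C j ⊆ keyCol C i := by
  induction j, h using Nat.le_induction with
  | base => exact subset_rfl
  | succ j _ ih => exact (keyCol_succ_subset hC j).trans ih

theorem keyCol_eq_empty {C : ℕ → Finset ℕ} (hC : AllM C) {j : ℕ} (h : C j = ∅) :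
    keyCol C j = ∅ := by
  rw [← Finset.card_eq_zero, card_keyCol hC, h, Finset.card_empty]

/-- `F` can be inserted next to a letter `x` put in column `C`. -/
def Loose (C F : Finset ℕ) (x : ℕ) : Prop :=
  ∀ t, x < t → lc F (t + 1) + lc C x ≤ lc C t + lc F (x + 1)

theorem fail_loose {C K F : Finset ℕ} {e h : ℕ} (hF : Fail C K e h) (hm : Matched C (K.erase e))
    (hFK : F ⊆ K.erase e) : Loose C F h := by
  intro t ht
  have h1 := fail_zero hF
  have h2 := hm t
  have h3 : lc F (t + 1) + lc (K.erase e) (h + 1) ≤ lc (K.erase e) (t + 1) + lc F (h + 1) := by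
    have hsd : Disjoint F (K.erase e \ F) := Finset.disjoint_sdiff
    have eu := Finset.union_sdiff_of_subset hFK
    have e1 := lc_union hsd (t + 1)
    have e2 := lc_union hsd (h + 1)
    rw [eu] at e1 e2
    have := lc_mono (K.erase e \ F) (show h + 1 ≤ t + 1 by omega)
    omega
  omega

theorem proj_ins {C : ℕ → Finset ℕ} {j x c : ℕ} {C' : ℕ → Finset ℕ} (h : Ins C j x c C') :
    AllM C → ∀ {F}, Matched (C j) F → Loose (C j) F x → proj C' (j + 1) F = proj C (j + 1) F := by
  induction h with
  | zero hx =>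
    intro hC F hF hl
    simp only [proj, Function.update_self]
    exact mat_opener_insert hF hx hl
  | @land C j x hx hm =>
    intro hC F hF hl
    change proj _ (j + 1) (mat _ F) = proj _ (j + 1) (mat _ F)
    rw [Function.update_self, mat_opener_insert hF hx hl]
    exact proj_congr _ (fun J hJ => Function.update_of_ne (by omega) _ _)
  | @step C j x e h c C' hx hFa h' ih =>
    intro hC F hF hl
    have hC2 := allM_step hC hx hFa
    have e1 : C' (j + 1) = (insert x (C (j + 1))).erase e := by
      rw [ins_above h' (by omega)]; simp
    have hxe := fail_le (hC j) hx hFa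
    have hm := fail_matched (hC j) hx hFa
    have hKF := matched_insert_erase hF hx (fail_mem hFa) hxe
    have e2 : Function.update C (j + 1) ((insert x (C (j + 1))).erase e) j = C j :=
      Function.update_of_ne (by omega) _ _
    rw [proj, e1, ih hC2 (by rw [e2]; exact matched_subset hm (mat_subset _ _))
      (by rw [e2]; exact fail_loose hFa hm (mat_subset _ _)), proj, e2, proj, proj,
      proj_congr _ (C' := C) (fun J hJ => Function.update_of_ne (by omega) _ _),
      (mat_opener_erase (fail_mem hFa) hKF hm hFa.no hFa.eq.le).2, mat_opener_insert hF hx hl]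

theorem proj_step {C : ℕ → Finset ℕ} (hC : AllM C) {j x e h : ℕ} (hx : x ∉ C (j + 1))
    (hF : Fail (C j) (insert x (C (j + 1))) e h) :
    mat (C j) ((insert x (C (j + 1))).erase e) = mat (C j) (C (j + 1)) := by
  have hxe := fail_le (hC j) hx hF
  have l := lc_insert_erase hx (fail_mem hF)
  refine (mat_closer_exchange (e := e) (hC j) (fail_matched (hC j) hx hF) ?_ ?_ ?_).symm
  · intro s
    have := l (s + 1)
    split_ifs at this <;> omega
  · intro s hs
    have := l (s + 1)
    split_ifs at this <;> omega
  · have h1 := lc_insert hx (e + 1)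
    have h2 := fail_lt hF
    split_ifs at h1 <;> omega

theorem keyCol_step {C : ℕ → Finset ℕ} (hC : AllM C) {j x e h : ℕ} (hx : x ∉ C (j + 1))
    (hF : Fail (C j) (insert x (C (j + 1))) e h) {J : ℕ} (hJ : J ≤ j + 1) :
    keyCol (Function.update C (j + 1) ((insert x (C (j + 1))).erase e)) J = keyCol C J := by
  by_cases hJ' : J = j + 1
  · subst hJ'
    rw [keyCol, proj, Function.update_self, Function.update_of_ne (by omega), proj_step hC hx hF,
      proj_congr _ (C' := C) (fun J hJ => Function.update_of_ne (by omega) _ _)]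
    rfl
  · exact keyCol_congr (fun I hI => Function.update_of_ne (by omega) _ _)

/-- Insertion does not change the left key in columns after the new box. -/
theorem keyCol_ins_of_lt {C : ℕ → Finset ℕ} {j x c : ℕ} {C' : ℕ → Finset ℕ} (h : Ins C j x c C') :
    AllM C → ∀ {J}, c < J → J ≤ j → keyCol C' J = keyCol C J := by
  induction h with
  | zero hx => intros; omega
  | land hx hm => intros; omega
  | @step C j x e h c C' hx hFa h' ih =>
    intro hC J hcJ hJ
    have hC2 := allM_step hC hx hFa
    have e1 : C' (j + 1) = (insert x (C (j + 1))).erase e := by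
      rw [ins_above h' (by omega)]; simp
    have hm := fail_matched (hC j) hx hFa
    have e2 : Function.update C (j + 1) ((insert x (C (j + 1))).erase e) j = C j :=
      Function.update_of_ne (by omega) _ _
    rw [← keyCol_step hC hx hFa hJ]
    by_cases hJ' : J = j + 1
    · subst hJ'
      rw [keyCol, e1, proj_ins h' hC2 (by rw [e2]; exact hm)
        (by rw [e2]; exact fail_loose hFa hm subset_rfl), keyCol, Function.update_self]
    · exact ih hC2 hcJ (by omega)

theorem keyCol_ins_of_gt {C : ℕ → Finset ℕ} {j x c : ℕ} {C' : ℕ → Finset ℕ} (h : Ins C j x c C')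
    {J : ℕ} (hJ : J < c) : keyCol C' J = keyCol C J :=
  keyCol_congr (fun _ hI => ins_below h (by omega))

theorem proj_insert {C : ℕ → Finset ℕ} (hC : AllM C) {j : ℕ} : ∀ {D D1 : Finset ℕ} {p : ℕ},
    p ∉ D → (∀ i, i + 1 = j → Matched (C i) (insert p D)) → D1 ⊆ D →
    (∀ t, t ≤ p + 1 → lc D1 t = lc D t) →
    ∃ r, r ∉ proj C j D ∧ proj C j (insert p D) = insert r (proj C j D) ∧
      ∀ t, t ≤ r + 1 → lc (proj C j D1) t = lc (proj C j D) t := by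
  induction j with
  | zero => intro D D1 p hp _ _ h; exact ⟨p, hp, rfl, h⟩
  | succ j ih =>
    intro D D1 p hp hm hD1 h
    obtain ⟨r, hrC, hr, -, e, -, h2⟩ := mat_insert hp (hm j rfl)
    have hD := matched_subset (hm j rfl) (Finset.subset_insert _ _)
    obtain ⟨r', hr', e', h3⟩ := ih (D := mat (C j) D) (D1 := mat (C j) D1) hr (fun i hi => by
      subst hi
      exact matched_subset (hC i) (Finset.insert_subset hrC (mat_subset _ _)))
      (mat_mono hD hD1) (h2 D1 hD1 h)
    exact ⟨r', hr', by rw [proj, e, e']; rfl, h3⟩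

/-- Insertion adds one element to the left key, in the column of the new box, in the lowest row
compatible with the next column. -/
theorem keyCol_ins {C : ℕ → Finset ℕ} {j x c : ℕ} {C' : ℕ → Finset ℕ} (h : Ins C j x c C') :
    AllM C → (∀ t, t ≤ x + 1 → lc (mat (C j) (C (j + 1))) t = lc (C j) t) →
    ∃ r, r ∉ keyCol C c ∧ keyCol C' c = insert r (keyCol C c) ∧
      ∀ r' ∈ keyCol C c, r' < r → r' ∈ keyCol C (c + 1) := by
  have key : ∀ {C : ℕ → Finset ℕ} {j x : ℕ}, x ∉ C j → AllM C →
      (∀ i, i + 1 = j → Matched (C i) (insert x (C j))) →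
      (∀ t, t ≤ x + 1 → lc (mat (C j) (C (j + 1))) t = lc (C j) t) →
      ∃ r, r ∉ keyCol C j ∧
        keyCol (Function.update C j (insert x (C j))) j = insert r (keyCol C j) ∧
        ∀ r' ∈ keyCol C j, r' < r → r' ∈ keyCol C (j + 1) := by
    intro C j x hx hC hm h
    obtain ⟨r, hr, e, h2⟩ := proj_insert hC hx hm (mat_subset _ _) h
    refine ⟨r, hr, ?_, ?_⟩
    · rw [keyCol, Function.update_self,
        proj_congr _ (C' := C) (fun J hJ => Function.update_of_ne (by omega) _ _), e]
      rfl
    · intro r' hr' hlt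
      unfold keyCol at hr'
      have h3 := h2 r' (by omega)
      have h4 := h2 (r' + 1) (by omega)
      rw [lc_succ, lc_succ _ r', if_pos hr'] at h4
      change r' ∈ proj C j (mat (C j) (C (j + 1)))
      by_contra hc
      rw [if_neg hc] at h4
      omega
  induction h with
  | zero hx => intro hC h; exact key hx hC (by omega) h
  | land hx hm =>
    intro hC h
    refine key hx hC ?_ h
    intro i hi
    obtain rfl := Nat.succ_injective hi
    exact hm
  | @step C j x e h c C' hx hFa h' ih =>
    intro hC _
    have hC2 := allM_step hC hx hFa
    have hcj := ins_le h'
    have hm := fail_matched (hC j) hx hFa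
    have e2 : Function.update C (j + 1) ((insert x (C (j + 1))).erase e) j = C j :=
      Function.update_of_ne (by omega) _ _
    obtain ⟨r, h1, h2, h3⟩ := ih hC2 (by
      rw [e2, Function.update_self]
      intro t ht
      have hz := fun t => lc_mat_of_zero hm (s := h) (t := t) (fail_zero hFa).le
      rcases Nat.lt_or_ge h t with h1 | h1
      · obtain rfl : t = h + 1 := by omega
        have h2 := hz h le_rfl
        rw [lc_succ, lc_succ (C j), if_neg hFa.nh, if_neg (fun hh => hFa.nh (mat_subset _ _ hh)), h2]
      · exact hz t h1)
    rw [keyCol_step hC hx hFa (by omega)] at h1 h2 h3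
    rw [keyCol_step hC hx hFa (by omega)] at h3
    exact ⟨r, h1, h2, h3⟩


/-! ### Insertion into tableaux -/

theorem ins_up_iff {C : ℕ → Finset ℕ} {N x c : ℕ} {C' : ℕ → Finset ℕ} (h0 : C N = ∅)
    (h1 : C (N + 1) = ∅) : Ins C (N + 1) x c C' ↔ Ins C N x c C' := by
  have hF : Fail (C N) (insert x (C (N + 1))) x x := by
    have l : ∀ t, lc (insert x (C (N + 1))) t = if x < t then 1 else 0 := fun t => by
      rw [lc_insert (by simp [h1]), h1, lc_eq_zero (by simp)]
      simp
    refine ⟨le_rfl, fun t ht => ?_, ?_, fun y a b => ?_, ?_, fun y a b => by omega, by simp [h0]⟩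
    · rw [l, if_neg (by omega)]; omega
    · rw [l, h0, lc_eq_zero (by simp)]; simp
    · obtain rfl : y = x := by omega
      simp
    · simp [h1]
  have hC : Function.update C (N + 1) ((insert x (C (N + 1))).erase x) = C := by
    rw [Function.update_eq_self_iff, h1]
    simp
  constructor
  · intro h
    obtain ⟨-, ⟨m, -, -⟩ | ⟨e, g, F, I⟩⟩ := ins_succ_inv h
    · exact absurd m (fail_not_matched hF)
    · obtain ⟨rfl, rfl⟩ := fail_unique hF F
      rwa [hC] at I
  · intro h
    exact Ins.step (by simp [h1]) hF (by rwa [hC])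

/-- Insertion of `x` into a tableau. -/
def TIns (C : ℕ → Finset ℕ) (x c : ℕ) (C' : ℕ → Finset ℕ) : Prop :=
  ∃ N, (∀ j, N ≤ j → C j = ∅) ∧ Ins C N x c C'

theorem tins_at {C : ℕ → Finset ℕ} {x c : ℕ} {C' : ℕ → Finset ℕ} (h : TIns C x c C') {M : ℕ}
    (hM : ∀ j, M ≤ j → C j = ∅) : Ins C M x c C' := by
  obtain ⟨N, hN, hI⟩ := h
  rcases Nat.le_total N M with hle | hle
  · induction M, hle using Nat.le_induction with
    | base => exact hI
    | succ M hM' ih =>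
      exact (ins_up_iff (hN M hM') (hM _ le_rfl)).2 (ih (fun j hj => hN j (by omega)))
  · induction N, hle using Nat.le_induction with
    | base => exact hI
    | succ N hN' ih =>
      exact ih (fun j hj => hM j (by omega)) ((ins_up_iff (hM N hN') (hN _ le_rfl)).1 hI)

theorem tins_unique {C : ℕ → Finset ℕ} {x c d : ℕ} {C' D' : ℕ → Finset ℕ} (h : TIns C x c C')
    (h' : TIns C x d D') : c = d ∧ C' = D' := by
  obtain ⟨N, hN, hI⟩ := h
  have hI' := tins_at h' hN
  obtain ⟨h1, h2⟩ := ins_unique hI hI' (fun _ _ => rfl)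
  refine ⟨h1, funext fun J => ?_⟩
  rcases Nat.lt_or_ge N J with hJ | hJ
  · rw [ins_above hI hJ, ins_above hI' hJ]
  · exact h2 J hJ

theorem tins_isTab {C : ℕ → Finset ℕ} {x c : ℕ} {C' : ℕ → Finset ℕ} (h : TIns C x c C')
    (hC : AllM C) : IsTab C' := by
  obtain ⟨N, hN, hI⟩ := h
  exact ⟨ins_allM hI hC, N + 1, fun j hj => by rw [ins_above hI (by omega), hN j (by omega)]⟩

theorem tins_lt {C : ℕ → Finset ℕ} {x y c d : ℕ} {C' C'' : ℕ → Finset ℕ} (hC : AllM C)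
    (h : TIns C x c C') (h' : TIns C' y d C'') (hxy : x < y) : c < d := by
  obtain ⟨N, hN, hI⟩ := h
  have hI' := tins_at h' (M := N + 1)
    (fun j hj => by rw [ins_above hI (by omega), hN j (by omega)])
  exact ins_lt_ins hI hC hxy hI'

theorem tins_le {C : ℕ → Finset ℕ} {x y c d : ℕ} {C' C'' : ℕ → Finset ℕ} (hC : AllM C)
    (h : TIns C x c C') (h' : TIns C' y d C'') (hxy : y < x) : d ≤ c := by
  obtain ⟨N, hN, hI⟩ := h
  have hN1 : ∀ j, N + 1 ≤ j → C j = ∅ := fun j hj => hN j (by omega)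
  have hI2 := (ins_up_iff (hN N le_rfl) (hN1 _ le_rfl)).2 hI
  have hI' := tins_at h' (M := N + 1)
    (fun j hj => by rw [ins_above hI (by omega), hN j (by omega)])
  exact ins_ins_le hI2 hC hxy hI'

theorem tins_dichotomy {C : ℕ → Finset ℕ} {a b ca cb c1 c2 : ℕ} {Ca Cb D1 D2 : ℕ → Finset ℕ}
    (hC : AllM C) (hab : a < b) (ha : TIns C a ca Ca) (hb : TIns C b cb Cb) (h1 : TIns Ca b c1 D1)
    (h2 : TIns Cb a c2 D2) : ca ≤ cb ∧ (ca < cb → c1 = cb ∧ c2 = ca) := by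
  obtain ⟨N, hN, hI⟩ := ha
  have hN1 : ∀ j, N + 1 ≤ j → C j = ∅ := fun j hj => hN j (by omega)
  have hIa := (ins_up_iff (hN N le_rfl) (hN1 _ le_rfl)).2 hI
  have hIb0 := tins_at hb hN
  have hIb := tins_at hb hN1
  have hI1 := tins_at h1 (M := N + 1)
    (fun j hj => by rw [ins_above hI (by omega), hN j (by omega)])
  have hI2 := tins_at h2 (M := N + 1)
    (fun j hj => by rw [ins_above hIb0 (by omega), hN j (by omega)])
  obtain ⟨q1, q2⟩ := ins_dichotomy hC hab hIa hIb
  exact ⟨q1, fun h => ⟨(q2 h).2.1 hI1, (q2 h).2.2 hI2⟩⟩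

theorem tins_keyCol {C : ℕ → Finset ℕ} {x c : ℕ} {C' : ℕ → Finset ℕ} (hC : AllM C)
    (h : TIns C x c C') : (∀ J, J ≠ c → keyCol C' J = keyCol C J) ∧
    ∃ r, r ∉ keyCol C c ∧ keyCol C' c = insert r (keyCol C c) ∧
      ∀ r' ∈ keyCol C c, r' < r → r' ∈ keyCol C (c + 1) := by
  have hT := tins_isTab h hC
  obtain ⟨N, hN, hI⟩ := h
  constructor
  · intro J hJ
    rcases Nat.lt_or_gt_of_ne hJ with h1 | h1
    · exact keyCol_ins_of_gt hI h1
    · rcases Nat.lt_or_ge N J with h2 | h2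
      · rw [keyCol_eq_empty hC (hN J h2.le),
          keyCol_eq_empty hT.1 (by rw [ins_above hI h2, hN J h2.le])]
      · exact keyCol_ins_of_lt hI hC h1 h2
  · refine keyCol_ins hI hC fun t _ => ?_
    have := mat_subset (C N) (C (N + 1))
    rw [hN N le_rfl, Finset.subset_empty] at this
    rw [hN N le_rfl, this]

theorem tins_card {C : ℕ → Finset ℕ} {x c : ℕ} {C' : ℕ → Finset ℕ} (hC : AllM C)
    (h : TIns C x c C') (j : ℕ) : (C' j).card = (C j).card + if j = c then 1 else 0 := by
  have hT := tins_isTab h hC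
  obtain ⟨h1, r, hr, h2, -⟩ := tins_keyCol hC h
  rw [← card_keyCol hC, ← card_keyCol hT.1]
  split_ifs with hj
  · rw [hj, h2, Finset.card_insert_of_notMem hr]
  · rw [h1 j hj]; rfl

theorem colw_stable {N n : ℕ} (h : N ≤ n) {C : ℕ → Finset ℕ} (hN : ∀ j, N ≤ j → C j = ∅) :
    colw n C = colw N C := by
  induction N generalizing n C with
  | zero =>
    clear h
    induction n generalizing C with
    | zero => rfl
    | succ n ih =>
      simp only [colw]
      rw [ih (fun j _ => hN _ (by omega)), hN 0 le_rfl, inc_empty]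
      rfl
  | succ N ih =>
    cases n with
    | zero => omega
    | succ n => rw [colw, colw, ih (by omega) (fun j hj => hN _ (by omega))]

theorem colw_top {N : ℕ} {C : ℕ → Finset ℕ} (x : ℕ) :
    colw (N + 1) (Function.update C N {x}) = x :: colw N C := by
  induction N generalizing C with
  | zero => simp [colw, inc_singleton]
  | succ N ih =>
    have : (fun j => Function.update C (N + 1) {x} (j + 1)) =
        Function.update (fun j => C (j + 1)) N {x} := by
      funext i
      by_cases hi : i = N
      · subst hi; simp
      · rw [Function.update_of_ne hi, Function.update_of_ne (by omega)]
    rw [colw, this, ih, Function.update_of_ne (by omega), colw]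
    rfl

/-- `C` is the tableau of the Coxeter–Knuth class of `W`. -/
structure Tab (W : List ℕ) (C : ℕ → Finset ℕ) : Prop where
  all : AllM C
  ck : ∃ n, (∀ j, n ≤ j → C j = ∅) ∧ CKEquiv W.reverse (colw n C)

theorem tab_uniq {W : List ℕ} {C D : ℕ → Finset ℕ} (hW : IsReducedWord W) (h : Tab W C)
    (h' : Tab W D) : C = D := by
  obtain ⟨hC, n, hn, h1⟩ := h
  obtain ⟨hD, m, hm, h2⟩ := h'
  rw [← colw_stable (Nat.le_max_left n m) hn] at h1
  rw [← colw_stable (Nat.le_max_right n m) hm] at h2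
  refine tab_unique (max n m) C D hC hD (fun j hj => hn j (by omega)) (fun j hj => hm j (by omega))
    ?_ (ck_trans (ck_symm h1) h2)
  exact nb_of_reduced (ck_reduced h1 (reduced_reverse hW))

theorem tab_congr {W W' : List ℕ} {C : ℕ → Finset ℕ} (h : Tab W C) (hW : CKEquiv W W') :
    Tab W' C := by
  obtain ⟨hC, n, hn, h1⟩ := h
  exact ⟨hC, n, hn, ck_trans (ck_symm (ck_reverse hW)) h1⟩

theorem tab_nil : Tab [] (fun _ => ∅) := by
  refine ⟨fun j t => ?_, 0, fun _ _ => rfl, ck_refl _⟩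
  rw [lc_eq_zero (by simp)]
  omega

theorem tab_isTab {W : List ℕ} {C : ℕ → Finset ℕ} (h : Tab W C) : IsTab C := by
  obtain ⟨hC, n, hn, -⟩ := h
  exact ⟨hC, n, hn⟩

theorem tab_snoc {W : List ℕ} {x : ℕ} {C : ℕ → Finset ℕ} (hW : IsReducedWord (W ++ [x]))
    (h : Tab W C) : ∃ c C', TIns C x c C' ∧ Tab (W ++ [x]) C' := by
  obtain ⟨hC, n, hn, h1⟩ := h
  have e1 : insert x (C n) = {x} := by rw [hn n le_rfl]; rfl
  have h2 : CKEquiv (W ++ [x]).reverse (colw (n + 1) (Function.update C n (insert x (C n)))) := by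
    rw [e1, colw_top, List.reverse_append]
    exact ck_left [x] h1
  obtain ⟨c, C', hI, h3⟩ := ins_exists (n := n + 1) n C x hC (by simp [hn n le_rfl]) (by omega)
    (ck_reduced h2 (reduced_reverse hW))
  refine ⟨c, C', ⟨n, hn, hI⟩, ins_allM hI hC, n + 1, fun j hj => ?_, ck_trans h2 h3⟩
  rw [ins_above hI (by omega), hn j (by omega)]

theorem tab_of_tins {W : List ℕ} {x c : ℕ} {C C' : ℕ → Finset ℕ} (hW : IsReducedWord (W ++ [x]))
    (h : Tab W C) (hI : TIns C x c C') : Tab (W ++ [x]) C' := by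
  obtain ⟨d, D, h1, h2⟩ := tab_snoc hW h
  rwa [(tins_unique hI h1).2]

theorem tab_exists {W : List ℕ} (hW : IsReducedWord W) : ∃ C, Tab W C := by
  induction W using List.reverseRecOn with
  | nil => exact ⟨_, tab_nil⟩
  | append_singleton W x ih =>
    obtain ⟨C, hC⟩ := ih (reduced_left hW)
    obtain ⟨c, C', -, h⟩ := tab_snoc hW hC
    exact ⟨C', h⟩

/-- Insertion of a word, with the list of columns of the new boxes. -/
inductive Cols : (ℕ → Finset ℕ) → List ℕ → List ℕ → (ℕ → Finset ℕ) → Prop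
  | nil (C) : Cols C [] [] C
  | cons {C x c C1 u cs C'} (h : TIns C x c C1) (h' : Cols C1 u cs C') :
      Cols C (x :: u) (c :: cs) C'

theorem cols_nil_inv {C cs C'} (h : Cols C [] cs C') : cs = [] ∧ C' = C := by
  cases h; exact ⟨rfl, rfl⟩

theorem cols_cons_inv {C x u cs C'} (h : Cols C (x :: u) cs C') :
    ∃ c C1 ds, TIns C x c C1 ∧ Cols C1 u ds C' ∧ cs = c :: ds := by
  cases h with
  | cons h h' => exact ⟨_, _, _, h, h', rfl⟩

theorem cols_unique {u : List ℕ} : ∀ {C cs C' ds D'}, Cols C u cs C' → Cols C u ds D' →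
    cs = ds ∧ C' = D' := by
  induction u with
  | nil =>
    intro C cs C' ds D' h h'
    obtain ⟨rfl, rfl⟩ := cols_nil_inv h
    obtain ⟨rfl, rfl⟩ := cols_nil_inv h'
    exact ⟨rfl, rfl⟩
  | cons x u ih =>
    intro C cs C' ds D' h h'
    obtain ⟨c, C1, cs, h1, h2, rfl⟩ := cols_cons_inv h
    obtain ⟨d, D1, ds, h1', h2', rfl⟩ := cols_cons_inv h'
    obtain ⟨rfl, rfl⟩ := tins_unique h1 h1'
    obtain ⟨rfl, rfl⟩ := ih h2 h2'
    exact ⟨rfl, rfl⟩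

theorem cols_exists {u : List ℕ} : ∀ {W C}, Tab W C → IsReducedWord (W ++ u) →
    ∃ cs C', Cols C u cs C' ∧ Tab (W ++ u) C' := by
  induction u with
  | nil => intro W C h _; exact ⟨[], C, .nil C, by simpa using h⟩
  | cons x u ih =>
    intro W C h hW
    rw [List.append_cons] at hW ⊢
    obtain ⟨c, C1, h1, h2⟩ := tab_snoc (reduced_left hW) h
    obtain ⟨cs, C', h3, h4⟩ := ih h2 hW
    exact ⟨_, _, .cons h1 h3, h4⟩

theorem tab_of_cols {u W : List ℕ} {C cs C'} (hW : IsReducedWord (W ++ u)) (h : Tab W C)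
    (hI : Cols C u cs C') : Tab (W ++ u) C' := by
  obtain ⟨ds, D, h1, h2⟩ := cols_exists h hW
  rwa [(cols_unique hI h1).2]

theorem cols_append {u v : List ℕ} : ∀ {C cs C1 ds C2}, Cols C u cs C1 → Cols C1 v ds C2 →
    Cols C (u ++ v) (cs ++ ds) C2 := by
  induction u with
  | nil =>
    intro C cs C1 ds C2 h h'
    obtain ⟨rfl, rfl⟩ := cols_nil_inv h
    exact h'
  | cons x u ih =>
    intro C cs C1 ds C2 h h'
    obtain ⟨c, C3, cs, h1, h2, rfl⟩ := cols_cons_inv h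
    exact .cons h1 (ih h2 h')

theorem cols_card {u : List ℕ} : ∀ {C cs C'}, AllM C → Cols C u cs C' → ∀ j,
    (C' j).card = (C j).card + cs.count j := by
  induction u with
  | nil =>
    intro C cs C' _ h j
    obtain ⟨rfl, rfl⟩ := cols_nil_inv h
    simp
  | cons x u ih =>
    intro C cs C' hC h j
    obtain ⟨c, C1, cs, h1, h2, rfl⟩ := cols_cons_inv h
    rw [ih (tins_isTab h1 hC).1 h2, tins_card hC h1, List.count_cons]
    simp only [beq_iff_eq]
    split_ifs <;> omega

theorem cols_allM {u : List ℕ} : ∀ {C cs C'}, AllM C → Cols C u cs C' → AllM C' := by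
  induction u with
  | nil =>
    intro C cs C' hC h
    obtain ⟨rfl, rfl⟩ := cols_nil_inv h
    exact hC
  | cons x u ih =>
    intro C cs C' hC h
    obtain ⟨c, C1, cs, h1, h2, rfl⟩ := cols_cons_inv h
    exact ih (tins_isTab h1 hC).1 h2

/-- An increasing word is inserted in increasing columns. -/
theorem cols_pairwise {u : List ℕ} : ∀ {C cs C'}, AllM C → Cols C u cs C' →
    u.Pairwise (· < ·) → cs.Pairwise (· < ·) := by
  induction u with
  | nil =>
    intro C cs C' hC h _
    obtain ⟨rfl, rfl⟩ := cols_nil_inv h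
    exact .nil
  | cons x u ih =>
    intro C cs C' hC h hu
    obtain ⟨c, C1, cs, h1, h2, rfl⟩ := cols_cons_inv h
    have hC1 := (tins_isTab h1 hC).1
    have hcs := ih hC1 h2 (List.pairwise_cons.1 hu).2
    cases u with
    | nil =>
      obtain ⟨rfl, rfl⟩ := cols_nil_inv h2
      simp
    | cons y u =>
      obtain ⟨d, C2, ds, h3, h4, rfl⟩ := cols_cons_inv h2
      have hcd := tins_lt hC h1 h3 ((List.pairwise_cons.1 hu).1 y (by simp))
      rw [List.pairwise_cons]
      refine ⟨fun z hz => ?_, hcs⟩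
      rcases List.mem_cons.1 hz with rfl | hz
      · exact hcd
      · exact hcd.trans ((List.pairwise_cons.1 hcs).1 z hz)


/-! ### Longest increasing subsequences of column words -/

/-- Update of `H t`, the length of the longest increasing subsequence with letters `< t`, when
the letter `c` is appended. -/
def lisStep (H : ℕ → ℕ) (c : ℕ) : ℕ → ℕ := fun t => if c < t then max (H t) (H c + 1) else H t

/-- Update of the longest increasing subsequence lengths when a word is appended. -/
def lis (H : ℕ → ℕ) (cs : List ℕ) : ℕ → ℕ := cs.foldl lisStep H

theorem lis_append (H : ℕ → ℕ) (a b : List ℕ) : lis H (a ++ b) = lis (lis H a) b :=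
  List.foldl_append

theorem lisStep_mono {H : ℕ → ℕ} (hH : Monotone H) (c : ℕ) : Monotone (lisStep H c) := by
  intro s t hst
  have h1 := hH hst
  simp only [lisStep]
  split_ifs with h2 h3
  · omega
  · omega
  · omega
  · exact h1

theorem lis_mono (cs : List ℕ) : ∀ {H : ℕ → ℕ}, Monotone H → Monotone (lis H cs) := by
  induction cs with
  | nil => exact fun h => h
  | cons c cs ih => exact fun h => ih (lisStep_mono h c)

theorem lis_knuth_one {H : ℕ → ℕ} (hH : Monotone H) {p q r : ℕ} (h1 : q ≤ p) (h2 : p < r) :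
    lis H [p, q, r] = lis H [p, r, q] := by
  funext t
  have h3 := hH h1
  simp only [lis, List.foldl_cons, List.foldl_nil, lisStep]
  split_ifs <;> omega

theorem lis_knuth_two {H : ℕ → ℕ} (hH : Monotone H) {p q r : ℕ} (h1 : q < r) (h2 : r ≤ p) :
    lis H [p, q, r] = lis H [q, p, r] := by
  funext t
  have h3 := hH h1.le
  have h4 := hH h2
  simp only [lis, List.foldl_cons, List.foldl_nil, lisStep]
  split_ifs <;> omega

theorem cols_append_inv {u v : List ℕ} : ∀ {C cs C2}, Cols C (u ++ v) cs C2 →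
    ∃ as C1 bs, Cols C u as C1 ∧ Cols C1 v bs C2 ∧ cs = as ++ bs := by
  induction u with
  | nil => intro C cs C2 h; exact ⟨[], C, cs, .nil C, h, rfl⟩
  | cons x u ih =>
    intro C cs C2 h
    obtain ⟨c, C1, ds, h1, h2, rfl⟩ := cols_cons_inv h
    obtain ⟨as, C3, bs, h3, h4, rfl⟩ := ih h2
    exact ⟨_, _, _, .cons h1 h3, h4, rfl⟩

theorem cols_three_inv {x y z : ℕ} {C cs C'} (h : Cols C [x, y, z] cs C') :
    ∃ p q r C1 C2, TIns C x p C1 ∧ TIns C1 y q C2 ∧ TIns C2 z r C' ∧ cs = [p, q, r] := by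
  obtain ⟨p, C1, _, h1, g1, rfl⟩ := cols_cons_inv h
  obtain ⟨q, C2, _, h2, g2, rfl⟩ := cols_cons_inv g1
  obtain ⟨r, C3, _, h3, g3, rfl⟩ := cols_cons_inv g2
  obtain ⟨rfl, rfl⟩ := cols_nil_inv g3
  exact ⟨p, q, r, C1, C2, h1, h2, h3, rfl⟩

theorem cols_perm {u v : List ℕ} {C cs ds D} (hC : AllM C) (h : Cols C u cs D)
    (h' : Cols C v ds D) : cs.Perm ds := by
  rw [List.perm_iff_count]
  intro j
  have h1 := cols_card hC h j
  have h2 := cols_card hC h' j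
  omega

theorem pair_eq_of_perm {a b c d : ℕ} (h : [a, b].Perm [c, d]) :
    (a = c ∧ b = d) ∨ (a = d ∧ b = c) := by
  have h1 := h.mem_iff (a := a)
  have h2 := h.sum_eq
  simp at h1 h2
  omega

theorem lis_ck_one {C D : ℕ → Finset ℕ} (hC : AllM C) {x y z : ℕ} (hyx : y < x) (hxz : x < z)
    {cs ds} (h : Cols C [x, y, z] cs D) (h' : Cols C [x, z, y] ds D) {H : ℕ → ℕ}
    (hH : Monotone H) : lis H cs = lis H ds := by
  have hP := cols_perm hC h h'
  obtain ⟨p, q, r, C1, C2, h1, h2, h3, rfl⟩ := cols_three_inv h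
  obtain ⟨p', r', q', D1, D2, g1, g2, g3, rfl⟩ := cols_three_inv h'
  obtain ⟨rfl, rfl⟩ := tins_unique h1 g1
  have a1 := tins_le hC h1 h2 hyx
  have a2 := tins_lt hC g1 g2 hxz
  rcases pair_eq_of_perm ((List.perm_cons p).1 hP) with ⟨e1, e2⟩ | ⟨e1, e2⟩
  · omega
  · subst e1 e2
    exact lis_knuth_one hH a1 a2

theorem lis_ck_two {C D : ℕ → Finset ℕ} (hC : AllM C) {a b u v : ℕ} (hab : a < b) (hau : a < u)
    (hvb : v < b) {cs ds} (h : Cols C [b, a, u] cs D) (h' : Cols C [a, b, v] ds D) {H : ℕ → ℕ}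
    (hH : Monotone H) : lis H cs = lis H ds := by
  have hP := cols_perm hC h h'
  obtain ⟨p, q, r, C1, C2, h1, h2, h3, rfl⟩ := cols_three_inv h
  obtain ⟨q', p', r', D1, D2, g1, g2, g3, rfl⟩ := cols_three_inv h'
  have hC1 := (tins_isTab h1 hC).1
  have hD1 := (tins_isTab g1 hC).1
  have a1 := tins_le hC h1 h2 hab
  have a2 := tins_lt hC1 h2 h3 hau
  have a3 := tins_lt hC g1 g2 hab
  have a4 := tins_le hD1 g2 g3 hvb
  obtain ⟨a5, a6⟩ := tins_dichotomy hC hab g1 h1 g2 h2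
  rcases a5.lt_or_eq with a7 | rfl
  · obtain ⟨rfl, rfl⟩ := a6 a7
    have hP' : [p', q, r].Perm [p', q, r'] := hP.trans (List.Perm.swap _ _ _)
    have e : r = r' := by
      have := hP'.sum_eq
      simpa using this
    subst e
    exact lis_knuth_two hH a2 a4
  · rcases pair_eq_of_perm ((List.perm_cons q').1 hP) with ⟨e1, e2⟩ | ⟨e1, e2⟩
    · omega
    · subst e1 e2
      exact lis_knuth_one hH a1 a3

theorem lis_ck_step {u u' W : List ℕ} (huu : CKStep u u') {C D D' : ℕ → Finset ℕ} {cs cs'}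
    (hT : Tab W C) (hW : IsReducedWord (W ++ u)) (h : Cols C u cs D) (h' : Cols C u' cs' D')
    {H : ℕ → ℕ} (hH : Monotone H) : lis H cs = lis H cs' := by
  have key : ∀ (a b t t' : List ℕ), u = a ++ t ++ b → u' = a ++ t' ++ b → CKEquiv t t' →
      (∀ C D ds ds', AllM C → Cols C t ds D → Cols C t' ds' D → ∀ {H : ℕ → ℕ}, Monotone H →
        lis H ds = lis H ds') → lis H cs = lis H cs' := by
    intro a b t t' e e' htt hloc
    subst e e'
    obtain ⟨l1, C1, m1, h1, h2, rfl⟩ := cols_append_inv h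
    obtain ⟨l2, C2, m2, h3, h4, rfl⟩ := cols_append_inv h1
    obtain ⟨l3, C3, m3, h5, h6, rfl⟩ := cols_append_inv h'
    obtain ⟨l4, C4, m4, h7, h8, rfl⟩ := cols_append_inv h5
    obtain ⟨rfl, rfl⟩ := cols_unique h3 h7
    have r1 : IsReducedWord (W ++ (a ++ t)) := by
      rw [← List.append_assoc W] at hW
      exact reduced_left hW
    have r2 : IsReducedWord (W ++ (a ++ t')) := by
      refine ck_reduced (ck_left W (ck_left a htt)) r1
    have t1 := tab_of_cols r1 hT h1
    have t2 := tab_congr (tab_of_cols r2 hT h5) (ck_symm (ck_left W (ck_left a htt)))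
    obtain rfl := tab_uniq r1 t1 t2
    obtain ⟨rfl, rfl⟩ := cols_unique h2 h6
    rw [lis_append, lis_append, lis_append, lis_append,
      hloc _ _ _ _ (cols_allM hT.all h3) h4 h8 (lis_mono _ hH)]
  rcases huu with ⟨a, b, x, y, z, hyx, hxz, e, e'⟩ | ⟨a, b, x, y, z, hyz, hzx, e, e'⟩ |
    ⟨a, b, i, e, e'⟩
  · exact key a b _ _ e e' (ck_one hyx hxz) fun C D ds ds' hC g g' H hH =>
      lis_ck_one hC hyx hxz g g' hH
  · exact key a b _ _ e e' (ck_two hyz hzx) fun C D ds ds' hC g g' H hH =>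
      lis_ck_two hC (hyz.trans hzx) hyz hzx g g' hH
  · exact key a b _ _ e e' (ck_three i) fun C D ds ds' hC g g' H hH =>
      (lis_ck_two hC (Nat.lt_succ_self i) (Nat.lt_succ_self i) (Nat.lt_succ_self i) g' g hH).symm

/-- Longest increasing subsequences of column words are Coxeter–Knuth invariant. -/
theorem lis_ck {u u' W : List ℕ} (huu : CKEquiv u u') {C D D' : ℕ → Finset ℕ} {cs cs'}
    (hT : Tab W C) (hW : IsReducedWord (W ++ u)) (h : Cols C u cs D) (h' : Cols C u' cs' D')
    {H : ℕ → ℕ} (hH : Monotone H) : lis H cs = lis H cs' := by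
  induction huu generalizing cs cs' D D' with
  | rel u u' huu => exact lis_ck_step huu hT hW h h' hH
  | refl u =>
    obtain ⟨rfl, -⟩ := cols_unique h h'
    rfl
  | symm u u' huu ih =>
    exact (ih (ck_reduced (ck_left W (ck_symm huu)) hW) h' h).symm
  | trans u v u' h1 h2 ih1 ih2 =>
    have hv := ck_reduced (ck_left W h1) hW
    obtain ⟨ds, E, h3, -⟩ := cols_exists hT hv
    exact (ih1 hW h h3).trans (ih2 hv h3 h')


/-! ### Reverse insertion -/

theorem lc_compl {S : Finset ℕ} {N t : ℕ} (hN : ∀ x ∈ S, x ≤ N) :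
    lc (S.image (N - ·)) t + lc S (N + 1 - t) = S.card := by
  have hc : (S.image (N - ·)).card = S.card := by
    refine Finset.card_image_of_injOn fun x hx y hy hxy => ?_
    have h1 := hN x hx
    have h2 := hN y hy
    have h3 : N - x = N - y := hxy
    omega
  by_cases ht : t ≤ N
  · have h1 := lc_add_gc (S.image (N - ·)) t
    rw [gc_compl hN ht, hc, show N - t + 1 = N + 1 - t by omega] at h1
    exact h1
  · rw [show N + 1 - t = 0 by omega, lc_zero, lc_of_ge, hc]
    · rfl
    · intro x hx
      simp only [Finset.mem_image] at hx
      omega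

/-- `block_exchange` where only the target is known to be reduced. -/
theorem block_exchange_symm {K C : Finset ℕ} {p q : ℕ} (hpq : p ≤ q) (hp : p ∉ K)
    (hK : ∀ y, p < y → y ≤ q → y ∈ K) (hC : ∀ y, p ≤ y → y < q → y ∈ C) (hq : q ∉ C)
    (h1 : ∀ t, t < p → lc C p + lc K (t + 1) ≤ lc K p + lc C t)
    (h2 : ∀ t, q < t → lc K (t + 1) + lc C (q + 1) ≤ lc C t + lc K (q + 1))
    (hnb : NB (inc K ++ inc (insert q C))) :
    CKEquiv (inc (insert p K) ++ inc C) (inc K ++ inc (insert q C)) := by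
  obtain ⟨N, hN⟩ : ∃ N, ∀ x ∈ insert p K ∪ insert q C, x ≤ N :=
    ⟨(insert p K ∪ insert q C).sup id, fun x hx => Finset.le_sup (f := id) hx⟩
  have nK : ∀ x ∈ K, x ≤ N := fun x hx => hN x (by simp [hx])
  have nC : ∀ x ∈ C, x ≤ N := fun x hx => hN x (by simp [hx])
  have npK : ∀ x ∈ insert p K, x ≤ N := fun x hx => hN x (by simp only [Finset.mem_union]; tauto)
  have nqC : ∀ x ∈ insert q C, x ≤ N := fun x hx => hN x (by simp only [Finset.mem_union]; tauto)
  have np : p ≤ N := npK p (by simp)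
  have nq : q ≤ N := nqC q (by simp)
  have mem : ∀ (S : Finset ℕ), (∀ x ∈ S, x ≤ N) → ∀ y, y ≤ N → (y ∈ S.image (N - ·) ↔ N - y ∈ S) := by
    intro S hS y hy
    simp only [Finset.mem_image]
    constructor
    · rintro ⟨x, hx, rfl⟩
      have := hS x hx
      rwa [show N - (N - x) = x by omega]
    · exact fun h => ⟨_, h, by omega⟩
  have lK := fun t => lc_compl (t := t) nK
  have lC := fun t => lc_compl (t := t) nC
  have w1 : ∀ x ∈ inc K ++ inc (insert q C), x ≤ N := by
    intro x hx
    rw [List.mem_append, mem_inc, mem_inc] at hx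
    exact hx.elim (nK x) (nqC x)
  have e1 : inc (insert (N - q) (C.image (N - ·))) ++ inc (K.image (N - ·)) =
      ((inc K ++ inc (insert q C)).map (N - ·)).reverse := by
    rw [← Finset.image_insert (N - ·), inc_compl nK, inc_compl nqC]
    simp
  have key := block_exchange (K := C.image (N - ·)) (C := K.image (N - ·)) (p := N - q) (q := N - p)
    (by omega) ?_ ?_ ?_ ?_ ?_ ?_ ?_
  · rw [e1, ← Finset.image_insert (N - ·), inc_compl nC, inc_compl npK] at key
    have w2 := ck_compl (N := N) (fun x hx => by
      simp only [List.mem_reverse, List.mem_map] at hx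
      omega) (ck_reverse key)
    rw [List.reverse_reverse, map_compl_compl w1] at w2
    refine ck_trans (ck_of_eq ?_) (ck_symm w2)
    have : inc (insert p K) ++ inc C = ((inc (insert p K) ++ inc C).map (N - ·)).map (N - ·) := by
      rw [map_compl_compl]
      intro x hx
      rw [List.mem_append, mem_inc, mem_inc] at hx
      exact hx.elim (npK x) (nC x)
    rw [this]
    simp
  · rw [mem C nC _ (by omega), show N - (N - q) = q by omega]
    exact hq
  · intro y a b
    rw [mem C nC _ (by omega)]
    exact hC _ (by omega) (by omega)
  · intro y a b
    rw [mem K nK _ (by omega)]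
    exact hK _ (by omega) (by omega)
  · rw [mem K nK _ (by omega), show N - (N - p) = p by omega]
    exact hp
  · intro t ht
    have a := h2 (N - t) (by omega)
    have b1 := lK (N - q)
    have b2 := lK t
    have b3 := lC (N - q)
    have b4 := lC (t + 1)
    rw [show N + 1 - (N - q) = q + 1 by omega] at b1 b3
    rw [show N + 1 - t = N - t + 1 by omega] at b2
    rw [show N + 1 - (t + 1) = N - t by omega] at b4
    omega
  · intro t ht
    have b1 := lC (t + 1)
    have b2 := lK (N - p + 1)
    have b3 := lK t
    have b4 := lC (N - p + 1)
    rw [show N + 1 - (N - p + 1) = p by omega] at b2 b4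
    by_cases hp0 : p = 0
    · have z1 : lc K p = 0 := by rw [hp0, lc_zero]
      have z2 : lc C p = 0 := by rw [hp0, lc_zero]
      rw [show N + 1 - t = 0 by omega, lc_zero] at b3
      rw [show N + 1 - (t + 1) = 0 by omega, lc_zero] at b1
      omega
    · have a := h1 (N - t) (by omega)
      rw [show N + 1 - (t + 1) = N - t by omega] at b1
      by_cases htN : t ≤ N
      · rw [show N + 1 - t = N - t + 1 by omega] at b3
        omega
      · rw [show N + 1 - t = 0 by omega, lc_zero] at b3
        rw [show N - t = 0 by omega, lc_zero] at a
        rw [show N - t = 0 by omega, lc_zero] at b1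
        omega
  · rw [e1]
    exact nb_reverse (nb_compl w1 hnb)

/-- The inverse of a bumping step between two adjacent columns. -/
theorem fail_reverse {C D : Finset ℕ} {y : ℕ} (hm : Matched C D) (hy : y ∉ C)
    (heq : lc C y = lc D (y + 1)) (hred : IsReducedWord (inc D ++ inc (insert y C))) :
    ∃ e, e ∉ D ∧ Fail C (insert e D) e y ∧
      CKEquiv (inc (insert e D) ++ inc C) (inc D ++ inc (insert y C)) := by
  have hnxt : y + 1 ∉ D := by
    intro h
    have h1 := hm (y + 1)
    have h2 := lc_succ C y
    have h3 := lc_succ D (y + 1)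
    rw [if_neg hy] at h2
    rw [if_pos h] at h3
    omega
  obtain ⟨e, hey, heD, hrun⟩ : ∃ e, e ≤ y ∧ e ∉ D ∧ ∀ z, e < z → z ≤ y → z ∈ D := by
    have hex : ∃ s, y - s ∉ D := ⟨y, by
      rw [Nat.sub_self]
      intro h
      have := hred.1 0 (by simp [mem_inc, h])
      omega⟩
    refine ⟨y - Nat.find hex, by omega, Nat.find_spec hex, fun z h1 h2 => ?_⟩
    have := Nat.find_min hex (m := y - z) (by omega)
    rwa [show y - (y - z) = z by omega, not_not] at this
  have hcov : ∀ z, e ≤ z → z < y → z ∈ C := by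
    have key : ∀ k, ∀ z, e ≤ z → z + k = y → ∀ z', z ≤ z' → z' ≤ y → z' ∈ insert y C := by
      intro k
      induction k with
      | zero =>
        intro z h1 h2 z' h3 h4
        obtain rfl : z' = y := by omega
        simp
      | succ k ih =>
        intro z h1 h2 z' h3 h4
        have hh := ih (z + 1) (by omega) (by omega)
        rcases Nat.eq_or_lt_of_le h3 with rfl | h5
        · have := run_left (K := D) (C := insert y C) (q := z + 1) (s := k)
            (fun w a b => hrun w (by omega) (by omega))
            (by rwa [show z + 1 + k + 1 = y + 1 by omega])
            (fun w a b => hh w (by omega) (by omega)) (by omega) hred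
          simpa using this
        · exact hh z' (by omega) h4
    intro z h1 h2
    have := key (y - z) z h1 (by omega) z le_rfl (by omega)
    rcases Finset.mem_insert.1 this with h | h
    · omega
    · exact h
  have hc1 := lc_run_le hey hcov
  have hc2 := lc_run_le (S := D) (p := e + 1) (q := y + 1) (by omega)
    (fun z a b => hrun z (by omega) (by omega))
  have hc3 := lc_succ D e
  rw [if_neg heD] at hc3
  have hk := fun t => lc_insert heD t
  have hF : Fail C (insert e D) e y := by
    refine ⟨hey, fun t ht => ?_, ?_, fun z a b => ?_, ?_, hcov, hy⟩
    · rw [hk, if_neg (by omega)]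
      exact hm t
    · rw [hk, if_neg (by omega)]
      omega
    · rcases Nat.eq_or_lt_of_le a with rfl | h
      · simp
      · exact Finset.mem_insert_of_mem (hrun z h b)
    · rw [Finset.mem_insert]
      rintro (h | h)
      · omega
      · exact hnxt h
  refine ⟨e, heD, hF, block_exchange_symm hey heD hrun hcov hy ?_ ?_ (nb_of_reduced hred)⟩
  · intro t ht
    have := hm t
    omega
  · intro t ht
    have h1 := hm t
    have h2 := lc_succ C y
    rw [if_neg hy] at h2
    omega

/-- The last letter of `K` that can be removed so that `K` still matches `D`. -/
theorem remove_exists {K D : Finset ℕ} (hm : Matched K D) (hc : D.card < K.card) :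
    ∃ x ∈ K, Matched (K.erase x) D ∧ lc (K.erase x) x = lc D (x + 1) ∧
      ∀ t, x < t → lc D (t + 1) < lc K t := by
  obtain ⟨M, hM⟩ : ∃ M, ∀ z ∈ K ∪ D, z < M :=
    ⟨(K ∪ D).sup id + 1, fun z hz => Nat.lt_succ_of_le (Finset.le_sup (f := id) hz)⟩
  have hbig : ∀ t, M ≤ t → lc D (t + 1) < lc K t := by
    intro t ht
    rw [lc_of_ge (S := K) fun z hz => (hM z (by simp [hz])).trans_le ht]
    exact (lc_le_card D _).trans_lt hc
  have hex : ∃ x, ∀ t, x < t → lc D (t + 1) < lc K t := ⟨M, fun t ht => hbig t ht.le⟩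
  have hspec := Nat.find_spec hex
  have heq : lc K (Nat.find hex) = lc D (Nat.find hex + 1) := by
    have h1 := hm (Nat.find hex)
    by_contra hne
    rcases Nat.eq_zero_or_pos (Nat.find hex) with h0 | h0
    · rw [h0, lc_zero] at hne h1
      omega
    · have := Nat.find_min hex (m := Nat.find hex - 1) (by omega)
      refine this fun t ht => ?_
      rcases Nat.eq_or_lt_of_le (show Nat.find hex ≤ t by omega) with h2 | h2
      · rw [← h2]; omega
      · exact hspec t h2
  set x := Nat.find hex
  have hx : x ∈ K := by
    by_contra hx
    have h1 := hspec (x + 1) (by omega)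
    have h2 := lc_succ K x
    have h3 := lc_mono D (show x + 1 ≤ x + 1 + 1 by omega)
    rw [if_neg hx] at h2
    omega
  have hl := fun t => lc_erase hx t
  refine ⟨x, hx, fun t => ?_, ?_, hspec⟩
  · have h1 := hl t
    have h2 := hm t
    split_ifs at h1 with h
    · have := hspec t h
      omega
    · omega
  · have h1 := hl x
    rw [if_neg (by omega)] at h1
    omega


theorem ins_reverse {C' : ℕ → Finset ℕ} {c n : ℕ} (hC : AllM C')
    (hc : (C' (c + 1)).card < (C' c).card) (hred : IsReducedWord (colw n C')) {j : ℕ} (hcj : c ≤ j)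
    (hj : j < n) : ∃ C y, AllM C ∧ y ∉ C j ∧ Ins C j y c C' ∧
      CKEquiv (colw n (Function.update C j (insert y (C j)))) (colw n C') ∧
      lc (C j) y = lc (C (j + 1)) (y + 1) ∧ (c < j → (C j).card = (C' j).card) := by
  induction j, hcj using Nat.le_induction with
  | base =>
    obtain ⟨y, hy, hm, heq, -⟩ := remove_exists (hC c) hc
    have e1 : (Function.update C' c ((C' c).erase y)) c = (C' c).erase y := Function.update_self ..
    have e2 : (Function.update C' c ((C' c).erase y)) (c + 1) = C' (c + 1) :=
      Function.update_of_ne (by omega) _ _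
    have e3 : Function.update (Function.update C' c ((C' c).erase y)) c
        (insert y ((Function.update C' c ((C' c).erase y)) c)) = C' := by
      rw [e1, Function.update_idem, Finset.insert_erase hy, Function.update_eq_self]
    refine ⟨Function.update C' c ((C' c).erase y), y, allM_update hC (fun i hi => ?_) hm, ?_, ?_, ?_,
      ?_, fun h => absurd h (lt_irrefl _)⟩
    · have := hC i
      rw [hi] at this
      exact matched_subset this (Finset.erase_subset _ _)
    · rw [e1]; simp
    · have key : Ins (Function.update C' c ((C' c).erase y)) c y c
        (Function.update (Function.update C' c ((C' c).erase y)) c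
        (insert y ((Function.update C' c ((C' c).erase y)) c))) := by
        cases c with
        | zero => exact .zero (by rw [e1]; simp)
        | succ c =>
          refine .land (by rw [e1]; simp) ?_
          rw [e1, Finset.insert_erase hy, Function.update_of_ne (by omega)]
          exact hC c
      rwa [e3] at key
    · rw [e3]
      exact ck_refl _
    · rw [e1, e2, heq]
  | succ j hcj ih =>
    obtain ⟨C, y, hM, hy, hI, hck, heq, hcard⟩ := ih (by omega)
    obtain ⟨A, B, hAB⟩ := colw_update_two hj C
    have e0 : Function.update C (j + 1) (C (j + 1)) = C := Function.update_eq_self _ _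
    have w1 := hAB (C (j + 1)) (insert y (C j))
    rw [e0] at w1
    have hred1 := ck_reduced (ck_symm hck) hred
    rw [w1] at hred1
    obtain ⟨e, heD, hF, hck2⟩ := fail_reverse (hM j) hy heq (reduced_factor hred1)
    have hmK : Matched (insert e (C (j + 1))) (C (j + 1 + 1)) :=
      matched_superset (hM (j + 1)) (Finset.subset_insert _ _)
    have hcd : (C (j + 1 + 1)).card < (insert e (C (j + 1))).card := by
      rw [Finset.card_insert_of_notMem heD, ins_above hI (show j < j + 1 + 1 by omega) |>.symm,
        ins_above hI (show j < j + 1 by omega) |>.symm, ← card_keyCol hC, ← card_keyCol hC]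
      exact Nat.lt_succ_of_le (Finset.card_le_card (keyCol_succ_subset hC _))
    obtain ⟨x, hx, hmx, hxeq, -⟩ := remove_exists hmK hcd
    have hl := fun t => lc_erase hx t
    have hk := fun t => lc_insert heD t
    have hxe : x ≤ e := by
      by_contra hlt
      have h1 := hM (j + 1) x
      have h2 := hl x
      have h3 := hk x
      rw [if_neg (by omega)] at h2
      rw [if_pos (by omega)] at h3
      omega
    set K := insert e (C (j + 1)) with hKdef
    have hKe : K.erase e = C (j + 1) := Finset.erase_insert heD
    have e1 : (Function.update C (j + 1) (K.erase x)) (j + 1) = K.erase x := Function.update_self ..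
    have e2 : insert x (K.erase x) = K := Finset.insert_erase hx
    have e3 : (Function.update C (j + 1) (K.erase x)) j = C j :=
      Function.update_of_ne (by omega) _ _
    refine ⟨Function.update C (j + 1) (K.erase x), x, allM_update hM (fun i hi => ?_) hmx, ?_, ?_,
      ?_, ?_, fun _ => ?_⟩
    · obtain rfl : i = j := by omega
      intro t
      have h1 := hl (t + 1)
      have h2 := hk (t + 1)
      have h3 := hM i t
      rcases Nat.lt_or_ge t e with h | h
      · have h4 := hF.no t h
        omega
      · rw [if_pos (by omega)] at h1 h2
        omega
    · rw [e1]; simp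
    · refine .step (e := e) (h := y) (by rw [e1]; simp) (by rwa [e1, e2, e3]) ?_
      rwa [e1, e2, Function.update_idem, hKe, e0]
    · rw [e1, e2, Function.update_idem]
      refine ck_trans ?_ hck
      have w2 := hAB K (C j)
      rw [show Function.update (Function.update C (j + 1) K) j (C j) =
        Function.update C (j + 1) K by
          rw [Function.update_eq_self_iff, Function.update_of_ne (by omega)]] at w2
      rw [w1, w2]
      exact ck_ctx A B hck2
    · rw [e1, Function.update_of_ne (by omega), hxeq]
    · rw [e1, Finset.card_erase_of_mem hx, hKdef, Finset.card_insert_of_notMem heD,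
        ins_above hI (show j < j + 1 by omega), Nat.add_sub_cancel]

/-- Every column that is longer than the next one is the place of the last insertion for some
word of the class. -/
theorem tab_unsnoc {W : List ℕ} (hW : IsReducedWord W) {C' : ℕ → Finset ℕ} (hT : Tab W C') {c : ℕ}
    (hc : (C' (c + 1)).card < (C' c).card) : ∃ W' y C, CKEquiv W (W' ++ [y]) ∧ Tab W' C ∧
      TIns C y c C' := by
  obtain ⟨hC, n, hn, hck⟩ := hT
  have hcn : c < n := by
    by_contra h
    rw [hn c (by omega)] at hc
    simp at hc
  rw [← colw_stable (show n ≤ n + 1 by omega) hn] at hck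
  obtain ⟨C, y, hM, hy, hI, hck2, -, hcard⟩ := ins_reverse hC hc
    (ck_reduced hck (reduced_reverse hW)) hcn.le (show n < n + 1 by omega)
  have hCn : ∀ j, n ≤ j → C j = ∅ := by
    intro j hj
    rcases Nat.eq_or_lt_of_le hj with rfl | hj
    · rw [← Finset.card_eq_zero, hcard hcn, hn _ le_rfl]
      rfl
    · rw [← ins_above hI hj, hn j hj.le]
  have e : insert y (C n) = {y} := by
    rw [hCn n le_rfl]
    rfl
  rw [e, colw_top] at hck2
  refine ⟨(colw n C).reverse, y, C, ?_, ⟨hM, n, hCn, ?_⟩, n, hCn, hI⟩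
  · have := ck_reverse (ck_trans hck (ck_symm hck2))
    simpa using this
  · rw [List.reverse_reverse]
    exact ck_refl _


theorem runFact_flatten (u : List ℕ) : (runFact u).flatten = u := by
  induction u with
  | nil => rfl
  | cons a u ih =>
    rw [runFact]
    split
    · rename_i h
      rw [h] at ih
      simp at ih
      simp [ih]
    · rename_i r rs h
      rw [h] at ih
      split_ifs <;> simp [← ih]

theorem runFact_ne (u : List ℕ) : ∀ b ∈ runFact u, b ≠ [] := by
  induction u with
  | nil => simp [runFact]
  | cons a u ih =>
    rw [runFact]
    split
    · simp
    · rename_i r rs h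
      rw [h] at ih
      intro b hb
      split_ifs at hb <;> simp only [List.mem_cons] at hb ih <;> grind

theorem runFact_pairwise (u : List ℕ) : ∀ b ∈ runFact u, b.Pairwise (· < ·) := by
  induction u with
  | nil => simp [runFact]
  | cons a u ih =>
    have hne := runFact_ne u
    rw [runFact]
    split
    · simp
    · rename_i r rs h
      rw [h] at ih hne
      intro b hb
      split_ifs at hb with hlt
      · rcases List.mem_cons.1 hb with rfl | hb
        · have h1 := ih r (by simp)
          have h2 := hne r (by simp)
          cases r with
          | nil => simp at h2
          | cons y r =>
            simp only [List.headI_cons] at hlt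
            rw [List.pairwise_cons] at h1 ⊢
            refine ⟨fun z hz => ?_, List.pairwise_cons.2 h1⟩
            rcases List.mem_cons.1 hz with rfl | hz
            · exact hlt
            · have := h1.1 z hz
              omega
        · exact ih b (by simp [hb])
      · rcases List.mem_cons.1 hb with rfl | hb
        · simp
        · exact ih b hb

theorem headI_le {b : List ℕ} (hb : b.Pairwise (· < ·)) {x : ℕ} (hx : x ∈ b) : b.headI ≤ x := by
  cases b with
  | nil => simp at hx
  | cons y b =>
    rcases List.mem_cons.1 hx with rfl | hx
    · exact le_rfl
    · exact (List.rel_of_pairwise_cons hb hx).le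

theorem runFact_append {b u : List ℕ} (hb : b ≠ []) (hp : b.Pairwise (· < ·))
    (h : ∀ r ∈ runFact u, r.headI ≤ b.headI) : runFact (b ++ u) = b :: runFact u := by
  have key : ∀ m, (∀ r ∈ runFact u, r.headI ≤ m) → (∀ x ∈ b, m ≤ x) →
      runFact (b ++ u) = b :: runFact u := by
    intro m hm hbm
    clear h
    induction b with
    | nil => exact absurd rfl hb
    | cons x b ih =>
      rw [List.cons_append, runFact]
      cases b with
      | nil =>
        rw [List.nil_append]
        have hx := hbm x (by simp)
        split
        · rename_i h
          rw [h]
        · rename_i r rs h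
          rw [h] at hm ⊢
          have := hm r (by simp)
          rw [if_neg (by omega)]
      | cons y b =>
        rw [ih (by simp) hp.of_cons (fun x hx => hbm x (by simp [hx]))]
        exact if_pos (List.rel_of_pairwise_cons hp (List.mem_cons_self ..))
  exact key b.headI h fun x hx => headI_le hp hx

theorem runFact_blocks {bs : List (List ℕ)} (h1 : ∀ b ∈ bs, b ≠ [] ∧ b.Pairwise (· < ·))
    (h2 : bs.Pairwise (fun b b' => b'.headI < b.headI)) : runFact bs.flatten = bs := by
  induction bs with
  | nil => rfl
  | cons b bs ih =>
    rw [List.pairwise_cons] at h2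
    have e := ih (fun b hb => h1 b (by simp [hb])) h2.2
    rw [List.flatten_cons, runFact_append (h1 b (by simp)).1 (h1 b (by simp)).2, e]
    rw [e]
    exact fun r hr => (h2.1 r hr).le

theorem wdtRowsAux_mem (bs : List (List ℕ)) : ∀ (m : ℤ), ∀ p ∈ (wdtRowsAux m bs).zip bs,
    p.1 < m ∧ p.1 ≤ (p.2.headI : ℤ) ∧ p.2 ∈ bs := by
  induction bs with
  | nil => simp [wdtRowsAux]
  | cons b bs ih =>
    intro m p hp
    rw [wdtRowsAux, List.zip_cons_cons] at hp
    rcases List.mem_cons.1 hp with rfl | hp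
    · exact ⟨by simp only; omega, by simp, by simp⟩
    · obtain ⟨h1, h2, h3⟩ := ih _ p hp
      exact ⟨by omega, h2, by simp [h3]⟩

theorem wdtRowsAux_pairwise (bs : List (List ℕ)) : ∀ (m : ℤ),
    ((wdtRowsAux m bs).zip bs).Pairwise (fun p q => q.1 < p.1) := by
  induction bs with
  | nil => simp [wdtRowsAux]
  | cons b bs ih =>
    intro m
    rw [wdtRowsAux, List.zip_cons_cons, List.pairwise_cons]
    exact ⟨fun p hp => (wdtRowsAux_mem bs _ p hp).1, ih _⟩

theorem wdtRowsAux_length (bs : List (List ℕ)) : ∀ (m : ℤ),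
    (wdtRowsAux m bs).length = bs.length := by
  induction bs with
  | nil => simp [wdtRowsAux]
  | cons b bs ih => intro m; simp [wdtRowsAux, ih]

/-- The blocks of a word with their rows. -/
def rowBlocks (u : List ℕ) : List (ℤ × List ℕ) := (wdtRows (runFact u)).zip (runFact u)

theorem wdtRows_eq_aux (bs : List (List ℕ)) : wdtRows bs = wdtRowsAux (bs.headI.headI + 1) bs := by
  cases bs with
  | nil => rfl
  | cons b bs => simp [wdtRows, wdtRowsAux]

theorem rowBlocks_mem {u : List ℕ} {p : ℤ × List ℕ} (hp : p ∈ rowBlocks u) :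
    p.1 ≤ (p.2.headI : ℤ) ∧ p.2 ∈ runFact u := by
  rw [rowBlocks, wdtRows_eq_aux] at hp
  exact (wdtRowsAux_mem _ _ p hp).2

theorem rowBlocks_pairwise (u : List ℕ) : (rowBlocks u).Pairwise (fun p q => q.1 < p.1) := by
  rw [rowBlocks, wdtRows_eq_aux]
  exact wdtRowsAux_pairwise _ _

theorem rowBlocks_flatten (u : List ℕ) : ((rowBlocks u).map Prod.snd).flatten = u := by
  rw [rowBlocks, wdtRows_eq_aux, List.map_snd_zip (by rw [wdtRowsAux_length]), runFact_flatten]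

theorem rowBlocks_pos {u : List ℕ} (hu : NonVirtual u) {p : ℤ × List ℕ} (hp : p ∈ rowBlocks u) :
    1 ≤ p.1 := hu _ (List.of_mem_zip (a := p.1) (b := p.2) hp).1

theorem wdtRowsAux_blocks {bs : List (List ℕ)} : ∀ {m : ℤ}, (∀ b ∈ bs, (b.headI : ℤ) < m) →
    bs.Pairwise (fun b b' => b'.headI < b.headI) →
    wdtRowsAux m bs = bs.map fun b => (b.headI : ℤ) := by
  induction bs with
  | nil => intros; rfl
  | cons b bs ih =>
    intro m hm hp
    rw [List.pairwise_cons] at hp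
    have h1 := hm b (by simp)
    have e : min (m - 1) (b.headI : ℤ) = b.headI := by omega
    rw [wdtRowsAux, e, ih (fun c hc => by exact_mod_cast hp.1 c hc) hp.2, List.map_cons]

theorem wdtRows_blocks {bs : List (List ℕ)} (hp : bs.Pairwise (fun b b' => b'.headI < b.headI)) :
    wdtRows bs = bs.map fun b => (b.headI : ℤ) := by
  rw [wdtRows_eq_aux]
  refine wdtRowsAux_blocks (fun b hb => ?_) hp
  cases bs with
  | nil => simp at hb
  | cons c bs =>
    rw [List.pairwise_cons] at hp
    simp only [List.headI_cons]
    rcases List.mem_cons.1 hb with rfl | hb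
    · omega
    · have := hp.1 b hb
      omega

/-- The length of the block in a given row. -/
def rowLen (ps : List (ℤ × List ℕ)) (r : ℤ) : ℕ :=
  match ps.find? (fun p => decide (p.1 = r)) with
  | some p => p.2.length
  | none => 0

theorem rowLen_nil (r : ℤ) : rowLen [] r = 0 := rfl

theorem rowLen_cons (p : ℤ × List ℕ) (ps : List (ℤ × List ℕ)) (r : ℤ) :
    rowLen (p :: ps) r = if p.1 = r then p.2.length else rowLen ps r := by
  unfold rowLen
  rw [List.find?_cons]
  split_ifs with h <;> simp [h]

theorem rowLen_eq_zero {ps : List (ℤ × List ℕ)} {r : ℤ} (h : ∀ p ∈ ps, p.1 ≠ r) :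
    rowLen ps r = 0 := by
  induction ps with
  | nil => rfl
  | cons p ps ih =>
    rw [rowLen_cons, if_neg (h p (by simp)), ih fun q hq => h q (by simp [hq])]

theorem weakDesTab_ne_zero {u : List ℕ} (hu : PosWord u) (r : ℤ) (c : ℕ) :
    weakDesTab u r c ≠ 0 ↔ 1 ≤ c ∧ c ≤ rowLen (rowBlocks u) r := by
  unfold weakDesTab rowLen
  rw [rowBlocks]
  split_ifs with hc
  · simp [hc]
  · split
    · rename_i p hp
      have hm := List.mem_of_find?_eq_some hp
      have hb := (rowBlocks_mem hm).2
      rw [List.getD_eq_getElem?_getD]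
      rcases Nat.lt_or_ge (c - 1) p.2.length with h | h
      · rw [List.getElem?_eq_getElem h]
        have : 1 ≤ p.2[c - 1] := hu _ (by
          rw [← runFact_flatten u]
          exact List.mem_flatten_of_mem hb (List.getElem_mem h))
        simp only [Option.getD_some]
        omega
      · rw [List.getElem?_eq_none h]
        simp only [Option.getD_none]
        omega
    · simp
      omega

theorem desComp_eq {u : List ℕ} (hu : PosWord u) (i : ℕ) :
    desComp u i = rowLen (rowBlocks u) i := by
  unfold desComp shapeOf
  simp only [weakDesTab_ne_zero hu]
  have : {c : ℕ | 1 ≤ c ∧ c ≤ rowLen (rowBlocks u) i} =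
      (Finset.Icc 1 (rowLen (rowBlocks u) i) : Finset ℕ) := by
    ext c; simp
  rw [this, Set.ncard_coe_finset]
  simp

/-- A word splits into the blocks in rows above `k` and the blocks in rows up to `k`. -/
theorem rowLen_split (k : ℕ) {ps : List (ℤ × List ℕ)} (h1 : ps.Pairwise (fun p q => q.1 < p.1))
    (h2 : ∀ p ∈ ps, 1 ≤ p.1 ∧ ∀ x ∈ p.2, p.1 ≤ (x : ℤ)) :
    ∃ u v, (ps.map Prod.snd).flatten = u ++ v ∧ (∀ x ∈ u, k < x) ∧
      v.length = ∑ i ∈ Finset.Icc 1 k, rowLen ps i ∧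
      ((∀ p ∈ ps, p.1 ≤ k) → u = []) := by
  induction ps with
  | nil => exact ⟨[], [], by simp [rowLen_nil]⟩
  | cons p ps ih =>
    rw [List.pairwise_cons] at h1
    obtain ⟨u, v, e, hu, hv, hn⟩ := ih h1.2 fun q hq => h2 q (by simp [hq])
    have hp := h2 p (by simp)
    by_cases hk : p.1 ≤ k
    · have hn' := hn fun q hq => (h1.1 q hq).le.trans hk
      subst hn'
      refine ⟨[], p.2 ++ v, by simp [e], by simp, ?_, fun _ => rfl⟩
      have e1 : ∀ i ∈ Finset.Icc 1 k, rowLen (p :: ps) i =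
          (if p.1.toNat = i then p.2.length else 0) + rowLen ps i := by
        intro i _
        rw [rowLen_cons]
        by_cases h : p.1 = i
        · have hz : rowLen ps i = 0 := rowLen_eq_zero fun q hq => by
            have := h1.1 q hq
            omega
          rw [if_pos h, if_pos (by omega), hz, add_zero]
        · rw [if_neg h, if_neg (by omega), zero_add]
      rw [Finset.sum_congr rfl e1, Finset.sum_add_distrib, List.length_append, hv,
        Finset.sum_ite_eq, if_pos (by simp; omega)]
    · refine ⟨p.2 ++ u, v, by simp [e], fun x hx => ?_, ?_, fun h => absurd (h p (by simp)) hk⟩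
      · rcases List.mem_append.1 hx with hx | hx
        · have := hp.2 x hx
          omega
        · exact hu x hx
      · rw [hv]
        refine Finset.sum_congr rfl fun i hi => ?_
        rw [Finset.mem_Icc] at hi
        rw [rowLen_cons, if_neg (by omega)]

theorem desComp_split (k : ℕ) {w : List ℕ} (hw : PosWord w) (hv : NonVirtual w) :
    ∃ u v, w = u ++ v ∧ (∀ x ∈ u, k < x) ∧ v.length = ∑ i ∈ Finset.Icc 1 k, desComp w i := by
  obtain ⟨u, v, h1, h2, h3, -⟩ := rowLen_split k (rowBlocks_pairwise w) fun p hp =>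
    ⟨rowBlocks_pos hv hp, fun x hx => by
      have h1 := rowBlocks_mem hp
      have h2 := headI_le (runFact_pairwise w _ h1.2) hx
      omega⟩
  rw [rowBlocks_flatten] at h1
  exact ⟨u, v, h1, h2, by simpa only [desComp_eq hw] using h3⟩


theorem mem_colw {n : ℕ} : ∀ {C : ℕ → Finset ℕ} {x : ℕ}, x ∈ colw n C ↔ ∃ j < n, x ∈ C j := by
  induction n with
  | zero => simp [colw]
  | succ n ih =>
    intro C x
    rw [colw, List.mem_append, ih, mem_inc]
    constructor
    · rintro (⟨j, hj, h⟩ | h)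
      · exact ⟨j + 1, by omega, h⟩
      · exact ⟨0, by omega, h⟩
    · rintro ⟨j, hj, h⟩
      cases j with
      | zero => exact Or.inr h
      | succ j => exact Or.inl ⟨j, by omega, h⟩

theorem length_colw {n : ℕ} : ∀ {C : ℕ → Finset ℕ},
    (colw n C).length = ∑ j ∈ Finset.range n, (C j).card := by
  induction n with
  | zero => simp [colw]
  | succ n ih =>
    intro C
    rw [colw, List.length_append, ih, Finset.sum_range_succ' (fun j => (C j).card)]
    simp [inc]

theorem exists_le_of_allM {C : ℕ → Finset ℕ} (hC : AllM C) {j : ℕ} : ∀ {x : ℕ}, x ∈ C j →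
    ∃ y ∈ C 0, y ≤ x := by
  induction j with
  | zero => exact fun {x} h => ⟨x, h, le_rfl⟩
  | succ j ih =>
    intro x hx
    have h1 := hC j x
    have h2 : 0 < lc (C (j + 1)) (x + 1) :=
      Finset.card_pos.2 ⟨x, by simp [hx]⟩
    obtain ⟨y, hy⟩ := Finset.card_pos.1 (h2.trans_le h1)
    rw [Finset.mem_filter] at hy
    obtain ⟨z, hz, hzy⟩ := ih hy.1
    exact ⟨z, hz, by omega⟩

theorem tab_colw {W : List ℕ} {C : ℕ → Finset ℕ} (h : Tab W C) {M : ℕ}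
    (hM : ∀ j, M ≤ j → C j = ∅) : CKEquiv W.reverse (colw M C) := by
  obtain ⟨hC, n, hn, hck⟩ := h
  rcases Nat.le_total n M with hle | hle
  · rwa [colw_stable hle hn]
  · rwa [← colw_stable hle hM]

theorem tab_length {W : List ℕ} {C : ℕ → Finset ℕ} (h : Tab W C) {M : ℕ}
    (hM : ∀ j, M ≤ j → C j = ∅) : W.length = ∑ j ∈ Finset.range M, (keyCol C j).card := by
  have := ck_length (tab_colw h hM)
  rw [List.length_reverse, length_colw] at this
  simpa only [card_keyCol h.all] using this

theorem tab_mem {W : List ℕ} {C : ℕ → Finset ℕ} (h : Tab W C) {x : ℕ} (hx : x ∈ C 0) : x ∈ W := by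
  obtain ⟨hC, n, hn, hck⟩ := h
  rw [← List.mem_reverse, ck_mem hck, mem_colw]
  refine ⟨0, ?_, hx⟩
  by_contra h0
  rw [hn 0 (by omega)] at hx
  simp at hx

theorem tab_ge {W : List ℕ} {C : ℕ → Finset ℕ} (h : Tab W C) {x : ℕ} (hx : x ∈ W) :
    ∃ y ∈ C 0, y ≤ x := by
  obtain ⟨hC, n, hn, hck⟩ := h
  rw [← List.mem_reverse, ck_mem hck, mem_colw] at hx
  obtain ⟨j, -, hj⟩ := hx
  exact exists_le_of_allM hC hj

theorem keyCol_mem {W : List ℕ} {C : ℕ → Finset ℕ} (h : Tab W C) {x j : ℕ} (hx : x ∈ keyCol C j) :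
    x ∈ W := tab_mem h (keyCol_anti h.all (Nat.zero_le j) hx)

theorem cols_keyCol_subset {u : List ℕ} : ∀ {C cs C'}, AllM C → Cols C u cs C' → ∀ j,
    keyCol C j ⊆ keyCol C' j := by
  induction u with
  | nil =>
    intro C cs C' _ h j
    obtain ⟨-, rfl⟩ := cols_nil_inv h
    exact subset_rfl
  | cons x u ih =>
    intro C cs C' hC h j
    obtain ⟨c, C1, ds, h1, h2, rfl⟩ := cols_cons_inv h
    refine subset_trans ?_ (ih (tins_isTab h1 hC).1 h2 j)
    obtain ⟨h3, r, hr, h4, -⟩ := tins_keyCol hC h1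
    by_cases hj : j = c
    · subst hj
      rw [h4]
      exact Finset.subset_insert _ _
    · rw [h3 j hj]

theorem pairwise_of_cols {u : List ℕ} : ∀ {W C cs C'}, Tab W C → IsReducedWord (W ++ u) →
    Cols C u cs C' → cs.Pairwise (· < ·) → u.Pairwise (· < ·) := by
  induction u with
  | nil => intros; exact List.Pairwise.nil
  | cons x u ih =>
    intro W C cs C' hT hW h hcs
    obtain ⟨c, C1, ds, h1, h2, rfl⟩ := cols_cons_inv h
    rw [List.append_cons] at hW
    have hT1 := tab_of_tins (reduced_left hW) hT h1
    have hp := ih hT1 hW h2 hcs.of_cons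
    cases u with
    | nil => exact List.pairwise_singleton _ _
    | cons y u =>
      obtain ⟨d, C2, es, h3, h4, rfl⟩ := cols_cons_inv h2
      have hcd : c < d := List.rel_of_pairwise_cons hcs (List.mem_cons_self ..)
      have hxy : x < y := by
        by_contra hlt
        rcases Nat.eq_or_lt_of_le (Nat.le_of_not_lt hlt) with rfl | hlt
        · have hr : IsReducedWord [y, y] := by
            refine reduced_factor (a := W) (b := u) ?_
            simpa using hW
          have := hr.2 [] (by simp [PosWord]) (by simp [wordPerm, sPerm])
          simp at this
        · have := tins_le hT.all h1 h3 hlt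
          omega
      rw [List.pairwise_cons]
      refine ⟨fun z hz => ?_, hp⟩
      rcases List.mem_cons.1 hz with rfl | hz
      · exact hxy
      · exact hxy.trans (List.rel_of_pairwise_cons hp hz)

theorem cols_snoc {u : List ℕ} {C cs C1 x c C2} (h : Cols C u cs C1) (h' : TIns C1 x c C2) :
    Cols C (u ++ [x]) (cs ++ [c]) C2 := cols_append h (.cons h' (.nil _))

/-- The boxes of the smallest key row can be removed by undoing a row of insertions. -/
theorem peel_row {k : ℕ} : ∀ {L : ℕ} {W : List ℕ} {C : ℕ → Finset ℕ}, IsReducedWord W → Tab W C →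
    (∀ x ∈ C 0, k ≤ x) → (∀ j, k ∈ keyCol C j ↔ j < L) → ∃ W' v C', CKEquiv W (W' ++ v) ∧
      v.length = L ∧ Tab W' C' ∧ Cols C' v (List.range L) C ∧
      ∀ j, keyCol C' j = (keyCol C j).erase k := by
  intro L
  induction L with
  | zero =>
    intro W C hW hT hk hL
    refine ⟨W, [], C, by simpa using ck_refl W, rfl, hT, .nil C, fun j => ?_⟩
    rw [Finset.erase_eq_of_notMem]
    rw [hL]
    omega
  | succ L ih =>
    intro W C hW hT hk hL
    have hc : (C (L + 1)).card < (C L).card := by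
      rw [← card_keyCol hT.all, ← card_keyCol hT.all]
      refine Finset.card_lt_card ((Finset.ssubset_iff_of_subset (keyCol_succ_subset hT.all L)).2
        ⟨k, (hL L).2 (by omega), ?_⟩)
      rw [hL]
      omega
    obtain ⟨W1, y, C1, hck, hT1, hI⟩ := tab_unsnoc hW hT hc
    obtain ⟨h3, r, hr, h4, h5⟩ := tins_keyCol hT1.all hI
    have hsub : ∀ j, keyCol C j ⊆ C 0 := fun j => keyCol_anti hT.all (Nat.zero_le j)
    have hrk : r = k := by
      by_contra hne
      have h6 : k ≤ r := hk r (hsub L (by rw [h4]; simp))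
      have h7 : k ∈ keyCol C L := (hL L).2 (by omega)
      rw [h4, Finset.mem_insert] at h7
      have h8 := h5 k (by tauto) (by omega)
      rw [← h3 (L + 1) (by omega), hL] at h8
      omega
    subst hrk
    have hW1 := ck_reduced hck hW
    obtain ⟨W', v, C', hck', hl, hT', hcols, hkey⟩ := ih (reduced_left hW1) hT1
      (fun x hx => hk x (by
        by_cases h : L = 0
        · subst h
          change x ∈ keyCol C 0
          rw [h4]
          exact Finset.mem_insert_of_mem hx
        · change x ∈ keyCol C 0
          rw [h3 0 (by omega)]
          exact hx))
      (fun j => by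
        by_cases h : j = L
        · subst h
          simp [hr]
        · rw [← h3 j h, hL]
          omega)
    refine ⟨W', v ++ [y], C', ?_, by simp [hl], hT', ?_, fun j => ?_⟩
    · rw [← List.append_assoc]
      exact ck_trans hck (ck_right [y] hck')
    · rw [List.range_succ]
      exact cols_snoc hcols hI
    · rw [hkey]
      by_cases h : j = L
      · subst h
        rw [h4, Finset.erase_insert hr, Finset.erase_eq_of_notMem hr]
      · rw [h3 j h]

/-- Every class contains a product of increasing words given by the rows of the key. -/
theorem exists_row_blocks (m : ℕ) : ∀ {W : List ℕ} {C : ℕ → Finset ℕ}, W.length ≤ m →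
    IsReducedWord W → Tab W C → ∃ bs : List (List ℕ), CKEquiv W bs.flatten ∧
      (∀ b ∈ bs, b ≠ [] ∧ b.Pairwise (· < ·)) ∧
      bs.Pairwise (fun b b' => b'.headI < b.headI) ∧
      ∀ r c, r ∈ keyCol C c ↔ ∃ b ∈ bs, b.headI = r ∧ c < b.length := by
  induction m with
  | zero =>
    intro W C hm hW hT
    have hW0 : W = [] := List.eq_nil_of_length_eq_zero (by omega)
    subst hW0
    refine ⟨[], ck_refl _, by simp, by simp, fun r c => ?_⟩
    simp only [List.not_mem_nil, false_and, exists_false, iff_false]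
    intro h
    have := keyCol_mem hT h
    simp at this
  | succ m ih =>
    intro W C hm hW hT
    by_cases hne : (C 0).Nonempty
    · set k := (C 0).min' hne with hk
      have hk0 : k ∈ C 0 := Finset.min'_mem _ _
      have hmin : ∀ x ∈ C 0, k ≤ x := fun x hx => Finset.min'_le _ _ hx
      obtain ⟨n, hn⟩ := (tab_isTab hT).2
      have hex : ∃ j, k ∉ keyCol C j := ⟨n, by rw [keyCol_eq_empty hT.all (hn n le_rfl)]; simp⟩
      have hL : ∀ j, k ∈ keyCol C j ↔ j < Nat.find hex := by
        intro j
        constructor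
        · intro h
          by_contra hle
          exact Nat.find_spec hex (keyCol_anti hT.all (by omega) h)
        · intro h
          by_contra hno
          exact Nat.find_min hex h hno
      have hL1 : 1 ≤ Nat.find hex := (hL 0).1 hk0
      set L := Nat.find hex
      obtain ⟨W', v, C', hck, hl, hT', hcols, hkey⟩ := peel_row hW hT hmin hL
      have hW' := ck_reduced hck hW
      have hv := pairwise_of_cols hT' hW' hcols List.pairwise_lt_range
      have hlen := ck_length hck
      rw [List.length_append] at hlen
      obtain ⟨bs, h1, h2, h3, h4⟩ := ih (by omega) (reduced_left hW') hT'
      have hgt : ∀ x ∈ C' 0, k < x := by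
        intro x hx
        change x ∈ keyCol C' 0 at hx
        rw [hkey, Finset.mem_erase] at hx
        have := hmin x hx.2
        omega
      have hkv : k ∈ v := by
        have := (ck_mem hck k).1 (tab_mem hT hk0)
        rcases List.mem_append.1 this with h | h
        · obtain ⟨y, hy, hyk⟩ := tab_ge hT' h
          have := hgt y hy
          omega
        · exact h
      have hvk : v.headI = k := by
        have h5 := headI_le hv hkv
        have h6 : v.headI ∈ v := by
          cases v with
          | nil => simp at hkv
          | cons => simp
        obtain ⟨y, hy, hyk⟩ := tab_ge hT ((ck_mem hck _).2 (List.mem_append_right W' h6))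
        have := hmin y hy
        omega
      have hbk : ∀ b ∈ bs, k < b.headI := fun b hb => by
        have := (h4 b.headI 0).2 ⟨b, hb, rfl, List.length_pos_of_ne_nil (h2 b hb).1⟩
        exact hgt _ this
      refine ⟨bs ++ [v], ?_, ?_, ?_, fun r c => ?_⟩
      · rw [List.flatten_append, List.flatten_singleton]
        exact ck_trans hck (ck_right v h1)
      · intro b hb
        rcases List.mem_append.1 hb with hb | hb
        · exact h2 b hb
        · rw [List.mem_singleton] at hb
          subst hb
          exact ⟨by rintro rfl; simp at hkv, hv⟩
      · rw [List.pairwise_append]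
        refine ⟨h3, List.pairwise_singleton _ _, fun b hb b' hb' => ?_⟩
        rw [List.mem_singleton] at hb'
        rw [hb', hvk]
        exact hbk b hb
      · have h5 := h4 r c
        rw [hkey, Finset.mem_erase] at h5
        by_cases hr : r = k
        · subst hr
          rw [hL]
          constructor
          · intro h
            exact ⟨v, by simp, hvk, by omega⟩
          · rintro ⟨b, hb, hb1, hb2⟩
            rcases List.mem_append.1 hb with hb | hb
            · have := hbk b hb
              omega
            · rw [List.mem_singleton] at hb
              subst hb
              omega
        · rw [show r ∈ keyCol C c ↔ r ≠ k ∧ r ∈ keyCol C c by tauto, h5]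
          constructor
          · rintro ⟨b, hb, h⟩
            exact ⟨b, by simp [hb], h⟩
          · rintro ⟨b, hb, h⟩
            refine ⟨b, ?_, h⟩
            rcases List.mem_append.1 hb with hb | hb
            · exact hb
            · rw [List.mem_singleton] at hb
              subst hb
              exact absurd (h.1.symm.trans hvk) hr
    · have hW0 : W = [] := by
        rw [List.eq_nil_iff_forall_not_mem]
        intro x hx
        obtain ⟨y, hy, -⟩ := tab_ge hT hx
        exact hne ⟨y, hy⟩
      exact ih (by simp [hW0]) hW hT


theorem rowBlocks_blocks {bs : List (List ℕ)} (h1 : ∀ b ∈ bs, b ≠ [] ∧ b.Pairwise (· < ·))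
    (h2 : bs.Pairwise (fun b b' => b'.headI < b.headI)) :
    rowBlocks bs.flatten = bs.map fun b => ((b.headI : ℤ), b) := by
  rw [rowBlocks, runFact_blocks h1 h2, wdtRows_blocks h2]
  have := List.zip_map' (f := fun b : List ℕ => (b.headI : ℤ)) (g := id) (l := bs)
  simpa using this

theorem lt_rowLen_iff {bs : List (List ℕ)} (h2 : bs.Pairwise (fun b b' => b'.headI < b.headI))
    (i c : ℕ) : c < rowLen (bs.map fun b => ((b.headI : ℤ), b)) i ↔
      ∃ b ∈ bs, b.headI = i ∧ c < b.length := by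
  induction bs with
  | nil => simp [rowLen_nil]
  | cons b bs ih =>
    rw [List.pairwise_cons] at h2
    rw [List.map_cons, rowLen_cons]
    by_cases h : b.headI = i
    · rw [if_pos (by simpa using h)]
      constructor
      · exact fun hc => ⟨b, by simp, h, hc⟩
      · rintro ⟨d, hd, h3, h4⟩
        rcases List.mem_cons.1 hd with rfl | hd
        · exact h4
        · have := h2.1 d hd
          omega
    · rw [if_neg (by simpa using h), ih h2.2]
      constructor
      · rintro ⟨d, hd, h3⟩
        exact ⟨d, by simp [hd], h3⟩
      · rintro ⟨d, hd, h3, h4⟩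
        rcases List.mem_cons.1 hd with rfl | hd
        · exact absurd h3 h
        · exact ⟨d, hd, h3, h4⟩

theorem keyCol_pos {W : List ℕ} (hW : IsReducedWord W) {C : ℕ → Finset ℕ} (h : Tab W C) {x j : ℕ}
    (hx : x ∈ keyCol C j) : 1 ≤ x := hW.1 x (keyCol_mem h hx)

theorem sum_rows_eq {C : ℕ → Finset ℕ} {M : ℕ} (hM : ∀ j, M ≤ j → keyCol C j = ∅)
    (hpos : ∀ j, ∀ x ∈ keyCol C j, 1 ≤ x) {a : ℕ → ℕ} (ha : ∀ i c, c < a i ↔ i ∈ keyCol C c)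
    (k : ℕ) : ∑ i ∈ Finset.Icc 1 k, a i =
      ∑ j ∈ Finset.range M, ((keyCol C j).filter (· ≤ k)).card := by
  have h1 : ∀ i, a i = ∑ j ∈ Finset.range M, if i ∈ keyCol C j then 1 else 0 := by
    intro i
    rw [← Finset.sum_filter, Finset.sum_const, smul_eq_mul, mul_one]
    rw [show (Finset.range M).filter (fun j => i ∈ keyCol C j) = Finset.range (a i) by
      ext j
      simp only [Finset.mem_filter, Finset.mem_range, ha]
      refine ⟨fun h => h.2, fun h => ⟨?_, h⟩⟩
      by_contra hj
      rw [hM j (by omega)] at h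
      simp at h]
    simp
  simp only [h1]
  rw [Finset.sum_comm]
  refine Finset.sum_congr rfl fun j _ => ?_
  rw [← Finset.sum_filter, Finset.sum_const, smul_eq_mul, mul_one]
  congr 1
  ext i
  simp only [Finset.mem_filter, Finset.mem_Icc]
  have := hpos j i
  tauto

theorem desComp_ge {W : List ℕ} (hW : IsReducedWord W) {C : ℕ → Finset ℕ} (hT : Tab W C)
    (hv : NonVirtual W) {M : ℕ} (hM : ∀ j, M ≤ j → C j = ∅) (k : ℕ) :
    ∑ j ∈ Finset.range M, ((keyCol C j).filter (· ≤ k)).card ≤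
      ∑ i ∈ Finset.Icc 1 k, desComp W i := by
  obtain ⟨u, v, rfl, hu, hl⟩ := desComp_split k hW.1 hv
  obtain ⟨D, hD⟩ := tab_exists (reduced_left hW)
  obtain ⟨cs, C', hcols, hT'⟩ := cols_exists hD hW
  obtain rfl := tab_uniq hW hT hT'
  have hsub := cols_keyCol_subset hD.all hcols
  have hDM : ∀ j, M ≤ j → D j = ∅ := by
    intro j hj
    rw [← Finset.card_eq_zero, ← card_keyCol hD.all, Finset.card_eq_zero, ← Finset.subset_empty,
      ← keyCol_eq_empty hT.all (hM j hj)]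
    exact hsub j
  have h1 := tab_length hT hM
  have h2 := tab_length hD hDM
  rw [List.length_append, h2] at h1
  have h3 : ∑ j ∈ Finset.range M, (keyCol D j).card +
      ∑ j ∈ Finset.range M, ((keyCol C j).filter (· ≤ k)).card ≤
      ∑ j ∈ Finset.range M, (keyCol C j).card := by
    rw [← Finset.sum_add_distrib]
    refine Finset.sum_le_sum fun j _ => ?_
    rw [← Finset.card_union_of_disjoint]
    · exact Finset.card_le_card (Finset.union_subset (hsub j) (Finset.filter_subset _ _))
    · rw [Finset.disjoint_left]
      intro x hx hx'
      have := hu x (keyCol_mem hD hx)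
      simp at hx'
      omega
  omega

theorem exists_yamanouchi {W : List ℕ} (hW : IsReducedWord W) {C : ℕ → Finset ℕ} (hT : Tab W C) :
    ∃ u, Yamanouchi u ∧ CKEquiv W u ∧ ∀ i c, c < desComp u i ↔ i ∈ keyCol C c := by
  obtain ⟨bs, h1, h2, h3, h4⟩ := exists_row_blocks W.length le_rfl hW hT
  have hred := ck_reduced h1 hW
  have hdes : ∀ i c, c < desComp bs.flatten i ↔ i ∈ keyCol C c := by
    intro i c
    rw [desComp_eq hred.1, rowBlocks_blocks h2 h3, lt_rowLen_iff h3, h4]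
  refine ⟨bs.flatten, ⟨hred, ?_, fun v hv hck k => ?_⟩, h1, hdes⟩
  · intro r hr
    rw [runFact_blocks h2 h3, wdtRows_blocks h3, List.mem_map] at hr
    obtain ⟨b, hb, rfl⟩ := hr
    have : b.headI ∈ keyCol C 0 := (h4 _ _).2 ⟨b, hb, rfl, List.length_pos_of_ne_nil (h2 b hb).1⟩
    exact_mod_cast keyCol_pos hW hT this
  · obtain ⟨M, hM⟩ := (tab_isTab hT).2
    rw [sum_rows_eq (fun j hj => keyCol_eq_empty hT.all (hM j hj))
      (fun j x hx => keyCol_pos hW hT hx) hdes]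
    have hc := ck_trans h1 hck
    exact desComp_ge (ck_reduced hc hW) (tab_congr hT hc) hv hM k

theorem eq_of_compLE {a b : ℕ → ℕ} (h : compLE a b) (h' : compLE b a) {i : ℕ} (hi : 1 ≤ i) :
    a i = b i := by
  have e := fun k => le_antisymm (h k) (h' k)
  have e1 := e i
  obtain ⟨j, rfl⟩ : ∃ j, i = j + 1 := ⟨i - 1, by omega⟩
  rw [Finset.sum_Icc_succ_top (by omega), Finset.sum_Icc_succ_top (by omega), e j] at e1
  omega

theorem hatP_iff {W : List ℕ} (hW : IsReducedWord W) {C : ℕ → Finset ℕ} (hT : Tab W C) (r : ℤ)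
    (c : ℕ) : hatP W r c ≠ 0 ↔ 1 ≤ c ∧ 1 ≤ r ∧ r.toNat ∈ keyCol C (c - 1) := by
  obtain ⟨u, hu, hck, hdes⟩ := exists_yamanouchi hW hT
  have hex : ∃ v, Yamanouchi v ∧ CKEquiv W v := ⟨u, hu, hck⟩
  obtain ⟨hv, hckv⟩ := hex.choose_spec
  unfold hatP hatRho
  rw [dif_pos hex]
  set v := hex.choose
  have huv : CKEquiv u v := ck_trans (ck_symm hck) hckv
  rw [weakDesTab_ne_zero hv.1.1]
  rcases le_or_gt 1 r with hr | hr
  · obtain ⟨i, rfl⟩ := Int.eq_ofNat_of_zero_le (by omega : 0 ≤ r)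
    rw [Int.toNat_natCast, ← hdes, eq_of_compLE (hu.2.2 v hv.2.1 huv)
      (hv.2.2 u hu.2.1 (ck_symm huv)) (by omega), desComp_eq hv.1.1]
    omega
  · rw [rowLen_eq_zero]
    · omega
    · intro p hp
      have := rowBlocks_pos hv.2.1 hp
      omega

theorem hatP_congr {W W' : List ℕ} (h : CKEquiv W W') : hatP W = hatP W' := by
  have e : (fun v => Yamanouchi v ∧ CKEquiv W v) = fun v => Yamanouchi v ∧ CKEquiv W' v := by
    funext v
    exact propext ⟨fun hv => ⟨hv.1, ck_trans (ck_symm h) hv.2⟩, fun hv => ⟨hv.1, ck_trans h hv.2⟩⟩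
  unfold hatP hatRho
  rw [e]


/-- `m` is the running maximum of `h`. -/
structure RunMax (h m : ℕ → ℤ) : Prop where
  le : ∀ s t, s ≤ t → h s ≤ m t
  ex : ∀ t, ∃ s ≤ t, h s = m t

theorem RunMax.mono {h m : ℕ → ℤ} (H : RunMax h m) {s t : ℕ} (hst : s ≤ t) : m s ≤ m t := by
  obtain ⟨r, hr, h1⟩ := H.ex s
  rw [← h1]
  exact H.le r t (hr.trans hst)

theorem RunMax.succ {h m : ℕ → ℤ} (H : RunMax h m) (t : ℕ) :
    m (t + 1) = m t ∨ m (t + 1) = h (t + 1) := by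
  obtain ⟨s, hs, h1⟩ := H.ex (t + 1)
  rcases Nat.eq_or_lt_of_le hs with rfl | hs
  · exact Or.inr h1.symm
  · left
    refine le_antisymm ?_ (H.mono (by omega))
    rw [← h1]
    exact H.le s t (by omega)

theorem RunMax.jump {h m h' m' d : ℕ → ℤ} (H : RunMax h m) (H' : RunMax h' m')
    (hd : ∀ t, m t = m' t + d t) (hh : ∀ t, h t = h' t + 2 * d t) {t : ℕ}
    (hs : d (t + 1) = d t + 1) (h1 : h (t + 1) ≤ h t + 1) (h2 : h' (t + 1) ≤ h' t - 1) :
    h (t + 1) = m (t + 1) ∧ m (t + 1) = m t + 1 ∧ 0 ≤ d t := by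
  have e1 := H.succ t
  have e2 := H'.succ t
  have e3 := H'.mono (show t ≤ t + 1 by omega)
  have e4 := H.le t t le_rfl
  have e5 := H'.le t t le_rfl
  have e6 := hd t
  have e7 := hd (t + 1)
  have e8 := hh (t + 1)
  have e9 := H.mono (show t ≤ t + 1 by omega)
  omega

/-- If two pairs of sets with the same sum have the same running maxima, and the second sets have
one more element in `D` than the first ones, they differ at the first maximum. -/
theorem RunMax.single_jump {h m h' m' d : ℕ → ℤ} (H : RunMax h m) (H' : RunMax h' m')
    (hd : ∀ t, m t = m' t + d t) (hh : ∀ t, h t = h' t + 2 * d t)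
    (hs : ∀ t, d (t + 1) = d t ∨
      (d (t + 1) = d t + 1 ∧ h (t + 1) = h t + 1 ∧ h' (t + 1) = h' t - 1) ∨
      (d (t + 1) = d t - 1 ∧ h (t + 1) = h t - 1 ∧ h' (t + 1) = h' t + 1)) (h0 : d 0 = 0)
    (hN : ∃ N, ∀ t, N ≤ t → d t = 1) :
    ∃ c, (∀ t, t ≤ c → d t = 0) ∧ (∀ t, c < t → d t = 1) ∧ (∀ t, h t ≤ h (c + 1)) ∧
      ∀ t, t ≤ c → h t < h (c + 1) := by
  obtain ⟨N, hN⟩ := hN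
  have up : ∀ t, d (t + 1) = d t + 1 → h (t + 1) = m (t + 1) ∧ m (t + 1) = m t + 1 ∧ 0 ≤ d t := by
    intro t ht
    have := hs t
    exact H.jump H' hd hh ht (by omega) (by omega)
  have down : ∀ t, d (t + 1) = d t - 1 → d t ≤ 0 := by
    intro t ht
    have := hs t
    have := H'.jump H (d := fun t => - d t) (fun t => by have := hd t; omega)
      (fun t => by have := hh t; omega) (t := t) (by omega) (by omega) (by omega)
    omega
  have hneg : ∀ t s, t ≤ s → d t < 0 → d s < 0 := by
    intro t s hts h1
    induction s, hts using Nat.le_induction with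
    | base => exact h1
    | succ s hts ih =>
      have h2 := hs s
      have h3 := up s
      omega
  have hpos : ∀ t, 0 ≤ d t := by
    intro t
    by_contra h1
    have h2 := hneg t (t + N) (by omega) (by omega)
    rw [hN (t + N) (by omega)] at h2
    omega
  have hmono : ∀ t s, t ≤ s → d t ≤ d s := by
    intro t s hts
    induction s, hts using Nat.le_induction with
    | base => exact le_rfl
    | succ s hts ih =>
      have h2 := hs s
      have h3 := down s
      have h4 := hpos (s + 1)
      omega
  have hex : ∃ t, d t = 1 := ⟨N, hN N le_rfl⟩
  have hf := Nat.find_spec hex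
  have hmin : ∀ t, t < Nat.find hex → d t ≠ 1 := fun t ht => Nat.find_min hex ht
  have hf0 : Nat.find hex ≠ 0 := fun h => by rw [h, h0] at hf; omega
  obtain ⟨c, hc⟩ := Nat.exists_eq_succ_of_ne_zero hf0
  rw [hc, Nat.succ_eq_add_one] at hf hmin
  have hle1 : ∀ t, d t ≤ 1 := by
    intro t
    have := hmono t (t + N) (by omega)
    rwa [hN (t + N) (by omega)] at this
  have hlow : ∀ t, t ≤ c → d t = 0 := by
    intro t ht
    have h1 := hmin t (by omega)
    have h2 := hle1 t
    have h3 := hpos t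
    omega
  have hhigh : ∀ t, c < t → d t = 1 := by
    intro t ht
    have h1 := hmono (c + 1) t ht
    have h2 := hle1 t
    omega
  obtain ⟨j1, j2, -⟩ := up c (by rw [hlow c le_rfl, hhigh (c + 1) (by omega)]; rfl)
  have hlt : ∀ t, t ≤ c → h t < h (c + 1) := by
    intro t ht
    have := H.le t c ht
    omega
  refine ⟨c, hlow, hhigh, fun t => ?_, hlt⟩
  by_contra hgt
  have hct : c < t := by
    by_contra hle
    have := hlt t (by omega)
    omega
  obtain ⟨s, hst, hs'⟩ := H'.ex t
  have e1 := hd t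
  have e2 := hhigh t hct
  have e3 := hh s
  have e4 := H.le s t hst
  have e5 := H.le t t le_rfl
  rcases Nat.lt_or_ge c s with hcs | hcs
  · have := hhigh s hcs
    omega
  · have := hlow s hcs
    have := hlt s hcs
    omega

theorem lis_zero_inc {a : List ℕ} (ha : a.Pairwise (· < ·)) (t : ℕ) :
    lis (fun _ => 0) a t = lc a.toFinset t := by
  induction a using List.reverseRecOn generalizing t with
  | nil => simp [lis, lc]
  | append_singleton a c ih =>
    rw [List.pairwise_append] at ha
    have hlt : ∀ x ∈ a, x < c := fun x hx => ha.2.2 x hx c (by simp)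
    have hc : c ∉ a.toFinset := fun h => lt_irrefl _ (hlt c (by simpa using h))
    have e : (a ++ [c]).toFinset = insert c a.toFinset := by ext; simp
    have e1 : lis (fun _ => 0) a = lc a.toFinset := funext fun t => ih ha.1 t
    rw [lis_append, e, lc_insert hc, e1]
    simp only [lis, List.foldl_cons, List.foldl_nil, lisStep]
    split_ifs with h
    · have e2 : ∀ s, c ≤ s → lc a.toFinset s = a.toFinset.card := fun s hs =>
        lc_of_ge fun x hx => (hlt x (by simpa using hx)).trans_le hs
      rw [e2 t h.le, e2 c le_rfl]
      omega
    · rfl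

theorem lis_inc {F : ℕ → ℕ} (hF : Monotone F) {b : List ℕ} (hb : b.Pairwise (· < ·)) (t : ℕ) :
    (∀ s, s ≤ t → F s + lc b.toFinset t ≤ lis F b t + lc b.toFinset s) ∧
      ∃ s, s ≤ t ∧ F s + lc b.toFinset t = lis F b t + lc b.toFinset s := by
  induction b using List.reverseRecOn generalizing t with
  | nil => exact ⟨fun s hs => by simpa [lis, lc] using hF hs, t, le_rfl, rfl⟩
  | append_singleton b c ih =>
    rw [List.pairwise_append] at hb
    have hlt : ∀ x ∈ b, x < c := fun x hx => hb.2.2 x hx c (by simp)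
    have hc : c ∉ b.toFinset := fun h => lt_irrefl _ (hlt c (by simpa using h))
    have e : (b ++ [c]).toFinset = insert c b.toFinset := by ext; simp
    have e2 : ∀ s, c ≤ s → lc b.toFinset s = b.toFinset.card := fun s hs =>
      lc_of_ge fun x hx => (hlt x (by simpa using hx)).trans_le hs
    have i1 := ih hb.1
    rw [lis_append, e]
    simp only [lc_insert hc, lis, List.foldl_cons, List.foldl_nil, lisStep]
    change (∀ s, s ≤ t → _ ≤ (if c < t then max (lis F b t) (lis F b c + 1) else lis F b t) + _) ∧
      ∃ s, s ≤ t ∧ _ = (if c < t then max (lis F b t) (lis F b c + 1) else lis F b t) + _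
    have i2 := i1 t
    have i3 := i1 c
    have e3 := e2 c le_rfl
    obtain ⟨i4, s1, hs1, i5⟩ := i2
    obtain ⟨i6, s2, hs2, i7⟩ := i3
    by_cases hct : c < t
    · have e4 := e2 t hct.le
      simp only [if_pos hct]
      refine ⟨fun s hs => ?_, ?_⟩
      · have := i4 s hs
        split_ifs with h
        · omega
        · have := i6 s (by omega)
          omega
      · rcases Nat.lt_or_ge (lis F b c) (lis F b t) with h | h
        · refine ⟨s1, hs1, ?_⟩
          rw [if_pos, max_eq_left (by omega)]
          · omega
          · by_contra hle
            have := i6 s1 (by omega)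
            omega
        · refine ⟨s2, by omega, ?_⟩
          rw [if_neg (by omega), max_eq_right (by omega)]
          omega
    · simp only [if_neg hct]
      refine ⟨fun s hs => ?_, s1, hs1, ?_⟩
      · rw [if_neg (by omega)]
        exact i4 s hs
      · rw [if_neg (by omega)]
        exact i5

theorem lc_toFinset {a : List ℕ} (ha : a.Nodup) (t : ℕ) :
    lc a.toFinset t = a.countP (· < t) := by
  rw [lc, List.countP_eq_length_filter, ← List.toFinset_card_of_nodup (ha.filter _)]
  congr 1
  ext
  simp

theorem mem_iff_lc {S : Finset ℕ} {x : ℕ} : x ∈ S ↔ lc S (x + 1) = lc S x + 1 := by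
  rw [lc_succ]
  split_ifs with h <;> simp [h]

/-- A crystal move on the recording data: one element passes from the first set to the second at
the first maximum of the difference of the counting functions. -/
theorem sets_jump {a b a' b' : List ℕ} (ha : a.Pairwise (· < ·)) (hb : b.Pairwise (· < ·))
    (ha' : a'.Pairwise (· < ·)) (hb' : b'.Pairwise (· < ·)) (hp : (a ++ b).Perm (a' ++ b'))
    (hl : lis (fun _ => 0) (a ++ b) = lis (fun _ => 0) (a' ++ b'))
    (hlen : a.length = a'.length + 1) :
    ∃ c ∈ a, c ∉ b ∧ (∀ x, x ∈ a' ↔ x ∈ a ∧ x ≠ c) ∧ (∀ x, x ∈ b' ↔ x ∈ b ∨ x = c) ∧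
      (∀ t, (lc a.toFinset t : ℤ) - lc b.toFinset t ≤
        lc a.toFinset (c + 1) - lc b.toFinset (c + 1)) ∧
      ∀ t, t ≤ c → (lc a.toFinset t : ℤ) - lc b.toFinset t <
        lc a.toFinset (c + 1) - lc b.toFinset (c + 1) := by
  have hnd : ∀ {l : List ℕ}, l.Pairwise (· < ·) → l.Nodup := fun h => h.imp Nat.ne_of_lt
  have hsum : ∀ t, lc a.toFinset t + lc b.toFinset t = lc a'.toFinset t + lc b'.toFinset t := by
    intro t
    rw [lc_toFinset (hnd ha), lc_toFinset (hnd hb), lc_toFinset (hnd ha'), lc_toFinset (hnd hb'),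
      ← List.countP_append, ← List.countP_append, hp.countP_eq]
  have hrun : ∀ {a b : List ℕ}, a.Pairwise (· < ·) → b.Pairwise (· < ·) →
      RunMax (fun t => (lc a.toFinset t : ℤ) - lc b.toFinset t)
        (fun t => (lis (fun _ => 0) (a ++ b) t : ℤ) - lc b.toFinset t) := by
    intro a b ha hb
    have hF : Monotone (lc a.toFinset) := fun s t h => lc_mono _ h
    have e1 : lis (fun _ => 0) a = lc a.toFinset := funext fun t => lis_zero_inc ha t
    rw [lis_append, e1]
    constructor
    · intro s t hst
      have := (lis_inc hF hb t).1 s hst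
      omega
    · intro t
      obtain ⟨s, hs, h⟩ := (lis_inc hF hb t).2
      refine ⟨s, hs, ?_⟩
      omega
  have H := hrun ha hb
  have H' := hrun ha' hb'
  rw [← hl] at H'
  obtain ⟨c, h1, h2, h3, h4⟩ := H.single_jump H'
    (d := fun t => (lc a.toFinset t : ℤ) - lc a'.toFinset t)
    (fun t => by have := hsum t; omega) (fun t => by have := hsum t; omega)
    (fun t => by
      have e0 := hsum t
      have e1 := hsum (t + 1)
      have ea := lc_succ a.toFinset t
      have ea' := lc_succ a'.toFinset t
      have eb := lc_succ b.toFinset t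
      have eb' := lc_succ b'.toFinset t
      split_ifs at ea ea' eb eb' <;> omega)
    (by simp [lc_zero])
    ⟨(a ++ a').sum + 1, fun t ht => by
      have hle : ∀ x ∈ a ++ a', x < t := fun x hx => by
        have := List.single_le_sum (l := a ++ a') (by simp) x hx
        omega
      rw [lc_of_ge fun x hx => hle x (by simp at hx; simp [hx]),
        lc_of_ge fun x hx => hle x (by simp at hx; simp [hx]),
        List.toFinset_card_of_nodup (hnd ha), List.toFinset_card_of_nodup (hnd ha'), hlen]
      omega⟩
  have key : ∀ x, (x ≠ c → (x ∈ a' ↔ x ∈ a) ∧ (x ∈ b' ↔ x ∈ b)) := by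
    intro x hx
    rw [← List.mem_toFinset, ← List.mem_toFinset (l := a), ← List.mem_toFinset (l := b'),
      ← List.mem_toFinset (l := b), mem_iff_lc, mem_iff_lc, mem_iff_lc, mem_iff_lc]
    have e0 := hsum x
    have e1 := hsum (x + 1)
    rcases Nat.lt_or_gt_of_ne hx with h | h
    · have := h1 x h.le
      have := h1 (x + 1) h
      omega
    · have := h2 x h
      have := h2 (x + 1) (by omega)
      omega
  have hc : c ∈ a ∧ c ∉ a' ∧ c ∉ b ∧ c ∈ b' := by
    rw [← List.mem_toFinset, ← List.mem_toFinset (l := a'), ← List.mem_toFinset (l := b'),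
      ← List.mem_toFinset (l := b)]
    have e0 := hsum c
    have e1 := hsum (c + 1)
    have e2 := h1 c le_rfl
    have e3 := h2 (c + 1) (by omega)
    have ea := lc_succ a.toFinset c
    have ea' := lc_succ a'.toFinset c
    have eb := lc_succ b.toFinset c
    have eb' := lc_succ b'.toFinset c
    split_ifs at ea ea' eb eb' <;> first | omega | tauto
  refine ⟨c, hc.1, hc.2.2.1, fun x => ?_, fun x => ?_, h3, h4⟩
  · by_cases hx : x = c
    · subst hx
      tauto
    · have := key x hx
      tauto
  · by_cases hx : x = c
    · subst hx
      tauto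
    · have := key x hx
      tauto


/-- Each column of `Y` with index in `S` has one box more than that of `X`, in a row below which
the columns of `X` propagate to the right; the other columns agree. -/
structure Step (X Y : ℕ → Finset ℕ) (S : Finset ℕ) : Prop where
  fix : ∀ c ∉ S, Y c = X c
  ins : ∀ c ∈ S, ∃ r, r ∉ X c ∧ Y c = insert r (X c) ∧ ∀ r' ∈ X c, r' < r → r' ∈ X (c + 1)
  anti : ∀ c, Y (c + 1) ⊆ Y c

/-- The excess of `S` over `D` to the left of `t`. -/
def exc (S D : Finset ℕ) (t : ℕ) : ℤ := (lc S t : ℤ) - lc D t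

theorem exc_succ (S D : Finset ℕ) (t : ℕ) :
    exc S D (t + 1) = exc S D t + (if t ∈ S then 1 else 0) - (if t ∈ D then 1 else 0) := by
  unfold exc
  rw [lc_succ, lc_succ]
  push_cast
  ring

/-- Two chains of steps with the same ends, whose index sets differ by moving `e` from the first
to the second set at the first maximum of the excess. -/
structure Move (X Y Y' Z : ℕ → Finset ℕ) (S D S' D' : Finset ℕ) (e : ℕ) : Prop where
  anti : ∀ c, X (c + 1) ⊆ X c
  s1 : Step X Y S
  s2 : Step Y Z D
  s1' : Step X Y' S'
  s2' : Step Y' Z D'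
  memS : e ∈ S
  memD : e ∉ D
  hS' : ∀ x, x ∈ S' ↔ x ∈ S ∧ x ≠ e
  hD' : ∀ x, x ∈ D' ↔ x ∈ D ∨ x = e
  le : ∀ t, exc S D t ≤ exc S D (e + 1)
  lt : ∀ t ≤ e, exc S D t < exc S D (e + 1)

theorem Step.mem {X Y : ℕ → Finset ℕ} {S : Finset ℕ} (h : Step X Y S) {c r : ℕ} (h1 : r ∈ Y c)
    (h2 : r ∉ X c) : c ∈ S := by
  by_contra hc
  rw [h.fix c hc] at h1
  exact h2 h1

theorem Step.sub {X Y : ℕ → Finset ℕ} {S : Finset ℕ} (h : Step X Y S) (c : ℕ) : X c ⊆ Y c := by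
  by_cases hc : c ∈ S
  · obtain ⟨r, -, e, -⟩ := h.ins c hc
    rw [e]
    exact Finset.subset_insert _ _
  · rw [h.fix c hc]

theorem Step.uniq {X Y : ℕ → Finset ℕ} {S : Finset ℕ} (h : Step X Y S) {c r r' : ℕ} (h1 : r ∈ Y c)
    (h2 : r ∉ X c) (h3 : r' ∈ Y c) (h4 : r' ∉ X c) : r = r' := by
  obtain ⟨x, -, e, -⟩ := h.ins c (h.mem h1 h2)
  rw [e, Finset.mem_insert] at h1 h3
  rw [h1.resolve_right h2, h3.resolve_right h4]

theorem Step.prop {X Y : ℕ → Finset ℕ} {S : Finset ℕ} (h : Step X Y S) {c r r' : ℕ} (h1 : r ∈ Y c)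
    (h2 : r ∉ X c) (h3 : r' ∈ X c) (h4 : r' < r) : r' ∈ X (c + 1) := by
  obtain ⟨x, -, e, hb⟩ := h.ins c (h.mem h1 h2)
  rw [e, Finset.mem_insert] at h1
  exact hb r' h3 (h1.resolve_right h2 ▸ h4)

theorem Step.new {X Y : ℕ → Finset ℕ} {S : Finset ℕ} (h : Step X Y S) {c : ℕ} (hc : c ∈ S) :
    ∃ r, r ∈ Y c ∧ r ∉ X c := by
  obtain ⟨x, h1, e, -⟩ := h.ins c hc
  exact ⟨x, by simp [e], h1⟩

section
variable {X Y Y' Z : ℕ → Finset ℕ} {S D S' D' : Finset ℕ} {e : ℕ}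

theorem step_chain (hX : ∀ c, X (c + 1) ⊆ X c) (s1 : Step X Y S) (s2 : Step Y Z D) {c ρ : ℕ}
    (h1 : ρ ∈ Y c) (h2 : ρ ∉ X c) (hc : c ∈ D) (h3 : ∀ z ∈ Z c, z ∉ Y c → ρ < z) :
    ρ ∈ Y (c + 1) ∧ ρ ∉ X (c + 1) ∧ c + 1 ∈ S ∧ ∀ z ∈ Z (c + 1), z ∉ Y (c + 1) → ρ < z := by
  obtain ⟨z0, hz0, hz1⟩ := s2.new hc
  have h4 := h3 z0 hz0 hz1
  have h5 : ρ ∈ Y (c + 1) := s2.prop hz0 hz1 h1 h4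
  have h6 : ρ ∉ X (c + 1) := fun h => h2 (hX c h)
  refine ⟨h5, h6, s1.mem h5 h6, fun z hz hz' => ?_⟩
  by_cases hzY : z ∈ Y c
  · by_contra hle
    exact hz' (s2.prop hz0 hz1 hzY (by omega))
  · exact h3 z (s2.anti c hz) hzY

/-- Reading up to row `r` in column `c`, the excess of the new boxes. -/
def boxExc (X Y Z : ℕ → Finset ℕ) (S D : Finset ℕ) (r : ℤ) (c : ℕ) : ℤ :=
  exc S D c + (if ∃ m : ℕ, (m ∈ Y c ∧ m ∉ X c) ∧ (m : ℤ) ≤ r then 1 else 0) -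
    (if ∃ m : ℕ, (m ∈ Z c ∧ m ∉ Y c) ∧ (m : ℤ) ≤ r then 1 else 0)

theorem Move.boxExc_le (H : Move X Y Y' Z S D S' D' e) (r : ℤ) (c : ℕ) :
    boxExc X Y Z S D r c ≤ exc S D (e + 1) := by
  have h0 := H.le c
  unfold boxExc
  split_ifs with h1 h2
  · omega
  · obtain ⟨ρ, ⟨h3, h4⟩, h5⟩ := h1
    by_contra hgt
    have hz : ∀ z ∈ Z c, z ∉ Y c → ρ < z := by
      intro z hz hz'
      by_contra hle
      exact h2 ⟨z, ⟨hz, hz'⟩, by omega⟩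
    have hall : ∀ j, (ρ ∈ Y (c + j) ∧ ρ ∉ X (c + j) ∧ ∀ z ∈ Z (c + j), z ∉ Y (c + j) → ρ < z) ∧
        exc S D (c + j) = exc S D (e + 1) := by
      intro j
      induction j with
      | zero => exact ⟨⟨h3, h4, hz⟩, by simp only [Nat.add_zero]; omega⟩
      | succ j ih =>
        obtain ⟨⟨i1, i2, i3⟩, i4⟩ := ih
        have i5 := exc_succ S D (c + j)
        rw [if_pos (H.s1.mem i1 i2)] at i5
        have i6 := H.le (c + j + 1)
        have i7 : c + j ∈ D := by
          by_contra hn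
          rw [if_neg hn] at i5
          omega
        rw [if_pos i7] at i5
        obtain ⟨k1, k2, -, k3⟩ := step_chain H.anti H.s1 H.s2 i1 i2 i7 i3
        exact ⟨⟨k1, k2, k3⟩, by rw [← Nat.add_assoc]; omega⟩
    obtain ⟨N, hN⟩ := S.exists_nat_subset_range
    have := hN (H.s1.mem (hall N).1.1 (hall N).1.2.1)
    simp at this
  · omega
  · omega

theorem Move.boxExc_last (H : Move X Y Y' Z S D S' D' e) {ρ : ℕ} (h1 : ρ ∈ Y e) (h2 : ρ ∉ X e) :
    boxExc X Y Z S D ρ e = exc S D (e + 1) := by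
  unfold boxExc
  rw [exc_succ, if_pos H.memS, if_neg H.memD, if_pos ⟨ρ, ⟨h1, h2⟩, le_rfl⟩, if_neg]
  rintro ⟨m, ⟨h3, h4⟩, -⟩
  exact H.memD (H.s2.mem h3 h4)

/-- The data of the first column `k` with a maximal box. -/
structure FirstMax (X Y Z : ℕ → Finset ℕ) (S D : Finset ℕ) (e k ρ : ℕ) : Prop where
  le : k ≤ e
  memY : ρ ∈ Y k
  memX : ρ ∉ X k
  eq : boxExc X Y Z S D ρ k = exc S D (e + 1)
  min : ∀ c < k, ∀ r : ℕ, r ∈ Z c → boxExc X Y Z S D r c ≠ exc S D (e + 1)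

theorem Move.row (H : Move X Y Y' Z S D S' D' e) {k : ℕ} (hk : k ≤ e) {r : ℤ}
    (hr : boxExc X Y Z S D r k = exc S D (e + 1)) : ∃ ρ, ρ ∈ Y k ∧ ρ ∉ X k ∧ (ρ : ℤ) ≤ r ∧
      boxExc X Y Z S D ρ k = exc S D (e + 1) ∧ exc S D k = exc S D (e + 1) - 1 ∧
      ∀ z ∈ Z k, z ∉ Y k → ρ < z := by
  have h0 := H.lt k hk
  unfold boxExc at hr ⊢
  split_ifs at hr with h1 h2 h2
  · omega
  · obtain ⟨ρ, ⟨h3, h4⟩, h5⟩ := h1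
    have h6 : ∀ z ∈ Z k, z ∉ Y k → ρ < z := by
      intro z hz hz'
      by_contra hle
      exact h2 ⟨z, ⟨hz, hz'⟩, by omega⟩
    refine ⟨ρ, h3, h4, h5, ?_, by omega, h6⟩
    rw [if_pos ⟨ρ, ⟨h3, h4⟩, le_rfl⟩, if_neg]
    · exact hr
    · rintro ⟨m, ⟨h7, h8⟩, h9⟩
      have := h6 m h7 h8
      omega
  · omega
  · omega

theorem Move.interval (H : Move X Y Y' Z S D S' D' e) {k ρ : ℕ}
    (F : FirstMax X Y Z S D e k ρ) {c : ℕ} (hkc : k ≤ c) (hce : c ≤ e) :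
    ρ ∈ Y c ∧ ρ ∉ X c ∧ (∀ z ∈ Z c, z ∉ Y c → ρ < z) ∧ exc S D c = exc S D (e + 1) - 1 ∧
      (c < e → c ∈ D) := by
  have hD : ∀ c, c < e → c ∈ S → exc S D c = exc S D (e + 1) - 1 → c ∈ D := by
    intro c h1 h2 h3
    by_contra h4
    have h5 := exc_succ S D c
    rw [if_pos h2, if_neg h4] at h5
    have := H.lt (c + 1) h1
    omega
  induction c, hkc using Nat.le_induction with
  | base =>
    obtain ⟨ρ', h1, h2, h3, -, h5, h6⟩ := H.row F.le F.eq
    obtain rfl := H.s1.uniq F.memY F.memX h1 h2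
    exact ⟨h1, h2, h6, h5, fun h => hD k h (H.s1.mem h1 h2) h5⟩
  | succ c hc ih =>
    obtain ⟨h1, h2, h3, h4, h5⟩ := ih (by omega)
    have h6 := h5 (by omega)
    obtain ⟨k1, k2, k4, k3⟩ := step_chain H.anti H.s1 H.s2 h1 h2 h6 h3
    have h7 := exc_succ S D c
    rw [if_pos (H.s1.mem h1 h2), if_pos h6] at h7
    exact ⟨k1, k2, k3, by omega, fun h => hD _ h k4 (by omega)⟩

theorem Move.end_eq (H : Move X Y Y' Z S D S' D' e) : Y' e = X e :=
  H.s1'.fix e fun h => ((H.hS' e).1 h).2 rfl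

theorem Move.beyond (H : Move X Y Y' Z S D S' D' e) {k ρ : ℕ}
    (F : FirstMax X Y Z S D e k ρ) {c : ℕ} (hec : e < c) (h1 : ρ ∈ Y c) : ρ ∈ X c := by
  by_contra h2
  have hY : ∀ c, e + 1 ≤ c → ρ ∈ Y c → ρ ∈ Y (e + 1) := by
    intro c hc
    induction c, hc using Nat.le_induction with
    | base => exact id
    | succ c hc ih => exact fun h => ih (H.s1.anti c h)
  have h3 := hY c hec h1
  obtain ⟨i1, i2, -, -, -⟩ := H.interval F F.le le_rfl
  have h4 : ρ ∉ X (e + 1) := fun h => i2 (H.anti e h)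
  have h5 := H.s1.mem h3 h4
  have h6 : e + 1 ∈ S' := (H.hS' _).2 ⟨h5, by omega⟩
  have h7 := exc_succ S D (e + 1)
  have h8 := H.le (e + 1 + 1)
  have h9 : e + 1 ∈ D := by
    by_contra h9
    rw [if_pos h5, if_neg h9] at h7
    omega
  obtain ⟨z, hz1, hz2⟩ := H.s2.new h9
  obtain ⟨y, hy1, hy2⟩ := H.s1'.new h6
  have hyX : y ∈ X e := H.end_eq ▸ H.s1'.anti e hy1
  have hyρ : y ≠ ρ := fun h => i2 (h ▸ hyX)
  have hyz : y = z := by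
    have hyZ := H.s2'.sub _ hy1
    by_cases hyY : y ∈ Y (e + 1)
    · exact absurd (H.s1.uniq hyY hy2 h3 h4) hyρ
    · exact H.s2.uniq hyZ hyY hz1 hz2
  have hρz : ρ < z := by
    by_contra hle
    exact hy2 (H.s1.prop i1 i2 hyX (by omega))
  have hle := H.boxExc_le ρ (e + 1)
  unfold boxExc at hle
  rw [if_pos ⟨ρ, ⟨h3, h4⟩, le_rfl⟩, if_neg] at hle
  · omega
  · rintro ⟨m, ⟨k1, k2⟩, k3⟩
    have := H.s2.uniq k1 k2 hz1 hz2
    omega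

/-- The two middle columns agree as soon as the next ones agree on the relevant box. -/
theorem Move.col_eq (H : Move X Y Y' Z S D S' D' e) {c : ℕ} (hce : c ≠ e)
    (h : ∀ r ∈ Z c, r ∉ X c → c ∈ S → c ∈ D → (∀ r' ∈ Z c, r' ∉ X c → r ≤ r') →
      (r ∈ Y (c + 1) ↔ r ∈ Y' (c + 1))) : Y' c = Y c := by
  have hcS : c ∈ S' ↔ c ∈ S := by rw [H.hS']; tauto
  have hcD : c ∈ D' ↔ c ∈ D := by rw [H.hD']; tauto
  by_cases hS : c ∈ S
  · by_cases hD : c ∈ D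
    · obtain ⟨y, hy1, hy2⟩ := H.s1.new hS
      obtain ⟨z, hz1, hz2⟩ := H.s2.new hD
      obtain ⟨y', hy1', hy2'⟩ := H.s1'.new (hcS.2 hS)
      obtain ⟨z', hz1', hz2'⟩ := H.s2'.new (hcD.2 hD)
      have hyZ := H.s2.sub c hy1
      have hyZ' := H.s2'.sub c hy1'
      have hzX : z ∉ X c := fun hx => hz2 (H.s1.sub c hx)
      have hzX' : z' ∉ X c := fun hx => hz2' (H.s1'.sub c hx)
      have hcase : ∀ x, x ∈ Z c → x ∉ X c → x = y ∨ x = z := by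
        intro x h1 h2
        by_cases hx : x ∈ Y c
        · exact Or.inl (H.s1.uniq hx h2 hy1 hy2)
        · exact Or.inr (H.s2.uniq h1 hx hz1 hz2)
      have hyz : y ≠ z := fun h => hz2 (h ▸ hy1)
      have hyz' : y' ≠ z' := fun h => hz2' (h ▸ hy1')
      have hy := hcase y' hyZ' hy2'
      have hz := hcase z' hz1' hzX'
      have hyy : y' = y := by
        by_contra hne
        have e1 : y' = z := by tauto
        have e2 : z' = y := by omega
        subst e1 e2
        rcases Nat.lt_or_gt_of_ne hyz with hlt | hlt
        · have h1 := h z' hyZ hy2 hS hD fun r' h1 h2 => by rcases hcase r' h1 h2 with h | h <;> omega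
          exact hz2' (H.s1'.anti c (h1.1 (H.s2.prop hz1 hz2 hy1 hlt)))
        · have h1 := h y' hyZ' hy2' hS hD fun r' h1 h2 => by
            rcases hcase r' h1 h2 with h | h <;> omega
          exact hz2 (H.s1.anti c (h1.2 (H.s2'.prop hz1' hz2' hy1' hlt)))
      subst hyy
      ext x
      constructor
      · intro hx
        by_cases hxX : x ∈ X c
        · exact H.s1.sub c hxX
        · rwa [H.s1'.uniq hx hxX hy1' hy2']
      · intro hx
        by_cases hxX : x ∈ X c
        · exact H.s1'.sub c hxX
        · rwa [H.s1.uniq hx hxX hy1 hy2]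
    · rw [← H.s2'.fix c fun h => hD (hcD.1 h), ← H.s2.fix c hD]
  · rw [H.s1'.fix c fun h => hS (hcS.1 h), H.s1.fix c hS]

theorem Move.right (H : Move X Y Y' Z S D S' D' e) {c : ℕ} (hc : e < c) : Y' c = Y c := by
  obtain ⟨N, hN⟩ := S.exists_nat_subset_range
  have key : ∀ d c, e < c → N ≤ c + d → Y' c = Y c := by
    intro d
    induction d with
    | zero =>
      intro c h1 h2
      refine H.col_eq (by omega) fun r _ _ h3 => ?_
      have := Finset.mem_range.1 (hN h3)
      omega
    | succ d ih =>
      intro c h1 h2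
      refine H.col_eq (by omega) fun r _ _ _ _ _ => ?_
      rw [ih (c + 1) (by omega) (by omega)]
  exact key N c hc (by omega)

theorem Move.middle (H : Move X Y Y' Z S D S' D' e) {k ρ : ℕ}
    (F : FirstMax X Y Z S D e k ρ) {c : ℕ} (hkc : k ≤ c) (hce : c ≤ e) (x : ℕ) :
    x ∈ Y' c ↔ x ∈ Z c ∧ x ≠ ρ := by
  have key : ∀ d c, k ≤ c → c + d = e → (x ∈ Y' c ↔ x ∈ Z c ∧ x ≠ ρ) ∧ ρ ∉ Y' c := by
    intro d
    induction d with
    | zero =>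
      rintro c hkc rfl
      obtain ⟨i1, i2, -, -, -⟩ := H.interval F (c := c) hkc le_rfl
      rw [show Y' c = X c from H.end_eq, H.s2.fix c H.memD]
      refine ⟨⟨fun h => ⟨H.s1.sub c h, fun h' => i2 (h' ▸ h)⟩, fun h => ?_⟩, i2⟩
      by_contra hx
      exact h.2 (H.s1.uniq h.1 hx i1 i2)
    | succ d ih =>
      rintro c hkc hce
      obtain ⟨i1, i2, i3, -, i5⟩ := H.interval F (c := c) hkc (by omega)
      have hD := i5 (by omega)
      have hS := H.s1.mem i1 i2
      obtain ⟨-, hn⟩ := ih (c + 1) (by omega) (by omega)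
      obtain ⟨y, hy1, hy2⟩ := H.s1'.new ((H.hS' c).2 ⟨hS, by omega⟩)
      obtain ⟨z, hz1, hz2⟩ := H.s2'.new ((H.hD' c).2 (Or.inl hD))
      have hcase : ∀ x, x ∈ Z c → x ∉ X c → x = ρ ∨ ρ < x := by
        intro x h1 h2
        by_cases hx : x ∈ Y c
        · exact Or.inl (H.s1.uniq hx h2 i1 i2)
        · exact Or.inr (i3 x h1 hx)
      have hzX : z ∉ X c := fun hx => hz2 (H.s1'.sub c hx)
      have hyρ : ρ ∉ Y' c := by
        intro h
        obtain rfl := H.s1'.uniq h i2 hy1 hy2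
        rcases hcase z hz1 hzX with h1 | h1
        · exact hz2 (h1 ▸ h)
        · exact hn (H.s2'.prop hz1 hz2 h h1)
      have hzρ : z = ρ := (H.s2'.uniq (H.s2.sub c i1) hyρ hz1 hz2).symm
      refine ⟨⟨fun h => ⟨H.s2'.sub c h, fun h' => hyρ (h' ▸ h)⟩, fun h => ?_⟩, hyρ⟩
      by_contra hx
      exact h.2 ((H.s2'.uniq h.1 hx hz1 hz2).trans hzρ)
  exact (key (e - c) c hkc (by omega)).1

theorem Move.left (H : Move X Y Y' Z S D S' D' e) {k ρ : ℕ}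
    (F : FirstMax X Y Z S D e k ρ) {c : ℕ} (hck : c < k) : Y' c = Y c := by
  have hke := F.le
  have key : ∀ d c, c + d + 1 = k → Y' c = Y c := by
    intro d
    induction d with
    | zero =>
      rintro c rfl
      refine H.col_eq (by omega) fun r hr1 hr2 hS hD hmin => ?_
      obtain ⟨i1, i2, i3, i4, i5⟩ := H.interval F le_rfl hke
      simp only [Nat.add_zero] at *
      have hρ : r ≠ ρ := by
        rintro rfl
        have h1 : r ∈ Y c := H.s1.anti c i1
        refine F.min c (by omega) r hr1 ?_
        have h2 := exc_succ S D c
        rw [if_pos hS, if_pos hD] at h2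
        unfold boxExc
        rw [if_pos ⟨r, ⟨h1, hr2⟩, le_rfl⟩, if_neg]
        · omega
        · rintro ⟨m, ⟨k1, k2⟩, k3⟩
          have := hmin m k1 fun h => k2 (H.s1.sub c h)
          have : r = m := by omega
          exact k2 (this ▸ h1)
      have hm := H.middle F le_rfl hke r
      rw [hm]
      refine ⟨fun h => ⟨H.s2.sub _ h, hρ⟩, fun h => ?_⟩
      by_contra hrY
      exfalso
      have h3 := i3 r h.1 hrY
      have hρc : ρ ∈ Y c := H.s1.anti c i1
      have hρX : ρ ∈ X c := by
        by_contra hx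
        have := hmin ρ (H.s2.sub c hρc) hx
        omega
      obtain ⟨y, hy1, hy2⟩ := H.s1.new hS
      have := hmin y (H.s2.sub c hy1) hy2
      exact i2 (H.s1.prop hy1 hy2 hρX (by omega))
    | succ d ih =>
      rintro c hc
      refine H.col_eq (by omega) fun r _ _ _ _ _ => ?_
      rw [ih (c + 1) (by omega)]
  exact key (k - c - 1) c (by omega)

end


theorem ncard_boxes {S : Finset ℕ} {P : ℕ → ℕ → Prop} (h0 : ∀ m c, P m c → c ∈ S)
    (h1 : ∀ c ∈ S, ∃ m, P m c) (hu : ∀ m m' c, P m c → P m' c → m = m') (r : ℤ) (c : ℕ) :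
    {p : ℤ × ℕ | (∃ m k : ℕ, p.1 = m ∧ p.2 = k + 1 ∧ P m k) ∧
      (p.2 < c + 1 ∨ (p.2 = c + 1 ∧ p.1 ≤ r))}.ncard =
      lc S c + if ∃ m : ℕ, P m c ∧ (m : ℤ) ≤ r then 1 else 0 := by
  choose! y hy using h1
  have e1 : {p : ℤ × ℕ | (∃ m k : ℕ, p.1 = m ∧ p.2 = k + 1 ∧ P m k) ∧
      (p.2 < c + 1 ∨ (p.2 = c + 1 ∧ p.1 ≤ r))} =
      ↑((S.filter fun k => k < c ∨ (k = c ∧ (y k : ℤ) ≤ r)).image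
        fun k => (((y k : ℕ) : ℤ), k + 1)) := by
    ext ⟨a, b⟩
    simp only [Set.mem_ofPred_eq, Finset.coe_image, Finset.coe_filter, Set.mem_image, Prod.mk.injEq]
    constructor
    · rintro ⟨⟨m, k, rfl, rfl, hP⟩, h⟩
      have hk := h0 m k hP
      obtain rfl := hu _ _ _ hP (hy k hk)
      exact ⟨k, ⟨hk, by omega⟩, rfl, rfl⟩
    · rintro ⟨k, ⟨hk, h⟩, rfl, rfl⟩
      exact ⟨⟨y k, k, rfl, rfl, hy k hk⟩, by omega⟩
  have hinj : Function.Injective fun k => (((y k : ℕ) : ℤ), k + 1) := fun a b h =>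
    Nat.succ_injective (congrArg Prod.snd h)
  rw [e1, Set.ncard_coe_finset, Finset.card_image_of_injective _ hinj]
  by_cases hc : ∃ m : ℕ, P m c ∧ (m : ℤ) ≤ r
  · obtain ⟨m, hm, hmr⟩ := id hc
    have hcS := h0 m c hm
    obtain rfl := hu _ _ _ hm (hy c hcS)
    rw [if_pos hc, lc, ← Finset.card_insert_of_notMem (a := c) (s := S.filter (· < c)) (by simp)]
    congr 1
    ext k
    simp only [Finset.mem_filter, Finset.mem_insert]
    constructor
    · rintro ⟨h1, h2 | h2⟩
      · exact Or.inr ⟨h1, h2⟩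
      · exact Or.inl h2.1
    · rintro (rfl | h)
      · exact ⟨hcS, Or.inr ⟨rfl, hmr⟩⟩
      · exact ⟨h.1, Or.inl h.2⟩
  · rw [if_neg hc, lc, Nat.add_zero]
    congr 1
    ext k
    simp only [Finset.mem_filter]
    constructor
    · rintro ⟨h1, h2 | ⟨rfl, h2⟩⟩
      · exact ⟨h1, h2⟩
      · exact absurd ⟨y k, hy k h1, h2⟩ hc
    · exact fun h => ⟨h.1, Or.inl h.2⟩

theorem mi_eq {X Y Z : ℕ → Finset ℕ} {S D : Finset ℕ} (s1 : Step X Y S) (s2 : Step Y Z D)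
    {T : Tableau} {i : ℕ}
    (h1 : ∀ r c, T r c = i + 1 ↔ ∃ m k : ℕ, r = m ∧ c = k + 1 ∧ (m ∈ Y k ∧ m ∉ X k))
    (h2 : ∀ r c, T r c = i ↔ ∃ m k : ℕ, r = m ∧ c = k + 1 ∧ (m ∈ Z k ∧ m ∉ Y k))
    (r : ℤ) (c : ℕ) : mi T i r (c + 1) = boxExc X Y Z S D r c := by
  unfold mi boxExc exc
  simp only [h1, h2]
  rw [ncard_boxes (S := S) (P := fun m k => m ∈ Y k ∧ m ∉ X k) (fun m c h => s1.mem h.1 h.2)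
      (fun c hc => s1.new hc) (fun m m' c h h' => s1.uniq h.1 h.2 h'.1 h'.2),
    ncard_boxes (S := D) (P := fun m k => m ∈ Z k ∧ m ∉ Y k) (fun m c h => s2.mem h.1 h.2)
      (fun c hc => s2.new hc) (fun m m' c h h' => s2.uniq h.1 h.2 h'.1 h'.2)]
  push_cast
  ring

theorem keyE_of_move {X Y Y' Z : ℕ → Finset ℕ} {S D S' D' : Finset ℕ} {e : ℕ}
    (H : Move X Y Y' Z S D S' D' e) {T T' : Tableau} {i : ℕ}
    (h1 : ∀ r c, T r c = i + 1 ↔ ∃ m k : ℕ, r = m ∧ c = k + 1 ∧ (m ∈ Y k ∧ m ∉ X k))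
    (h2 : ∀ r c, T r c = i ↔ ∃ m k : ℕ, r = m ∧ c = k + 1 ∧ (m ∈ Z k ∧ m ∉ Y k))
    (h1' : ∀ r c, T' r c = i + 1 ↔ ∃ m k : ℕ, r = m ∧ c = k + 1 ∧ (m ∈ Y' k ∧ m ∉ X k))
    (h2' : ∀ r c, T' r c = i ↔ ∃ m k : ℕ, r = m ∧ c = k + 1 ∧ (m ∈ Z k ∧ m ∉ Y' k))
    (ho : ∀ r c, T r c ≠ i → T r c ≠ i + 1 → T' r c = T r c)
    (h0 : ∀ r c, T r c ≠ 0 → 1 ≤ c) (hZ : ∀ (m k : ℕ), m ∈ Z k → T m (k + 1) ≠ 0) :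
    keyE i T = some T' := by
  have hmi := mi_eq H.s1 H.s2 h1 h2
  set M := exc S D (e + 1) with hM
  have hM1 : 1 ≤ M := by
    have := H.lt 0 (by omega)
    simp only [exc, lc_zero] at this
    rw [hM]
    simp only [exc]
    omega
  have hle : ∀ r c, T r c ≠ 0 → mi T i r c ≤ M := by
    intro r c h
    obtain ⟨k, rfl⟩ := Nat.exists_eq_add_of_le' (h0 r c h)
    rw [hmi]
    exact H.boxExc_le r k
  obtain ⟨ρe, he1, he2⟩ := H.s1.new H.memS
  have hTe : T ρe (e + 1) ≠ 0 := hZ _ _ (H.s2.sub _ he1)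
  have hme : mi T i ρe (e + 1) = M := by rw [hmi, H.boxExc_last he1 he2]
  have hmax : ∀ r c, isMaxBox T i r c ↔ T r c ≠ 0 ∧ mi T i r c = M := by
    intro r c
    constructor
    · rintro ⟨h3, h4⟩
      exact ⟨h3, le_antisymm (hle r c h3) (hme ▸ h4 _ _ hTe)⟩
    · rintro ⟨h3, h4⟩
      exact ⟨h3, fun r' c' h => h4 ▸ hle r' c' h⟩
  have hex : ∃ r c, isMaxBox T i r c ∧ 1 ≤ mi T i r c :=
    ⟨ρe, e + 1, (hmax _ _).2 ⟨hTe, hme⟩, by omega⟩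
  have hne : {c | ∃ r, isMaxBox T i r c}.Nonempty := ⟨e + 1, ρe, (hmax _ _).2 ⟨hTe, hme⟩⟩
  have hcq := Nat.sInf_mem hne
  have hcqmin : ∀ c, (∃ r, isMaxBox T i r c) → sInf {c | ∃ r, isMaxBox T i r c} ≤ c :=
    fun c h => Nat.sInf_le h
  unfold keyE
  rw [dif_pos hex]
  simp only
  generalize sInf {c | ∃ r, isMaxBox T i r c} = cq at *
  obtain ⟨r0, hr0⟩ := hcq
  have hr0' := (hmax _ _).1 hr0
  obtain ⟨k, rfl⟩ := Nat.exists_eq_add_of_le' (h0 _ _ hr0'.1)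
  have hke : k ≤ e := by
    have := hcqmin (e + 1) ⟨ρe, (hmax _ _).2 ⟨hTe, hme⟩⟩
    omega
  obtain ⟨ρ, p1, p2, -, p4, p5, p6⟩ := H.row hke ((hmi r0 k).symm.trans hr0'.2)
  have hρmax : isMaxBox T i (ρ : ℤ) (k + 1) :=
    (hmax _ _).2 ⟨hZ _ _ (H.s2.sub _ p1), by rw [hmi, p4]⟩
  have hrq : sInf {m : ℕ | isMaxBox T i ((m : ℕ) : ℤ) (k + 1)} = ρ := by
    refine le_antisymm (Nat.sInf_le hρmax) ?_
    refine le_csInf ⟨ρ, hρmax⟩ fun m hm => ?_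
    have h3 := ((hmax _ _).1 hm).2
    rw [hmi] at h3
    obtain ⟨ρ', q1, q2, q3, -⟩ := H.row hke h3
    obtain rfl := H.s1.uniq p1 p2 q1 q2
    omega
  rw [hrq]
  have F : FirstMax X Y Z S D e k ρ := by
    refine ⟨hke, p1, p2, p4, fun c hc r hr h => ?_⟩
    have := hcqmin (c + 1) ⟨r, (hmax _ _).2 ⟨hZ _ _ hr, by rw [hmi, h]⟩⟩
    omega
  have hcond : ∀ c, (k + 1 ≤ c ∧ T (ρ : ℤ) c = i + 1) ↔ ∃ j, c = j + 1 ∧ k ≤ j ∧ j ≤ e := by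
    intro c
    rw [h1]
    constructor
    · rintro ⟨h3, m, j, h4, rfl, h5, h6⟩
      have : ρ = m := by exact_mod_cast h4
      subst this
      refine ⟨j, rfl, by omega, ?_⟩
      by_contra hlt
      exact h6 (H.beyond F (by omega) h5)
    · rintro ⟨j, rfl, h3, h4⟩
      obtain ⟨i1, i2, -⟩ := H.interval F h3 h4
      exact ⟨by omega, ρ, j, rfl, rfl, i1, i2⟩
  have h1c : ∀ (m j : ℕ), T m (j + 1) = i + 1 ↔ m ∈ Y j ∧ m ∉ X j := by
    intro m j
    rw [h1]
    constructor
    · rintro ⟨m', j', h3, h4, h5⟩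
      have e1 : m = m' := by exact_mod_cast h3
      have e2 : j = j' := by omega
      subst e1 e2
      exact h5
    · exact fun h => ⟨m, j, rfl, rfl, h⟩
  have h2c : ∀ (m j : ℕ), T m (j + 1) = i ↔ m ∈ Z j ∧ m ∉ Y j := by
    intro m j
    rw [h2]
    constructor
    · rintro ⟨m', j', h3, h4, h5⟩
      have e1 : m = m' := by exact_mod_cast h3
      have e2 : j = j' := by omega
      subst e1 e2
      exact h5
    · exact fun h => ⟨m, j, rfl, rfl, h⟩
  congr 1
  funext r c
  simp only [hcond]
  split_ifs with hc ha hb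
  · obtain ⟨j, rfl, h3, h4⟩ := hc
    obtain ⟨m, j', rfl, hj, h5, h6⟩ := (h1 _ _).1 ha
    obtain rfl : j = j' := by omega
    obtain ⟨i1, i2, -⟩ := H.interval F h3 h4
    obtain rfl := H.s1.uniq h5 h6 i1 i2
    refine ((h2' _ _).2 ⟨m, j, rfl, rfl, H.s2.sub _ h5, fun h => ?_⟩).symm
    exact ((H.middle F h3 h4 m).1 h).2 rfl
  · obtain ⟨j, rfl, h3, h4⟩ := hc
    obtain ⟨m, j', rfl, hj, h5, h6⟩ := (h2 _ _).1 hb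
    obtain rfl : j = j' := by omega
    obtain ⟨i1, i2, -⟩ := H.interval F h3 h4
    refine ((h1' _ _).2 ⟨m, j, rfl, rfl, (H.middle F h3 h4 m).2 ⟨h5, fun h => h6 (h ▸ i1)⟩,
      fun h => h6 (H.s1.sub _ h)⟩).symm
  · exact (ho r c hb ha).symm
  · by_cases hA : T r c = i + 1
    · obtain ⟨m, j, rfl, rfl, h5, h6⟩ := (h1 _ _).1 hA
      have hY : Y' j = Y j := by
        rcases Nat.lt_or_ge j k with h | h
        · exact H.left F h
        · exact H.right (by by_contra h'; exact hc ⟨j, rfl, h, by omega⟩)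
      rw [hA]
      exact ((h1' _ _).2 ⟨m, j, rfl, rfl, hY ▸ h5, h6⟩).symm
    · by_cases hB : T r c = i
      · obtain ⟨m, j, rfl, rfl, h5, h6⟩ := (h2 _ _).1 hB
        have hY : Y' j = Y j := by
          rcases Nat.lt_or_ge j k with h | h
          · exact H.left F h
          · exact H.right (by by_contra h'; exact hc ⟨j, rfl, h, by omega⟩)
        rw [hB]
        exact ((h2' _ _).2 ⟨m, j, rfl, rfl, h5, hY ▸ h6⟩).symm
      · exact (ho r c hB hA).symm


theorem cols_length {u : List ℕ} : ∀ {C cs C'}, Cols C u cs C' → cs.length = u.length := by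
  induction u with
  | nil =>
    intro C cs C' h
    obtain ⟨rfl, -⟩ := cols_nil_inv h
    rfl
  | cons x u ih =>
    intro C cs C' h
    obtain ⟨c, C1, ds, -, h2, rfl⟩ := cols_cons_inv h
    simp [ih h2]

theorem cols_keyCol {u : List ℕ} : ∀ {C cs C'}, AllM C → Cols C u cs C' → u.Pairwise (· < ·) →
    ∀ c, (c ∉ cs → keyCol C' c = keyCol C c) ∧ (c ∈ cs → ∃ r, r ∉ keyCol C c ∧
      keyCol C' c = insert r (keyCol C c) ∧
      ∀ r' ∈ keyCol C c, r' < r → r' ∈ keyCol C (c + 1)) := by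
  induction u with
  | nil =>
    intro C cs C' hC h _ c
    obtain ⟨rfl, rfl⟩ := cols_nil_inv h
    simp
  | cons x u ih =>
    intro C cs C' hC h hu c
    have hp := cols_pairwise hC h hu
    obtain ⟨d, C1, ds, h1, h2, rfl⟩ := cols_cons_inv h
    have hlt := (List.pairwise_cons.1 hp).1
    have hd : d ∉ ds := fun hd => lt_irrefl _ (hlt d hd)
    obtain ⟨i1, i2⟩ := ih (tins_isTab h1 hC).1 h2 (List.pairwise_cons.1 hu).2 c
    obtain ⟨j1, j2⟩ := tins_keyCol hC h1
    constructor
    · intro hc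
      rw [List.mem_cons, not_or] at hc
      rw [i1 hc.2, j1 c hc.1]
    · intro hc
      rcases List.mem_cons.1 hc with rfl | hc
      · rw [i1 hd]
        exact j2
      · have := hlt c hc
        rw [j1 c (by omega), j1 (c + 1) (by omega)] at i2
        exact i2 hc

theorem step_of_cols {u cs : List ℕ} {C C' : ℕ → Finset ℕ} (hC : AllM C) (h : Cols C u cs C')
    (hu : u.Pairwise (· < ·)) : Step (keyCol C) (keyCol C') cs.toFinset where
  fix c hc := (cols_keyCol hC h hu c).1 (by simpa using hc)
  ins c hc := (cols_keyCol hC h hu c).2 (by simpa using hc)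
  anti c := keyCol_succ_subset (cols_allM hC h) c

theorem foldr_range_succ (f : ℕ → List ℕ) (m i : ℕ) :
    ((((List.range (m + 1)).reverse).filter (fun j => decide (i ≤ j))).map f).foldr (· ++ ·) [] =
      (if i ≤ m then f m else []) ++
      ((((List.range m).reverse).filter (fun j => decide (i ≤ j))).map f).foldr (· ++ ·) [] := by
  rw [List.range_succ, List.reverse_append, List.reverse_singleton, List.singleton_append,
    List.filter_cons]
  by_cases h : i ≤ m <;> simp [h]

theorem foldr_range_of_le (f : ℕ → List ℕ) {m i : ℕ} (h : m ≤ i) :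
    ((((List.range m).reverse).filter (fun j => decide (i ≤ j))).map f).foldr (· ++ ·) [] = [] := by
  induction m with
  | zero => rfl
  | succ m ih => rw [foldr_range_succ, ih (by omega), if_neg (by omega)]; rfl

theorem foldr_range_split (f : ℕ → List ℕ) {m i : ℕ} (h : i < m) :
    ((((List.range m).reverse).filter (fun j => decide (i ≤ j))).map f).foldr (· ++ ·) [] =
      ((((List.range m).reverse).filter (fun j => decide (i + 1 ≤ j))).map f).foldr (· ++ ·) [] ++
        f i := by
  induction m with
  | zero => omega
  | succ m ih =>
    rw [foldr_range_succ, foldr_range_succ f m (i + 1), if_pos (by omega)]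
    rcases Nat.eq_or_lt_of_le (Nat.le_of_lt_succ h) with rfl | hlt
    · rw [foldr_range_of_le f le_rfl, foldr_range_of_le f (Nat.le_succ i), if_neg (by omega)]
      simp
    · rw [ih hlt, if_pos (by omega), List.append_assoc]

section
variable {f : ℕ → List ℕ} {n : ℕ}

theorem topIdx_le (hf : ∀ j, n < j → f j = []) : topIdx f ≤ n :=
  csSup_le' fun j hj => by
    by_contra hlt
    exact hj (hf j (by omega))

theorem factWordGe_of_lt (hf : ∀ j, n < j → f j = []) {i : ℕ} (hi : n < i) :
    factWordGe f i = [] :=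
  foldr_range_of_le f (by have := topIdx_le hf; omega)

theorem factWordGe_eq (hf : ∀ j, n < j → f j = []) (i : ℕ) :
    factWordGe f i = factWordGe f (i + 1) ++ f i := by
  rcases Nat.lt_or_ge (topIdx f) i with h | h
  · have h1 : f i = [] := by
      by_contra hne
      have : i ≤ topIdx f := le_csSup ⟨n, fun j hj => by
        by_contra hlt
        exact hj (hf j (by omega))⟩ hne
      omega
    unfold factWordGe
    rw [h1, foldr_range_of_le f (by omega), foldr_range_of_le f (by omega)]
    rfl
  · exact foldr_range_split f (by omega)

theorem factWordGe_congr {g : ℕ → List ℕ} (hf : ∀ j, n < j → f j = [])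
    (hg : ∀ j, n < j → g j = []) {i : ℕ} (h : ∀ j, i ≤ j → f j = g j) {j : ℕ} (hj : i ≤ j) :
    factWordGe f j = factWordGe g j := by
  have key : ∀ d j, i ≤ j → n < j + d → factWordGe f j = factWordGe g j := by
    intro d
    induction d with
    | zero =>
      intro j _ h2
      rw [factWordGe_of_lt hf (by omega), factWordGe_of_lt hg (by omega)]
    | succ d ih =>
      intro j h1 h2
      rw [factWordGe_eq hf, factWordGe_eq hg, ih (j + 1) (by omega) (by omega), h j h1]
  exact key (n + 1) j hj (by omega)

theorem factWordGe_reduced (hf : ∀ j, n < j → f j = []) (hr : IsReducedWord (factWord f)) (j : ℕ) :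
    IsReducedWord (factWordGe f j) := by
  induction j with
  | zero => exact hr
  | succ j ih =>
    rw [factWordGe_eq hf] at ih
    exact reduced_left ih

theorem hatP_nil (r : ℤ) (c : ℕ) : hatP [] r c = 0 := by
  have hr : IsReducedWord [] := ⟨fun x hx => by simp at hx, fun σ _ _ => by simp⟩
  obtain ⟨C, hC⟩ := tab_exists hr
  by_contra h
  have := keyCol_mem hC ((hatP_iff hr hC r c).1 h).2.2
  simp at this

theorem hatP_append {W u : List ℕ} (hr : IsReducedWord (W ++ u)) {r : ℤ} {c : ℕ}
    (h : hatP W r c ≠ 0) : hatP (W ++ u) r c ≠ 0 := by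
  have hW := reduced_left hr
  obtain ⟨C, hC⟩ := tab_exists hW
  obtain ⟨cs, C', h1, h2⟩ := cols_exists hC hr
  obtain ⟨i1, i2, i3⟩ := (hatP_iff hW hC r c).1 h
  exact (hatP_iff hr h2 r c).2 ⟨i1, i2, cols_keyCol_subset hC.1 h1 _ i3⟩

end

/-- `P` is a decreasing family of propositions which is eventually false. -/
structure Levels (P : ℕ → Prop) : Prop where
  step : ∀ j, P (j + 1) → P j
  bdd : ∃ N, ∀ j, N < j → ¬ P j

/-- The last level of a decreasing family. -/
def level (P : ℕ → Prop) : ℕ := sSup {j | 1 ≤ j ∧ P j ∧ ¬ P (j + 1)}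

theorem Levels.mono {P : ℕ → Prop} (H : Levels P) {i j : ℕ} (h : i ≤ j) (hj : P j) : P i := by
  induction j, h using Nat.le_induction with
  | base => exact hj
  | succ j _ ih => exact ih (H.step j hj)

theorem Levels.eq_iff {P : ℕ → Prop} (H : Levels P) {j : ℕ} (hj : 1 ≤ j) :
    level P = j ↔ P j ∧ ¬ P (j + 1) := by
  obtain ⟨N, hN⟩ := H.bdd
  constructor
  · rintro rfl
    have hne : {j | 1 ≤ j ∧ P j ∧ ¬ P (j + 1)}.Nonempty := by
      by_contra hne
      rw [Set.not_nonempty_iff_eq_empty] at hne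
      rw [level, hne] at hj
      simp at hj
    exact (Nat.sSup_mem hne ⟨N, fun j hj => by
      by_contra hlt
      exact hN j (by omega) hj.2.1⟩).2
  · rintro ⟨h1, h2⟩
    have e : {j | 1 ≤ j ∧ P j ∧ ¬ P (j + 1)} = {j} := by
      ext k
      constructor
      · rintro ⟨-, h3, h4⟩
        change k = j
        rcases Nat.lt_trichotomy k j with h | h | h
        · exact absurd (H.mono h h1) h4
        · exact h
        · exact absurd (H.mono h h3) h2
      · rintro rfl
        exact ⟨hj, h1, h2⟩
    rw [level, e]
    exact csSup_singleton j

theorem Levels.ne_zero {P : ℕ → Prop} (H : Levels P) {j : ℕ} (hj : 1 ≤ j) (h : P j) :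
    level P ≠ 0 := by
  obtain ⟨N, hN⟩ := H.bdd
  have key : ∀ d j, 1 ≤ j → P j → N < j + d → level P ≠ 0 := by
    intro d
    induction d with
    | zero => exact fun j _ h1 h2 => absurd h1 (hN j h2)
    | succ d ih =>
      intro j hj h1 h2
      by_cases h3 : P (j + 1)
      · exact ih (j + 1) (by omega) h3 (by omega)
      · rw [(H.eq_iff hj).2 ⟨h1, h3⟩]
        omega
  exact key (N + 1) j hj h (by omega)

theorem Levels.congr {P P' : ℕ → Prop} (H : Levels P) (H' : Levels P') {i : ℕ} (hi : 1 ≤ i)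
    (h : ∀ j, j ≠ i + 1 → (P' j ↔ P j)) (h1 : level P ≠ i) (h2 : level P ≠ i + 1) :
    level P' = level P := by
  by_cases h0 : level P = 0
  · rw [h0]
    by_contra h3
    have h4 := (H'.eq_iff (j := level P') (by omega)).1 rfl
    by_cases h5 : level P' = i + 1
    · rw [h5] at h4
      exact H.ne_zero hi ((h i (by omega)).1 (H'.mono (Nat.le_succ i) h4.1)) h0
    · exact H.ne_zero (j := level P') (by omega) ((h _ h5).1 h4.1) h0
  · rw [H'.eq_iff (by omega), h _ h2, h _ (by omega)]
    exact (H.eq_iff (by omega)).1 rfl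

theorem hatQfact_eq (f : ℕ → List ℕ) (r : ℤ) (c : ℕ) :
    hatQfact f r c = level fun j => hatP (factWordGe f j) r c ≠ 0 := by
  simp only [hatQfact, level, not_not]

theorem levels_hatP {f : ℕ → List ℕ} {n : ℕ} (hf : ∀ j, n < j → f j = [])
    (hr : IsReducedWord (factWord f)) (r : ℤ) (c : ℕ) :
    Levels fun j => hatP (factWordGe f j) r c ≠ 0 := by
  refine ⟨fun j h => ?_, n, fun j hj h => h ?_⟩
  · have := factWordGe_reduced hf hr j
    rw [factWordGe_eq hf] at this ⊢
    exact hatP_append this h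
  · rw [factWordGe_of_lt hf hj, hatP_nil]

theorem hatP_diff {W W' : List ℕ} {C C' : ℕ → Finset ℕ} (hW : IsReducedWord W) (h : Tab W C)
    (hW' : IsReducedWord W') (h' : Tab W' C') (r : ℤ) (c : ℕ) :
    (hatP W r c ≠ 0 ∧ ¬ hatP W' r c ≠ 0) ↔
      ∃ m k : ℕ, r = m ∧ c = k + 1 ∧ (m ∈ keyCol C k ∧ m ∉ keyCol C' k) := by
  rw [hatP_iff hW h, hatP_iff hW' h']
  constructor
  · rintro ⟨⟨h1, h2, h3⟩, h4⟩
    exact ⟨r.toNat, c - 1, by omega, by omega, h3, fun h5 => h4 ⟨h1, h2, h5⟩⟩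
  · rintro ⟨m, k, rfl, rfl, h1, h2⟩
    have := keyCol_pos hW h h1
    simp only [Int.toNat_natCast, Nat.add_sub_cancel]
    exact ⟨⟨by omega, by omega, h1⟩, fun h3 => h2 h3.2.2⟩

theorem intertwine {f g : ℕ → List ℕ} {n i : ℕ} (hf : ∀ j, n < j → f j = [])
    (hinc : ∀ j, (f j).Pairwise (· < ·)) (hr : IsReducedWord (factWord f)) (hi : 1 ≤ i)
    (hin : i < n) (hg : msE i f = some g) :
    hatP (factWord g) = hatP (factWord f) ∧ keyE i (hatQfact f) = some (hatQfact g) := by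
  have hW := factWordGe_reduced hf hr
  have e2 : factWordGe f i = factWordGe f (i + 2) ++ f (i + 1) ++ f i := by
    rw [factWordGe_eq hf i, factWordGe_eq hf (i + 1)]
  have hred : IsReducedWord (f (i + 1) ++ f i) := by
    have := hW i
    rw [e2, List.append_assoc] at this
    exact reduced_right this
  obtain ⟨K, L, p, q, hp, hq, hA, hB, rfl, hck⟩ := msE_spec hg (hinc _) (hinc _) hred
  set g := Function.update (Function.update f (i + 1) (inc K)) i (inc (insert q L)) with hgdef
  have g0 : g i = inc (insert q L) := by simp [hgdef]
  have g1 : g (i + 1) = inc K := by simp [hgdef]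
  have g2 : ∀ j, j ≠ i → j ≠ i + 1 → g j = f j := by
    intro j h1 h2
    simp [hgdef, h1, h2]
  rw [← hA, ← hB, ← g0, ← g1] at hck
  have hgn : ∀ j, n < j → g j = [] := fun j hj => by
    rw [g2 j (by omega) (by omega), hf j hj]
  have hup : ∀ j, i + 2 ≤ j → factWordGe g j = factWordGe f j := fun j hj =>
    factWordGe_congr hgn hf (fun k hk => g2 k (by omega) (by omega)) hj
  have e2' : factWordGe g i = factWordGe f (i + 2) ++ g (i + 1) ++ g i := by
    rw [factWordGe_eq hgn i, factWordGe_eq hgn (i + 1), hup _ le_rfl]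
  have hdown : ∀ d j, j + d = i → CKEquiv (factWordGe f j) (factWordGe g j) := by
    intro d
    induction d with
    | zero =>
      rintro j rfl
      simp only [Nat.add_zero] at *
      rw [e2, e2', List.append_assoc, List.append_assoc]
      exact ck_left _ hck
    | succ d ih =>
      rintro j hj
      rw [factWordGe_eq hf, factWordGe_eq hgn, g2 j (by omega) (by omega)]
      exact ck_right _ (ih (j + 1) (by omega))
  have hle : ∀ j, j ≤ i → CKEquiv (factWordGe f j) (factWordGe g j) := fun j hj =>
    hdown (i - j) j (by omega)
  refine ⟨(hatP_congr (hle 0 (Nat.zero_le i))).symm, ?_⟩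
  have hrg : IsReducedWord (factWord g) := ck_reduced (hle 0 (Nat.zero_le i)) hr
  have hWg := factWordGe_reduced hgn hrg
  have hY : factWordGe f (i + 1) = factWordGe f (i + 2) ++ f (i + 1) := factWordGe_eq hf _
  have hYg : factWordGe g (i + 1) = factWordGe f (i + 2) ++ g (i + 1) := by
    rw [factWordGe_eq hgn, hup _ le_rfl]
  have hZ : factWordGe f i = factWordGe f (i + 1) ++ f i := factWordGe_eq hf _
  have hZg : factWordGe g i = factWordGe g (i + 1) ++ g i := factWordGe_eq hgn _
  obtain ⟨C, hC⟩ := tab_exists (hW (i + 2))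
  obtain ⟨a, C1, a1, hC1⟩ := cols_exists hC (hY ▸ hW (i + 1))
  rw [← hY] at hC1
  obtain ⟨b, C2, b1, hC2⟩ := cols_exists hC1 (hZ ▸ hW i)
  rw [← hZ] at hC2
  obtain ⟨a', C1', a1', hC1'⟩ := cols_exists hC (hYg ▸ hWg (i + 1))
  rw [← hYg] at hC1'
  obtain ⟨b', C2', b1', hC2'⟩ := cols_exists hC1' (hZg ▸ hWg i)
  rw [← hZg] at hC2'
  obtain rfl := tab_uniq (hWg i) hC2' (tab_congr hC2 (hle i le_rfl))
  have hgA : (g (i + 1)).Pairwise (· < ·) := g1 ▸ inc_pairwise K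
  have hgB : (g i).Pairwise (· < ·) := g0 ▸ inc_pairwise _
  have hlenA : a.length = a'.length + 1 := by
    rw [cols_length a1, cols_length a1', hA, g1]
    simp [inc, hp]
  obtain ⟨e, k1, k2, k3, k4, k5, k6⟩ := sets_jump (cols_pairwise hC.1 a1 (hinc _))
    (cols_pairwise hC1.1 b1 (hinc _)) (cols_pairwise hC.1 a1' hgA) (cols_pairwise hC1'.1 b1' hgB)
    (cols_perm hC.1 (cols_append a1 b1) (cols_append a1' b1'))
    (lis_ck hck hC (by rw [← List.append_assoc, ← e2]; exact hW i) (cols_append a1 b1)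
      (cols_append a1' b1') fun _ _ _ => le_rfl) hlenA
  have H : Move (keyCol C) (keyCol C1) (keyCol C1') (keyCol C2') a.toFinset b.toFinset a'.toFinset
      b'.toFinset e :=
    { anti := fun c => keyCol_succ_subset hC.1 c
      s1 := step_of_cols hC.1 a1 (hinc _)
      s2 := step_of_cols hC1.1 b1 (hinc _)
      s1' := step_of_cols hC.1 a1' hgA
      s2' := step_of_cols hC1'.1 b1' hgB
      memS := by simpa using k1
      memD := by simpa using k2
      hS' := by simpa using k3
      hD' := by simpa using k4
      le := k5
      lt := k6 }
  have hlf := levels_hatP hf hr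
  have hlg := levels_hatP hgn hrg
  refine keyE_of_move H (T := hatQfact f) (T' := hatQfact g) (i := i) (fun r c => ?_)
    (fun r c => ?_) (fun r c => ?_) (fun r c => ?_) (fun r c => ?_) (fun r c h => ?_)
    (fun m k h => ?_)
  · rw [hatQfact_eq, (hlf r c).eq_iff (by omega)]
    exact hatP_diff (hW _) hC1 (hW _) hC r c
  · rw [hatQfact_eq, (hlf r c).eq_iff hi]
    exact hatP_diff (hW _) hC2 (hW _) hC1 r c
  · rw [hatQfact_eq, (hlg r c).eq_iff (by omega)]
    exact hatP_diff (hWg _) hC1' (hWg _) ((hup (i + 2) le_rfl).symm ▸ hC) r c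
  · rw [hatQfact_eq, (hlg r c).eq_iff hi]
    exact hatP_diff (hWg _) hC2' (hWg _) hC1' r c
  · rw [hatQfact_eq, hatQfact_eq]
    refine (hlf r c).congr (hlg r c) hi fun j hj => ?_
    rcases Nat.lt_or_ge i j with h | h
    · rw [hup j (by omega)]
    · rw [hatP_congr (hle j h)]
  · rw [hatQfact_eq] at h
    exact ((hatP_iff (hW _) (tab_exists (hW _)).choose_spec r c).1
      (((hlf r c).eq_iff (Nat.one_le_iff_ne_zero.2 h)).1 rfl).1).1
  · rw [hatQfact_eq]
    refine (hlf m (k + 1)).ne_zero hi ((hatP_iff (hW _) hC2 _ _).2 ⟨by omega, ?_, by simpa using h⟩)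
    have := keyCol_pos (hW _) hC2 h
    omega

end WeakEG

/-- Theorem `cor 4.6`.
For `ρ^• ∈ RFC_n(w, φ)` and `1 ≤ i < n`, if `e_i(ρ^•) ≠ 0` then
`P̂(e_i(ρ^•)) = P̂(ρ^•)` and `Q̂(e_i(ρ^•)) = e_i(Q̂(ρ^•))`, where on the right `e_i` is the
Assaf–Schilling raising operator on key tableaux. -/
theorem weak_EG_intertwines_crystal_operators (w : Equiv.Perm ℕ) (hw : FinitaryPerm w)
    (φ : ℕ → ℕ) (hφ : IsFlag φ) (n : ℕ) (hn : 1 ≤ n)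
    (f : ℕ → List ℕ) (hf : f ∈ RFCn n w φ) (i : ℕ) (hi1 : 1 ≤ i) (hin : i < n)
    (g : ℕ → List ℕ) (hg : msE i f = some g) :
    hatP (factWord g) = hatP (factWord f) ∧
      keyE i (hatQfact f) = some (hatQfact g) := by
  obtain ⟨⟨-, h1, h2, h3, -⟩, -⟩ := hf
  exact WeakEG.intertwine h1 (fun j => List.isChain_iff_pairwise.1 (h2 j)) h3 hi1 hin hg

end
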